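/- A commutative semigroup variety V with V ≠ COM is an upper-modular element of the lattice Com if and only if it is an upper-modular element of the lattice SEM. -/

import Mathlib

/-!
Formalization framework: semigroup varieties as Galois-closed equational theories
over the free semigroup on countably many letters.  A variety is represented by
its equational theory; the order `V ≤ W` ("V is a subvariety of W") is reverse
inclusion of theories.  `Com` is the lattice of commutative semigroup varieties,
realized as the subtype of varieties whose theory contains the commutative law.
-/

open FreeSemigroup

/-- Words: elements of the free semigroup over a countably infinite alphabet. -/
abbrev Word : Type := FreeSemigroup ℕ

/-- A semigroup identity `u = v`. -/
abbrev SgId : Type := Word × Word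

/-- `spow a n = a ^ (n + 1)` in any (multiplicative) semigroup. -/
def spow {M : Type*} [Mul M] (a : M) : ℕ → M
  | 0 => a
  | n + 1 => a * spow a n

/-- A semigroup `S` satisfies the identity `e.1 = e.2`. -/
def SatS (S : Type) [Semigroup S] (e : SgId) : Prop :=
  ∀ σ : ℕ → S, FreeSemigroup.lift σ e.1 = FreeSemigroup.lift σ e.2

/-- `S` is a model of the set of identities `E`. -/
def Models (S : Type) [Semigroup S] (E : Set SgId) : Prop :=
  ∀ e ∈ E, SatS S e

/-- The equational theory generated by `E`: all identities holding in every
model of `E` (by Birkhoff's theorem this is exactly deductive closure). -/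
def eqTh (E : Set SgId) : Set SgId :=
  { e | ∀ (S : Type) [Semigroup S], Models S E → SatS S e }

theorem subset_eqTh (E : Set SgId) : E ⊆ eqTh E := by
  intro e he S _ hS
  exact hS e he

theorem eqTh_mono {E F : Set SgId} (h : E ⊆ F) : eqTh E ⊆ eqTh F := by
  intro e he S _ hS
  exact he S fun e' he' => hS e' (h he')

theorem eqTh_idem (E : Set SgId) : eqTh (eqTh E) = eqTh E := by
  refine Set.Subset.antisymm ?_ (subset_eqTh _)
  intro e he S _ hS
  exact he S fun e' he' => he' S hS

/-- A semigroup variety, given by its (Galois-closed) equational theory. -/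
structure SgVariety where
  th : Set SgId
  closed : eqTh th = th

theorem SgVariety.ext' {V W : SgVariety} (h : V.th = W.th) : V = W := by
  cases V; cases W; cases h; rfl

/-- The variety defined by a set of identities. -/
def varOf (E : Set SgId) : SgVariety :=
  ⟨eqTh E, eqTh_idem E⟩

/-- `V ≤ W` iff `V` is a subvariety of `W`, i.e. the theory of `W` is contained
in the theory of `V`. -/
instance : PartialOrder SgVariety where
  le V W := W.th ⊆ V.th
  le_refl V := Set.Subset.refl _
  le_trans a b c h1 h2 := Set.Subset.trans h2 h1
  le_antisymm a b h1 h2 := SgVariety.ext' (Set.Subset.antisymm h2 h1)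

/-- The lattice **SEM** of all semigroup varieties: join is intersection of
theories; meet is the variety defined by the union of the theories. -/
instance : Lattice SgVariety :=
  { (inferInstance : PartialOrder SgVariety) with
    sup := fun V W =>
      ⟨V.th ∩ W.th, by
        refine Set.Subset.antisymm (Set.subset_inter ?_ ?_) (subset_eqTh _)
        · exact (eqTh_mono Set.inter_subset_left).trans (le_of_eq V.closed)
        · exact (eqTh_mono Set.inter_subset_right).trans (le_of_eq W.closed)⟩
    le_sup_left := fun V W => Set.inter_subset_left
    le_sup_right := fun V W => Set.inter_subset_right
    sup_le := fun V W U h1 h2 => Set.subset_inter h1 h2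
    inf := fun V W => varOf (V.th ∪ W.th)
    inf_le_left := fun V W => Set.subset_union_left.trans (subset_eqTh _)
    inf_le_right := fun V W => Set.subset_union_right.trans (subset_eqTh _)
    le_inf := fun U V W h1 h2 =>
      (eqTh_mono (Set.union_subset h1 h2)).trans (le_of_eq U.closed) }

/-- The letters `x`, `y`, `z`. -/
def xw : Word := FreeSemigroup.of 0
def yw : Word := FreeSemigroup.of 1
def zw : Word := FreeSemigroup.of 2

/-- The commutative law `xy = yx`. -/
def commId : SgId := (xw * yw, yw * xw)

/-- The lattice **Com**: commutative semigroup varieties. -/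
abbrev ComVariety : Type := { V : SgVariety // commId ∈ V.th }

instance : Lattice ComVariety :=
  { (inferInstance : PartialOrder ComVariety) with
    sup := fun V W => ⟨V.1 ⊔ W.1, ⟨V.2, W.2⟩⟩
    le_sup_left := fun V W => @le_sup_left SgVariety _ V.1 W.1
    le_sup_right := fun V W => @le_sup_right SgVariety _ V.1 W.1
    sup_le := fun V W U h1 h2 => @sup_le SgVariety _ V.1 W.1 U.1 h1 h2
    inf := fun V W => ⟨V.1 ⊓ W.1, subset_eqTh _ (Set.mem_union_left _ V.2)⟩
    inf_le_left := fun V W => @inf_le_left SgVariety _ V.1 W.1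
    inf_le_right := fun V W => @inf_le_right SgVariety _ V.1 W.1
    le_inf := fun U V W h1 h2 => @le_inf SgVariety _ U.1 V.1 W.1 h1 h2 }

/-- The trivial variety `T`. -/
def trivialVar : SgVariety := varOf Set.univ

/-- The variety `COM` of all commutative semigroups. -/
def COMvar : SgVariety := varOf {commId}

/-- The variety `SL` of semilattices. -/
def SLvar : SgVariety := varOf {commId, (xw * xw, xw)}

/-- `C_m = var{xᵐ = xᵐ⁺¹, xy = yx}` for `m ≥ 1`, and `C_0 = T`. -/
def Cvar : ℕ → SgVariety
  | 0 => trivialVar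
  | m + 1 => varOf {commId, (spow xw m, spow xw (m + 1))}

def Tcom : ComVariety := ⟨trivialVar, subset_eqTh _ (Set.mem_univ _)⟩
def COMcom : ComVariety := ⟨COMvar, subset_eqTh _ rfl⟩
def SLcom : ComVariety := ⟨SLvar, subset_eqTh _ (Set.mem_insert _ _)⟩
def Ccom (m : ℕ) : ComVariety :=
  ⟨Cvar m, by
    cases m with
    | zero => exact subset_eqTh _ (Set.mem_univ _)
    | succ m => exact subset_eqTh _ (Set.mem_insert _ _)⟩

/-- A semigroup (nonempty, with the given multiplication) is a group. -/
def IsGroupS (S : Type) [Semigroup S] : Prop :=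
  ∃ e : S, (∀ a : S, e * a = a ∧ a * e = a) ∧ ∀ a : S, ∃ b : S, a * b = e ∧ b * a = e

/-- A nilsemigroup: there is a zero element and some power of every element is zero. -/
def IsNilS (S : Type) [Semigroup S] : Prop :=
  ∃ z : S, (∀ a : S, z * a = z ∧ a * z = z) ∧ ∀ a : S, ∃ n : ℕ, spow a n = z

/-- A group variety: all its (nonempty) members are groups. -/
def IsGroupVariety (V : SgVariety) : Prop :=
  ∀ (S : Type) [Semigroup S], Nonempty S → Models S V.th → IsGroupS S

/-- A nil-variety: all its (nonempty) members are nilsemigroups. -/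
def IsNilVariety (V : SgVariety) : Prop :=
  ∀ (S : Type) [Semigroup S], Nonempty S → Models S V.th → IsNilS S

/-- A combinatorial variety: all groups in it are singletons. -/
def IsCombinatorial (V : SgVariety) : Prop :=
  ∀ (S : Type) [Semigroup S], Models S V.th → IsGroupS S → Subsingleton S

/-- A periodic variety: satisfies `xⁿ = xⁿ⁺ᵏ` for some `n, k ≥ 1`. -/
def IsPeriodic (V : SgVariety) : Prop :=
  ∃ n k : ℕ, (spow xw n, spow xw (n + k + 1)) ∈ V.th

/-- The letter `k` occurs in the word `w`. -/
def occursIn (k : ℕ) (w : Word) : Prop := k = w.head ∨ k ∈ w.tail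

/-- `S` satisfies the identity `w = 0` (i.e. the system `wx = xw = w`, `x` fresh):
every value of `w` in `S` is a (two-sided) zero element. -/
def SatZeroS (S : Type) [Semigroup S] (w : Word) : Prop :=
  ∀ (σ : ℕ → S) (a : S),
    FreeSemigroup.lift σ w * a = FreeSemigroup.lift σ w ∧
      a * FreeSemigroup.lift σ w = FreeSemigroup.lift σ w

/-- The variety `V` satisfies the identity `w = 0`. -/
def VSatZero (V : SgVariety) (w : Word) : Prop :=
  ∀ (S : Type) [Semigroup S], Models S V.th → SatZeroS S w

/-- The words `x²`, `x³`, `x²y`, `xy²`, `x²yz`. -/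
def w_xx : Word := xw * xw
def w_xxx : Word := xw * xw * xw
def w_xxy : Word := xw * xw * yw
def w_xyy : Word := xw * yw * yw
def w_xxyz : Word := xw * xw * yw * zw

/-- The identity `x²y = xy²`. -/
def idQ : SgId := (w_xxy, w_xyy)

/-- The pair of identities expressing `w = 0`, with `k` a fresh letter. -/
def zeroPair (w : Word) (k : ℕ) : Set SgId :=
  {(w * FreeSemigroup.of k, w), (FreeSemigroup.of k * w, w)}

/-- `xprodTo n = x₁x₂⋯xₙ` (for `n ≥ 1`), on the letters `0, …, n-1`. -/
def xprodTo : ℕ → Word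
  | 0 => FreeSemigroup.of 0
  | 1 => FreeSemigroup.of 0
  | n + 2 => xprodTo (n + 1) * FreeSemigroup.of (n + 1)

/-- `I = var{x²y = xy², x²yz = 0, xy = yx}`. -/
def Ivar : SgVariety := varOf ({commId, idQ} ∪ zeroPair w_xxyz 3)

/-- `K = var{x²y = 0, xy = yx}`. -/
def Kvar : SgVariety := varOf ({commId} ∪ zeroPair w_xxy 2)

/-- `L = var{x² = 0, xy = yx}`. -/
def Lvar : SgVariety := varOf ({commId} ∪ zeroPair w_xx 1)

/-- `I_n = var{x²yz = x₁⋯xₙ = 0, x²y = xy², xy = yx}`. -/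
def Ivarn (n : ℕ) : SgVariety :=
  varOf ({commId, idQ} ∪ zeroPair w_xxyz 3 ∪ zeroPair (xprodTo n) n)

/-- `J = var{x²yz = x³ = 0, x²y = xy², xy = yx}`. -/
def Jvar : SgVariety := varOf ({commId, idQ} ∪ zeroPair w_xxyz 3 ∪ zeroPair w_xxx 1)

/-- `J_n = var{x²yz = x³ = x₁⋯xₙ = 0, x²y = xy², xy = yx}`. -/
def Jvarn (n : ℕ) : SgVariety :=
  varOf ({commId, idQ} ∪ zeroPair w_xxyz 3 ∪ zeroPair w_xxx 1 ∪ zeroPair (xprodTo n) n)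

/-- `K_n = var{x²y = x₁⋯xₙ = 0, xy = yx}`. -/
def Kvarn (n : ℕ) : SgVariety :=
  varOf ({commId} ∪ zeroPair w_xxy 2 ∪ zeroPair (xprodTo n) n)

/-- `L_n = var{x² = x₁⋯xₙ = 0, xy = yx}`. -/
def Lvarn (n : ℕ) : SgVariety :=
  varOf ({commId} ∪ zeroPair w_xx 1 ∪ zeroPair (xprodTo n) n)

/-- Generators of `ZR(U)`: the commutative law together with all 0-reduced
identities (in the form of the corresponding identity pairs) holding in `U`. -/
def ZRgen (U : SgVariety) : Set SgId :=
  {commId} ∪ { e : SgId | ∃ (w : Word) (k : ℕ), ¬ occursIn k w ∧ VSatZero U w ∧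
      (e = (w * FreeSemigroup.of k, w) ∨ e = (FreeSemigroup.of k * w, w)) }

/-- `ZR(U)`: the variety given by the commutative law and all 0-reduced
identities holding in `U`. -/
def ZRvar (U : SgVariety) : SgVariety := varOf (ZRgen U)

def Icom : ComVariety := ⟨Ivar, subset_eqTh _ (Set.mem_union_left _ (Set.mem_insert _ _))⟩

def ZRcom (U : SgVariety) : ComVariety :=
  ⟨ZRvar U, subset_eqTh _ (Set.mem_union_left _ rfl)⟩

/-- All nilsemigroups in `V` are nilpotent of degree ≤ n, i.e. satisfy `x₁⋯xₙ = 0`. -/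
def HasDegLe (V : SgVariety) (n : ℕ) : Prop :=
  ∀ (S : Type) [Semigroup S], Nonempty S → Models S V.th → IsNilS S → SatZeroS S (xprodTo n)

/-- `deg V = d` (with `d = ⊤` meaning infinite degree). -/
def DegIs (V : SgVariety) (d : ℕ∞) : Prop :=
  (∃ n : ℕ, 0 < n ∧ d = (n : ℕ∞) ∧ IsLeast {m : ℕ | 0 < m ∧ HasDegLe V m} n) ∨
    (d = ⊤ ∧ ∀ n : ℕ, 0 < n → ¬ HasDegLe V n)

/-- Upper-modular element of a lattice. -/
def IsUpperModular {L : Type*} [Lattice L] (a : L) : Prop :=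
  ∀ b c : L, b ≤ a → a ⊓ (b ⊔ c) = b ⊔ (a ⊓ c)

/-- Codistributive element of a lattice. -/
def IsCodistributive {L : Type*} [Lattice L] (a : L) : Prop :=
  ∀ b c : L, a ⊓ (b ⊔ c) = (a ⊓ b) ⊔ (a ⊓ c)

/-- Costandard element of a lattice. -/
def IsCostandard {L : Type*} [Lattice L] (a : L) : Prop :=
  ∀ b c : L, (a ⊓ b) ⊔ c = (a ⊔ c) ⊓ (b ⊔ c)

/-- Modular element of a lattice. -/
def IsModularElt {L : Type*} [Lattice L] (a : L) : Prop :=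
  ∀ b c : L, b ≤ c → (a ⊔ b) ⊓ c = (a ⊓ c) ⊔ b

/-- Neutral element of a lattice, via the median characterization
(equivalent to: every triple containing `a` generates a distributive
sublattice; Grätzer, "Lattice Theory: Foundation", Theorem 254). -/
def IsNeutralElt {L : Type*} [Lattice L] (a : L) : Prop :=
  ∀ b c : L, (a ⊓ b) ⊔ (b ⊓ c) ⊔ (c ⊓ a) = (a ⊔ b) ⊓ (b ⊔ c) ⊓ (c ⊔ a)

/-- A relation on words (written as lists of letters) that is a fully invariant congruence
of the free monoid and separates the empty word from all other words. -/
structure FullyInvariant (R : List ℕ → List ℕ → Prop) : Prop where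
  refl : ∀ a, R a a
  symm : ∀ {a b}, R a b → R b a
  trans : ∀ {a b c}, R a b → R b c → R a c
  append : ∀ {a b c d}, R a b → R c d → R (a ++ c) (b ++ d)
  subst : ∀ {a b} (σ : ℕ → List ℕ), (∀ i, σ i ≠ []) → R a b → R (a.flatMap σ) (b.flatMap σ)
  nil : ∀ {b}, R [] b → b = []

/-- The list of letters of a word. -/
def Word.letters (w : Word) : List ℕ := w.head :: w.tail

theorem Word.letters_mul (u v : Word) : (u * v).letters = u.letters ++ v.letters := by
  simp [Word.letters, FreeSemigroup.head_mul, FreeSemigroup.tail_mul]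

theorem Word.letters_of (i : ℕ) : Word.letters (FreeSemigroup.of i) = [i] := rfl

theorem Word.letters_ne_nil (u : Word) : u.letters ≠ [] := by simp [Word.letters]

theorem Word.letters_injective : Function.Injective Word.letters := by
  intro u v h
  simp only [Word.letters, List.cons.injEq] at h
  exact FreeSemigroup.ext h.1 h.2

theorem Word.exists_letters_eq {l : List ℕ} (h : l ≠ []) : ∃ u : Word, u.letters = l := by
  cases l with
  | nil => exact absurd rfl h
  | cons a t => exact ⟨⟨a, t⟩, rfl⟩

theorem Word.letters_lift (s : ℕ → Word) (w : Word) :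
    (FreeSemigroup.lift s w).letters = w.letters.flatMap fun i => (s i).letters := by
  induction w using FreeSemigroup.recOnMul with
  | ih1 x => simp [Word.letters_of]
  | ih2 x y hx hy =>
    rw [map_mul, Word.letters_mul, Word.letters_mul, hy, List.flatMap_append, ← hx]

/-- The congruence of the free semigroup attached to a fully invariant relation. -/
def FullyInvariant.con {R : List ℕ → List ℕ → Prop} (hR : FullyInvariant R) : Con Word where
  r u v := R u.letters v.letters
  iseqv := ⟨fun _ => hR.refl _, fun h => hR.symm h, fun h k => hR.trans h k⟩
  mul' := fun h k => by
    simp only [Word.letters_mul]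
    exact hR.append h k

/-- Birkhoff's theorem: a fully invariant relation containing `E` contains `eqTh E`. -/
theorem FullyInvariant.of_mem_eqTh {R : List ℕ → List ℕ → Prop} (hR : FullyInvariant R)
    {E : Set SgId} (hE : ∀ e ∈ E, R e.1.letters e.2.letters) {e : SgId} (he : e ∈ eqTh E) :
    R e.1.letters e.2.letters := by
  have key : ∀ (s : ℕ → Word) (w : Word),
      FreeSemigroup.lift (fun i => ((s i : Word) : hR.con.Quotient)) w =
        ((FreeSemigroup.lift s w : Word) : hR.con.Quotient) := by
    intro s w
    induction w using FreeSemigroup.recOnMul with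
    | ih1 x => simp
    | ih2 x y hx hy => rw [map_mul, map_mul, hy, Con.coe_mul, ← hx]
  have hm : Models hR.con.Quotient E := by
    intro f hf σ
    choose s hs using fun i => Quotient.exists_rep (σ i)
    have hσ : σ = fun i => ((s i : Word) : hR.con.Quotient) := funext fun i => (hs i).symm
    rw [hσ, key, key]
    refine (Con.eq _).2 ?_
    change R _ _
    rw [Word.letters_lift, Word.letters_lift]
    exact hR.subst _ (fun i => Word.letters_ne_nil _) (hE f hf)
  have h := he hR.con.Quotient hm fun i => ((FreeSemigroup.of i : Word) : hR.con.Quotient)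
  rw [key, key] at h
  have h2 : R _ _ := (Con.eq _).1 h
  rw [Word.letters_lift, Word.letters_lift] at h2
  simpa [Word.letters_of] using h2

/-- The variety whose equational theory is a given fully invariant relation. -/
def FullyInvariant.toVariety {R : List ℕ → List ℕ → Prop} (hR : FullyInvariant R) :
    SgVariety where
  th := {e | R e.1.letters e.2.letters}
  closed := Set.Subset.antisymm (fun _ he => hR.of_mem_eqTh (fun _ h => h) he) (subset_eqTh _)

/-- The theory of a variety as a relation on lists of letters. -/
def SgVariety.rel (V : SgVariety) (a b : List ℕ) : Prop :=
  a = b ∨ ∃ e ∈ V.th, e.1.letters = a ∧ e.2.letters = b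

theorem SgVariety.mem_th_refl (V : SgVariety) (u : Word) : (u, u) ∈ V.th := by
  rw [← V.closed]; intro S _ _ σ; rfl

theorem SgVariety.mem_th_symm {V : SgVariety} {u v : Word} (h : (u, v) ∈ V.th) :
    (v, u) ∈ V.th := by
  rw [← V.closed]; intro S _ hS σ; exact (hS _ h σ).symm

theorem SgVariety.mem_th_trans {V : SgVariety} {u v w : Word} (h : (u, v) ∈ V.th)
    (k : (v, w) ∈ V.th) : (u, w) ∈ V.th := by
  rw [← V.closed]; intro S _ hS σ; exact (hS _ h σ).trans (hS _ k σ)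

theorem SgVariety.mem_th_mul {V : SgVariety} {u v w x : Word} (h : (u, v) ∈ V.th)
    (k : (w, x) ∈ V.th) : (u * w, v * x) ∈ V.th := by
  rw [← V.closed]; intro S _ hS σ
  have h1 := hS _ h σ
  have h2 := hS _ k σ
  simp only at h1 h2
  simp [map_mul, h1, h2]

theorem lift_lift {S : Type} [Semigroup S] (σ : ℕ → S) (s : ℕ → Word) (w : Word) :
    FreeSemigroup.lift σ (FreeSemigroup.lift s w) =
      FreeSemigroup.lift (fun i => FreeSemigroup.lift σ (s i)) w := by
  induction w using FreeSemigroup.recOnMul with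
  | ih1 x => simp
  | ih2 x y hx hy => rw [map_mul, map_mul, map_mul, hy, ← hx]

theorem SgVariety.mem_th_lift {V : SgVariety} {u v : Word} (h : (u, v) ∈ V.th) (s : ℕ → Word) :
    (FreeSemigroup.lift s u, FreeSemigroup.lift s v) ∈ V.th := by
  rw [← V.closed]; intro S _ hS σ
  simp only [lift_lift]
  exact hS _ h _

theorem SgVariety.rel_letters {V : SgVariety} {u v : Word} :
    V.rel u.letters v.letters ↔ (u, v) ∈ V.th := by
  constructor
  · rintro (h | ⟨⟨a, b⟩, he, ha, hb⟩)
    · rw [Word.letters_injective h]; exact V.mem_th_refl v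
    · rw [← Word.letters_injective ha, ← Word.letters_injective hb]; exact he
  · intro h; exact Or.inr ⟨_, h, rfl, rfl⟩

theorem SgVariety.rel_fullyInvariant (V : SgVariety) : FullyInvariant V.rel where
  refl a := Or.inl rfl
  symm := by
    rintro a b (h | ⟨e, he, rfl, rfl⟩)
    · exact Or.inl h.symm
    · exact rel_letters.2 (mem_th_symm he)
  trans := by
    rintro a b c (rfl | ⟨e, he, rfl, rfl⟩) hbc
    · exact hbc
    · rcases hbc with rfl | ⟨f, hf, h1, rfl⟩
      · exact rel_letters.2 he
      · obtain h1 := Word.letters_injective h1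
        refine rel_letters.2 (mem_th_trans (v := e.2) he ?_)
        rw [← h1]; exact hf
  append := by
    intro a b c d hab hcd
    rcases hab with rfl | ⟨e, he, rfl, rfl⟩
    · rcases hcd with rfl | ⟨f, hf, rfl, rfl⟩
      · exact Or.inl rfl
      · by_cases ha : a = []
        · subst ha; exact rel_letters.2 hf
        · obtain ⟨u, rfl⟩ := Word.exists_letters_eq ha
          rw [← Word.letters_mul, ← Word.letters_mul]
          exact rel_letters.2 (mem_th_mul (V.mem_th_refl u) hf)
    · rcases hcd with rfl | ⟨f, hf, rfl, rfl⟩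
      · by_cases hc : c = []
        · subst hc; simpa using rel_letters.2 he
        · obtain ⟨u, rfl⟩ := Word.exists_letters_eq hc
          rw [← Word.letters_mul, ← Word.letters_mul]
          exact rel_letters.2 (mem_th_mul he (V.mem_th_refl u))
      · rw [← Word.letters_mul, ← Word.letters_mul]
        exact rel_letters.2 (mem_th_mul he hf)
  subst := by
    rintro a b σ hσ (rfl | ⟨e, he, rfl, rfl⟩)
    · exact Or.inl rfl
    · choose s hs using fun i => Word.exists_letters_eq (hσ i)
      obtain rfl : (fun i => (s i).letters) = σ := funext hs
      rw [← Word.letters_lift, ← Word.letters_lift]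
      exact rel_letters.2 (mem_th_lift he s)
  nil := by
    rintro b (h | ⟨e, he, h, rfl⟩)
    · exact h.symm
    · exact absurd h (Word.letters_ne_nil _)

/-- The join of two fully invariant relations is the transitive closure of their union. -/
theorem FullyInvariant.sup {R S : List ℕ → List ℕ → Prop} (hR : FullyInvariant R)
    (hS : FullyInvariant S) :
    FullyInvariant (Relation.ReflTransGen fun a b => R a b ∨ S a b) := by
  have hl : ∀ {a b} (c), Relation.ReflTransGen (fun a b => R a b ∨ S a b) a b →
      Relation.ReflTransGen (fun a b => R a b ∨ S a b) (c ++ a) (c ++ b) := by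
    intro a b c h
    exact h.lift (c ++ ·) fun x y hxy =>
      hxy.imp (hR.append (hR.refl c)) (hS.append (hS.refl c))
  have hr : ∀ {a b} (c), Relation.ReflTransGen (fun a b => R a b ∨ S a b) a b →
      Relation.ReflTransGen (fun a b => R a b ∨ S a b) (a ++ c) (b ++ c) := by
    intro a b c h
    exact h.lift (· ++ c) fun x y hxy =>
      hxy.imp (fun k => hR.append k (hR.refl c)) (fun k => hS.append k (hS.refl c))
  refine ⟨fun _ => .refl, ?_, fun h k => h.trans k, fun h k => (hr _ h).trans (hl _ k), ?_, ?_⟩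
  · intro a b h
    induction h with
    | refl => exact .refl
    | tail _ h ih => exact Relation.ReflTransGen.head (h.imp hR.symm hS.symm) ih
  · intro a b σ hσ h
    exact Relation.ReflTransGen.lift (p := fun a b => R a b ∨ S a b) (fun l : List ℕ => l.flatMap σ)
      (fun x y (hxy : R x y ∨ S x y) => hxy.imp (hR.subst σ hσ) (hS.subst σ hσ)) _ _ h
  · intro b h
    induction h with
    | refl => rfl
    | tail _ h ih =>
      subst ih
      exact h.elim hR.nil hS.nil

theorem FullyInvariant.inf {R S : List ℕ → List ℕ → Prop} (hR : FullyInvariant R)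
    (hS : FullyInvariant S) : FullyInvariant fun a b => R a b ∧ S a b :=
  ⟨fun _ => ⟨hR.refl _, hS.refl _⟩, fun h => ⟨hR.symm h.1, hS.symm h.2⟩,
    fun h k => ⟨hR.trans h.1 k.1, hS.trans h.2 k.2⟩,
    fun h k => ⟨hR.append h.1 k.1, hS.append h.2 k.2⟩,
    fun σ hσ h => ⟨hR.subst σ hσ h.1, hS.subst σ hσ h.2⟩, fun h => hR.nil h.1⟩

theorem FullyInvariant.ctx {R : List ℕ → List ℕ → Prop} (hR : FullyInvariant R) {X Y : List ℕ}
    (A B : List ℕ) (h : R X Y) : R (A ++ X ++ B) (A ++ Y ++ B) :=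
  hR.append (hR.append (hR.refl A) h) (hR.refl B)

/-- `Deep h T e` says that `e` occurs in `T` with at least `h` letters on both sides. -/
def Deep (h : ℕ) (T : List ℕ) (e : ℕ) : Prop :=
  ∃ X Z, T = X ++ e :: Z ∧ h ≤ X.length ∧ h ≤ Z.length

theorem Deep.mem {h : ℕ} {T : List ℕ} {e : ℕ} (d : Deep h T e) : e ∈ T := by
  obtain ⟨X, Z, rfl, _, _⟩ := d; simp

theorem Deep.mono {h k : ℕ} {T : List ℕ} {e : ℕ} (d : Deep h T e) (hk : k ≤ h) : Deep k T e := by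
  obtain ⟨X, Z, rfl, h1, h2⟩ := d; exact ⟨X, Z, rfl, hk.trans h1, hk.trans h2⟩

theorem Deep.of_factor {h : ℕ} {T : List ℕ} {e : ℕ} (d : Deep h T e) (U W : List ℕ) :
    Deep h (U ++ T ++ W) e := by
  obtain ⟨X, Z, rfl, h1, h2⟩ := d
  exact ⟨U ++ X, Z ++ W, by simp, by simp; omega, by simp; omega⟩

theorem Deep.of_infix {h : ℕ} {T S : List ℕ} {e : ℕ} (d : Deep h T e) (hT : T <:+: S) :
    Deep h S e := by
  obtain ⟨U, W, rfl⟩ := hT; exact d.of_factor U W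

theorem Deep.factor {h m : ℕ} {U Y Q : List ℕ} {e : ℕ} (d : Deep h (U ++ Y ++ Q) e)
    (hU : U.length + m ≤ h) (hQ : Q.length + m ≤ h) : Deep m Y e := by
  obtain ⟨X, Z, hT, h1, h2⟩ := d
  have hX : X = U ++ X.drop U.length := by
    have h3 := congrArg (List.take U.length) hT
    rw [List.append_assoc, List.take_left, List.take_append_of_le_length (by omega)] at h3
    conv_lhs => rw [← List.take_append_drop U.length X, ← h3]
  have hZ : Z = Z.take (Z.length - Q.length) ++ Q := by
    have h3 := congrArg (fun l => (l.reverse.take Q.length).reverse) hT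
    simp only [List.reverse_append, List.reverse_cons] at h3
    rw [List.append_assoc, ← List.length_reverse (as := Q), List.take_left,
      List.take_append_of_le_length (by simp; omega), List.take_reverse, List.reverse_reverse,
      List.reverse_reverse, List.length_reverse] at h3
    conv_lhs => rw [← List.take_append_drop (Z.length - Q.length) Z, ← h3]
  refine ⟨X.drop U.length, Z.take (Z.length - Q.length), ?_, by simp; omega, by simp; omega⟩
  rw [hX, hZ] at hT
  have h4 : U ++ (Y ++ Q) =
      U ++ ((X.drop U.length ++ e :: Z.take (Z.length - Q.length)) ++ Q) := by
    simpa [List.append_assoc] using hT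
  exact List.append_cancel_right (List.append_cancel_left h4)

theorem infix_flatMap_of_mem {σ : ℕ → List ℕ} {i : ℕ} {T : List ℕ} (h : i ∈ T) :
    σ i <:+: T.flatMap σ := by
  obtain ⟨A, B, rfl⟩ := List.append_of_mem h
  exact ⟨A.flatMap σ, B.flatMap σ, by simp⟩

theorem length_le_length_flatMap {σ : ℕ → List ℕ} (hσ : ∀ i, σ i ≠ []) (T : List ℕ) :
    T.length ≤ (T.flatMap σ).length := by
  induction T with
  | nil => simp
  | cons a t ih =>
    have := List.length_pos_of_ne_nil (hσ a)
    simp only [List.flatMap_cons, List.length_append, List.length_cons]; omega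

/-- Any word of length at least `a + b` splits off a prefix of length `a` and a suffix of
length `b`. -/
theorem exists_split (T : List ℕ) (a b : ℕ) (h : a + b ≤ T.length) :
    ∃ P Y Q, T = P ++ Y ++ Q ∧ P.length = a ∧ Q.length = b := by
  refine ⟨T.take a, (T.drop a).take (T.length - a - b), (T.drop a).drop (T.length - a - b), ?_,
    ?_, ?_⟩
  · rw [List.append_assoc, List.take_append_drop, List.take_append_drop]
  · simp; omega
  · simp; omega

theorem range_flatMap_getD (bs : List (List ℕ)) :
    (List.range bs.length).flatMap (fun i => bs.getD i [0]) = bs.flatten := by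
  rw [List.flatMap_def]
  congr 1
  apply List.ext_getElem (by simp)
  intro i h1 h2
  simp [List.getD_eq_getElem?_getD, h2]

theorem getD_ne_nil {bs : List (List ℕ)} (hbs : ∀ b ∈ bs, b ≠ []) (i : ℕ) :
    bs.getD i [0] ≠ [] := by
  rw [List.getD_eq_getElem?_getD]
  cases hi : bs[i]? with
  | none => simp
  | some b => simpa using hbs b (List.mem_of_getElem? hi)

/-- Substituting a long block for one letter and single letters for the others. -/
theorem exists_one_block {n : ℕ} {P Y Q : List ℕ} (hY : Y ≠ [])
    (hn : P.length + 1 + Q.length = n) :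
    ∃ σ : ℕ → List ℕ, (∀ i, σ i ≠ []) ∧ σ P.length = Y ∧
      (List.range n).flatMap σ = P ++ Y ++ Q := by
  let bs : List (List ℕ) := P.map (fun a => [a]) ++ Y :: Q.map (fun a => [a])
  have hbs : ∀ b ∈ bs, b ≠ [] := by
    intro b hb
    simp only [bs, List.mem_append, List.mem_cons, List.mem_map] at hb
    rcases hb with ⟨a, _, rfl⟩ | rfl | ⟨a, _, rfl⟩ <;> simp [hY]
  refine ⟨fun i => bs.getD i [0], getD_ne_nil hbs, ?_, ?_⟩
  · simp [bs, List.getD_eq_getElem?_getD]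
  · obtain rfl : bs.length = n := by simp [bs]; omega
    rw [range_flatMap_getD]
    simp [bs, ← List.flatMap_def]

/-- Substituting long blocks for two letters and single letters for the others. -/
theorem exists_two_block {n : ℕ} {P Y M Z Q : List ℕ} (hY : Y ≠ []) (hZ : Z ≠ [])
    (hn : P.length + 1 + M.length + 1 + Q.length = n) :
    ∃ σ : ℕ → List ℕ, (∀ i, σ i ≠ []) ∧ σ P.length = Y ∧ σ (P.length + 1 + M.length) = Z ∧
      (List.range n).flatMap σ = P ++ Y ++ M ++ Z ++ Q := by
  let bs : List (List ℕ) :=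
    P.map (fun a => [a]) ++ Y :: (M.map (fun a => [a]) ++ Z :: Q.map (fun a => [a]))
  have hbs : ∀ b ∈ bs, b ≠ [] := by
    intro b hb
    simp only [bs, List.mem_append, List.mem_cons, List.mem_map] at hb
    rcases hb with ⟨a, _, rfl⟩ | rfl | ⟨a, _, rfl⟩ | rfl | ⟨a, _, rfl⟩ <;> simp [hY, hZ]
  refine ⟨fun i => bs.getD i [0], getD_ne_nil hbs, ?_, ?_, ?_⟩
  · simp [bs, List.getD_eq_getElem?_getD]
  · have : P.length + 1 + M.length - P.length = M.length + 1 := by omega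
    simp only [bs, List.getD_eq_getElem?_getD]
    rw [List.getElem?_append_right (by simp; omega), List.length_map, this,
      List.getElem?_cons_succ, List.getElem?_append_right (by simp)]
    simp
  · obtain rfl : bs.length = n := by simp [bs]; omega
    rw [range_flatMap_getD]
    simp [bs, ← List.flatMap_def]

/-- A fully invariant relation that preserves the set of letters and identifies
`range n` with a longer word. -/
structure Expanding (R : List ℕ → List ℕ → Prop) (n : ℕ) (w₀ : List ℕ) : Prop where
  inv : FullyInvariant R
  mem_iff : ∀ {X Y}, R X Y → ∀ a, a ∈ X ↔ a ∈ Y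
  rel : R (List.range n) w₀
  lt : n < w₀.length

namespace Expanding

variable {R : List ℕ → List ℕ → Prop} {n : ℕ} {w₀ : List ℕ}

theorem mem_range (h : Expanding R n w₀) {T : List ℕ} (hT : R (List.range n) T) (a : ℕ) :
    a ∈ T ↔ a < n := by
  rw [← h.mem_iff hT a, List.mem_range]

theorem pos (h : Expanding R n w₀) : 0 < n := by
  rcases Nat.eq_zero_or_pos n with rfl | hn
  · have h1 := h.lt
    have h2 := h.inv.nil (by simpa using h.rel)
    simp [h2] at h1
  · exact hn

theorem length_lt (h : Expanding R n w₀) {σ : ℕ → List ℕ} (hσ : ∀ i, σ i ≠ []) :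
    ((List.range n).flatMap σ).length < (w₀.flatMap σ).length := by
  have h1 : (List.range n).Subperm w₀ :=
    List.subperm_of_subset List.nodup_range fun a ha => (h.mem_iff h.rel a).1 ha
  have h2 : List.Perm (List.range n ++ w₀.diff (List.range n)) w₀ :=
    List.subperm_append_diff_self_of_count_le fun x _ => h1.count_le x
  have h3 := h2.length_eq
  have h4 := (h2.flatMap_right σ).length_eq
  have h5 := length_le_length_flatMap hσ (w₀.diff (List.range n))
  have := h.lt
  simp only [List.flatMap_append, List.length_append, List.length_range] at h3 h4
  omega

theorem pump (h : Expanding R n w₀) {X : List ℕ} (hX : n ≤ X.length) (N : ℕ) :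
    ∃ X', R X X' ∧ N ≤ X'.length := by
  induction N with
  | zero => exact ⟨X, h.inv.refl X, Nat.zero_le _⟩
  | succ N ih =>
    obtain ⟨X', h1, h2⟩ := ih
    by_cases hN : N + 1 ≤ X'.length
    · exact ⟨X', h1, hN⟩
    by_cases hn : n ≤ X'.length
    swap
    · exact ⟨X, h.inv.refl X, by omega⟩
    have hpos := h.pos
    obtain ⟨P, Y, Q, rfl, hP, hQ⟩ := exists_split X' 0 (n - 1) (by omega)
    have hP0 : P = [] := List.length_eq_zero_iff.1 hP
    subst hP0
    have hY : Y ≠ [] := by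
      rintro rfl
      simp at hn; omega
    obtain ⟨σ, hσ, -, h3⟩ := exists_one_block (n := n) (P := []) hY (Q := Q) (by simp; omega)
    have h4 := h.inv.subst σ hσ h.rel
    have hlen := h.length_lt hσ
    rw [h3] at h4 hlen
    exact ⟨_, h.inv.trans h1 h4, by omega⟩

end Expanding

theorem exists_two_occurrences {T : List ℕ} {i : ℕ} (hi : 2 ≤ T.count i) :
    ∃ α β γ, T = α ++ i :: (β ++ i :: γ) := by
  obtain ⟨α, δ, hα⟩ := List.append_of_mem (List.count_pos_iff.1 (by omega : 0 < T.count i))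
  by_cases hδ : i ∈ δ
  · obtain ⟨β, γ, rfl⟩ := List.append_of_mem hδ
    exact ⟨α, β, γ, hα⟩
  · have hα' : i ∈ α := by
      by_contra hc
      rw [hα, List.count_append, List.count_cons_self, List.count_eq_zero.2 hc,
        List.count_eq_zero.2 hδ] at hi
      omega
    obtain ⟨β, γ, rfl⟩ := List.append_of_mem hα'
    exact ⟨β, γ, δ, by rw [hα]; simp⟩

namespace Expanding

variable {R : List ℕ → List ℕ → Prop} {n : ℕ} {w₀ : List ℕ}

theorem deepen_left (h : Expanding R n w₀) {T A B : List ℕ} {i : ℕ} (hT : R (List.range n) T)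
    (hAB : T = A ++ i :: B) (hA : A.length < i) (hlen : 6 * n ≤ T.length) :
    ∃ T', R (List.range n) T' ∧ Deep n T' i ∧ ∀ e, Deep (4 * n) T e → Deep n T' e := by
  have hi : i < n := (h.mem_range hT i).1 (by simp [hAB])
  obtain ⟨k, hk, hkA⟩ : ∃ k, k ≤ A.length ∧ k ∉ A := by
    by_contra! hc
    have h1 := (List.subperm_of_subset (List.nodup_range (n := A.length + 1))
      fun a ha => hc a (by simpa [Nat.lt_succ_iff] using ha)).length_le
    simp at h1
  have hkB : k ∈ B := by
    have : k ∈ T := (h.mem_range hT k).2 (by omega)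
    rw [hAB] at this
    simp only [List.mem_append, List.mem_cons] at this
    rcases this with h1 | h1 | h1
    · exact absurd h1 hkA
    · omega
    · exact h1
  have hBlen : B.length + A.length + 1 = T.length := by rw [hAB]; simp; omega
  obtain ⟨M, Z, Q, hB, hM, hQ⟩ := exists_split (B.drop n) (i - k - 1) (n - 1 - i)
    (by simp; omega)
  have hZlen : n ≤ Z.length := by
    have := congrArg List.length hB
    simp at this; omega
  obtain ⟨σ, hσ, hσk, hσi, hflat⟩ := exists_two_block (n := n) (P := A.take k)
    (Y := A.drop k ++ i :: B.take n) (M := M) (Z := Z) (Q := Q) (by simp)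
    (by rintro rfl; simp at hZlen; omega) (by simp; omega)
  have hTeq : A.take k ++ (A.drop k ++ i :: B.take n) ++ M ++ Z ++ Q = T := by
    rw [hAB]
    conv_rhs => rw [← List.take_append_drop n B, hB]
    simp only [List.append_assoc, List.cons_append]
    rw [← List.append_assoc (A.take k), List.take_append_drop]
  rw [hTeq] at hflat
  have hPk : (A.take k).length = k := by simp; omega
  rw [hPk] at hσk hσi
  have hki : k + 1 + M.length = i := by omega
  rw [hki] at hσi
  have hrel := h.inv.subst σ hσ hT
  rw [hflat] at hrel
  refine ⟨_, h.inv.trans hT hrel, ?_, fun e he => ?_⟩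
  · obtain ⟨B1, B2, rfl⟩ := List.append_of_mem hkB
    refine ⟨A.flatMap σ ++ Z ++ B1.flatMap σ ++ A.drop k,
      (B1 ++ k :: B2).take n ++ B2.flatMap σ, ?_, ?_, ?_⟩
    · conv_lhs => rw [hAB]
      simp [hσk, hσi]
    · simp; omega
    · simp only [List.length_append, List.length_take] at hBlen ⊢; omega
  · rw [← hTeq] at he
    refine Deep.of_infix (he.factor (m := n) ?_ ?_) (hσi ▸ infix_flatMap_of_mem (by simp [hAB]))
    · simp; omega
    · omega

theorem deepen_right (h : Expanding R n w₀) {T A B : List ℕ} {i : ℕ} (hT : R (List.range n) T)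
    (hAB : T = A ++ i :: B) (hB : i + B.length + 1 < n) (hlen : 6 * n ≤ T.length) :
    ∃ T', R (List.range n) T' ∧ Deep n T' i ∧ ∀ e, Deep (4 * n) T e → Deep n T' e := by
  obtain ⟨k, hk, hkn, hkB⟩ : ∃ k, n ≤ k + B.length + 1 ∧ k < n ∧ k ∉ B := by
    by_contra! hc
    have h1 := (List.subperm_of_subset
      (List.nodup_range' (s := n - 1 - B.length) (n := B.length + 1) (step := 1))
      (l₂ := B) fun a ha => by
        rw [List.mem_range'_1] at ha
        exact hc a (by omega) (by omega)).length_le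
    simp at h1
  have hkA : k ∈ A := by
    have : k ∈ T := (h.mem_range hT k).2 (by omega)
    rw [hAB] at this
    simp only [List.mem_append, List.mem_cons] at this
    rcases this with h1 | h1 | h1
    · exact h1
    · omega
    · exact absurd h1 hkB
  have hBlen : B.length + A.length + 1 = T.length := by rw [hAB]; simp; omega
  obtain ⟨A', A'', E, hA, hA', hE⟩ := exists_split A 0 n (by omega)
  obtain rfl : A' = [] := List.length_eq_zero_iff.1 hA'
  rw [List.nil_append] at hA
  have hlA := congrArg List.length hA
  rw [List.length_append] at hlA
  obtain ⟨P, Z, M, hA2, hP, hM⟩ := exists_split A'' i (k - i - 1) (by omega)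
  obtain ⟨B', F, Q, hB2, hB', hQ⟩ := exists_split B 0 (n - 1 - k) (by omega)
  obtain rfl : B' = [] := List.length_eq_zero_iff.1 hB'
  rw [List.nil_append] at hB2
  have hlB := congrArg List.length hB2
  rw [List.length_append] at hlB
  have hZlen : n ≤ Z.length := by
    have := congrArg List.length hA2
    simp at this; omega
  obtain ⟨σ, hσ, hσi, hσk, hflat⟩ := exists_two_block (n := n) (P := P)
    (Y := Z) (M := M) (Z := E ++ i :: F) (Q := Q)
    (by rintro rfl; simp at hZlen; omega) (by simp) (by omega)
  have hTeq : P ++ Z ++ (M ++ (E ++ i :: F) ++ Q) = T := by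
    rw [hAB, hA, hA2, hB2]
    simp
  have hTeq2 : P ++ Z ++ M ++ (E ++ i :: F) ++ Q = T := by
    rw [← hTeq]; simp
  rw [hTeq2] at hflat
  rw [hP] at hσk hσi
  have hki : i + 1 + M.length = k := by omega
  rw [hki] at hσk
  have hrel := h.inv.subst σ hσ hT
  rw [hflat] at hrel
  refine ⟨_, h.inv.trans hT hrel, ?_, fun e he => ?_⟩
  · obtain ⟨A1, A2, hA12⟩ := List.append_of_mem hkA
    refine ⟨A1.flatMap σ ++ E, F ++ A2.flatMap σ ++ Z ++ B.flatMap σ, ?_, ?_, ?_⟩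
    · conv_lhs => rw [hAB, hA12]
      simp [hσk, hσi]
    · simp; omega
    · simp; omega
  · rw [← hTeq] at he
    refine Deep.of_infix (he.factor (m := n) ?_ ?_) (hσi ▸ infix_flatMap_of_mem (by simp [hAB]))
    · omega
    · simp; omega

theorem deepen (h : Expanding R n w₀) {T : List ℕ} {i : ℕ} (hT : R (List.range n) T)
    (hi : 2 ≤ T.count i) (hlen : 6 * n ≤ T.length) :
    ∃ T', R (List.range n) T' ∧ Deep n T' i ∧ ∀ e, Deep (4 * n) T e → Deep n T' e := by
  have him : i ∈ T := List.count_pos_iff.1 (by omega)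
  have hin : i < n := (h.mem_range hT i).1 him
  obtain ⟨A, B, hAB⟩ := List.append_of_mem him
  rcases lt_or_ge A.length i with hA | hA
  · exact h.deepen_left hT hAB hA hlen
  rcases lt_or_ge (i + B.length + 1) n with hB | hB
  · exact h.deepen_right hT hAB hB hlen
  have hBlen : B.length + A.length + 1 = T.length := by rw [hAB]; simp; omega
  obtain ⟨P, A', Q', hA2, hP, hQ'⟩ := exists_split A i 0 (by omega)
  obtain rfl : Q' = [] := List.length_eq_zero_iff.1 hQ'
  rw [List.append_nil] at hA2
  obtain ⟨B', F, Q, hB2, hB', hQ⟩ := exists_split B 0 (n - 1 - i) (by omega)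
  obtain rfl : B' = [] := List.length_eq_zero_iff.1 hB'
  rw [List.nil_append] at hB2
  obtain ⟨σ, hσ, hσi, hflat⟩ := exists_one_block (n := n) (P := P) (Y := A' ++ i :: F) (Q := Q)
    (by simp) (by omega)
  have hTeq : P ++ (A' ++ i :: F) ++ Q = T := by
    rw [hAB, hA2, hB2]; simp
  have hlA := congrArg List.length hA2
  have hlB := congrArg List.length hB2
  rw [List.length_append] at hlA hlB
  rw [hTeq] at hflat
  rw [hP] at hσi
  have hrel := h.inv.subst σ hσ hT
  rw [hflat] at hrel
  obtain ⟨α, β, γ, hαβγ⟩ := exists_two_occurrences hi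
  refine ⟨_, h.inv.trans hT hrel, ?_, fun e he => ?_⟩
  · rcases le_or_gt n A'.length with hA' | hA'
    · refine ⟨α.flatMap σ ++ A', F ++ β.flatMap σ ++ (A' ++ i :: F) ++ γ.flatMap σ, ?_, ?_, ?_⟩
      · rw [hαβγ]; simp [hσi]
      · simp; omega
      · simp; omega
    · refine ⟨α.flatMap σ ++ (A' ++ i :: F) ++ β.flatMap σ ++ A', F ++ γ.flatMap σ, ?_, ?_, ?_⟩
      · rw [hαβγ]; simp [hσi]
      · simp; omega
      · simp; omega
  · rw [← hTeq] at he
    refine Deep.of_infix (he.factor (m := n) ?_ ?_) (hσi ▸ infix_flatMap_of_mem him)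
    · omega
    · omega

/-- There is a word in which every letter either occurs once, outside a long middle part, or
occurs deep inside that part. -/
theorem exists_core (h : Expanding R n w₀) :
    ∃ L C M, R (List.range n) (L ++ C ++ M) ∧ C ≠ [] ∧ (∀ e ∈ C, Deep (4 * n) C e) ∧
      ∀ a < n, a ∉ C → (L ++ C ++ M).count a = 1 := by
  classical
  have hpos := h.pos
  let d : List ℕ → ℕ := fun T => ((Finset.range n).filter fun a => Deep n T a).card
  obtain ⟨T, hT, hmax⟩ : ∃ T, R (List.range n) T ∧ ∀ T', R (List.range n) T' → d T' ≤ d T := by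
    have hex : ∃ m, ∃ T, R (List.range n) T ∧ d T = m := ⟨_, _, h.inv.refl _, rfl⟩
    have hb : ∀ m, (∃ T, R (List.range n) T ∧ d T = m) → m ≤ n := by
      rintro m ⟨T, hT, rfl⟩
      exact (Finset.card_filter_le _ _).trans (by simp)
    obtain ⟨T, hT, hd⟩ := Nat.findGreatest_spec (P := fun m => ∃ T, R (List.range n) T ∧ d T = m)
      (hb _ hex.choose_spec) hex.choose_spec
    refine ⟨T, hT, fun T' hT' => ?_⟩
    rw [hd]
    exact Nat.le_findGreatest (hb _ ⟨T', hT', rfl⟩) ⟨T', hT', rfl⟩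
  have hstable : ∀ T', R (List.range n) T' → (∀ a < n, Deep n T a → Deep n T' a) →
      ∀ a < n, Deep n T' a → Deep n T a := by
    intro T' hT' hsub a ha hd
    have h1 : (Finset.range n).filter (fun a => Deep n T a) ⊆
        (Finset.range n).filter fun a => Deep n T' a := by
      intro x hx
      simp only [Finset.mem_filter, Finset.mem_range] at hx ⊢
      exact ⟨hx.1, hsub x hx.1 hx.2⟩
    have h2 := Finset.eq_of_subset_of_card_le h1 (hmax T' hT')
    have h3 : a ∈ (Finset.range n).filter fun a => Deep n T' a := by simp [ha, hd]
    rw [← h2] at h3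
    simpa [ha] using h3
  obtain ⟨T₁, hT₁, hd₁⟩ : ∃ T₁, R (List.range n) T₁ ∧ 12 * n ≤ T₁.length ∧
      ∀ a, Deep n T a → Deep (6 * n) T₁ a := by
    by_cases hlen : n + n ≤ T.length
    · obtain ⟨X, Y, Z, rfl, hX, hZ⟩ := exists_split T n n hlen
      obtain ⟨X', hX', hXl⟩ := h.pump (X := X) (by omega) (6 * n)
      obtain ⟨Z', hZ', hZl⟩ := h.pump (X := Z) (by omega) (6 * n)
      refine ⟨X' ++ Y ++ Z', h.inv.trans hT (h.inv.append (h.inv.append hX' (h.inv.refl Y)) hZ'),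
        by simp; omega, fun a ha => ?_⟩
      obtain ⟨U, W, hUW, hU, hW⟩ := ha.factor (m := 0) (by omega) (by omega)
      exact ⟨X' ++ U, W ++ Z', by rw [hUW]; simp, by simp; omega, by simp; omega⟩
    · obtain ⟨T₁, hT₁, hl⟩ := h.pump (X := List.range n) (by simp) (12 * n)
      refine ⟨T₁, hT₁, hl, ?_⟩
      rintro a ⟨U, W, rfl, hU, hW⟩
      simp at hlen; omega
  obtain ⟨hlen₁, hd₁⟩ := hd₁
  have hback : ∀ a < n, Deep n T₁ a → Deep (6 * n) T₁ a := fun a ha hd =>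
    hd₁ a (hstable T₁ hT₁ (fun b _ hb => (hd₁ b hb).mono (by omega)) a ha hd)
  have hcount : ∀ a < n, ¬ Deep n T₁ a → T₁.count a = 1 := by
    intro a ha hnd
    by_contra hc
    have h1 : 0 < T₁.count a := List.count_pos_iff.2 ((h.mem_range hT₁ a).2 ha)
    obtain ⟨T', hT', hda, hde⟩ := h.deepen (i := a) hT₁ (by omega) (by omega)
    refine hnd ((hd₁ a (hstable T' hT' (fun b _ hb => hde b ((hd₁ b hb).mono (by omega))) a ha
      hda)).mono (by omega))
  obtain ⟨L, C, M, rfl, hL, hM⟩ := exists_split T₁ n n (by omega)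
  have hCdeep : ∀ e ∈ C, Deep n (L ++ C ++ M) e := by
    intro e he
    obtain ⟨U, W, rfl⟩ := List.append_of_mem he
    exact ⟨L ++ U, W ++ M, by simp, by simp; omega, by simp; omega⟩
  refine ⟨L, C, M, hT₁, ?_, fun e he => ?_, fun a ha haC => ?_⟩
  · rintro rfl
    simp at hlen₁; omega
  · exact (hback e ((h.mem_range hT₁ e).1 (by simp [he])) (hCdeep e he)).factor (by omega)
      (by omega)
  · refine hcount a ha fun hd => haC ?_
    exact (hd.factor (m := 0) (by omega) (by omega)).mem

end Expanding

/-- The power `u ^ k` of a word. -/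
def lpow (k : ℕ) (u : List ℕ) : List ℕ := (List.replicate k u).flatten

theorem lpow_one (u : List ℕ) : lpow 1 u = u := by simp [lpow]

theorem lpow_add (j k : ℕ) (u : List ℕ) : lpow (j + k) u = lpow j u ++ lpow k u := by
  simp only [lpow, List.replicate_add, List.flatten_append]

theorem lpow_succ (k : ℕ) (u : List ℕ) : lpow (k + 1) u = u ++ lpow k u := by
  simp [lpow, List.replicate_succ]

theorem lpow_singleton (k a : ℕ) : lpow k [a] = List.replicate k a := by
  simp [lpow]

theorem length_lpow (k : ℕ) (u : List ℕ) : (lpow k u).length = k * u.length := by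
  simp [lpow]

theorem count_lpow (k : ℕ) (u : List ℕ) (a : ℕ) : (lpow k u).count a = k * u.count a := by
  simp [lpow, List.count_flatten]

theorem lpow_ne_nil {k : ℕ} {u : List ℕ} (hk : k ≠ 0) (hu : u ≠ []) : lpow k u ≠ [] := by
  obtain ⟨k, rfl⟩ := Nat.exists_eq_succ_of_ne_zero hk
  simp [lpow_succ, hu]

theorem exists_descent {w : List ℕ} (hw : ¬ w.Nodup) :
    ∃ α k l β, w = α ++ k :: l :: β ∧ l ≤ k := by
  have key : ∀ w : List ℕ, (∃ α k l β, w = α ++ k :: l :: β ∧ l ≤ k) ∨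
      List.IsChain (· < ·) w := by
    intro w
    induction w with
    | nil => exact Or.inr List.IsChain.nil
    | cons a t ih =>
      rcases ih with ⟨α, k, l, β, rfl, hkl⟩ | ih
      · exact Or.inl ⟨a :: α, k, l, β, rfl, hkl⟩
      · cases t with
        | nil => exact Or.inr (List.IsChain.singleton a)
        | cons b t =>
          rcases lt_or_ge a b with hab | hab
          · exact Or.inr (List.isChain_cons_cons.2 ⟨hab, ih⟩)
          · exact Or.inl ⟨[], a, b, t, rfl, hab⟩
  rcases key w with h | h
  · exact h
  · exact absurd ((List.isChain_iff_pairwise.1 h).imp fun hab => hab.ne) hw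

theorem flatMap_singleton_const (T : List ℕ) (e : ℕ) :
    T.flatMap (fun _ => [e]) = List.replicate T.length e := by
  induction T with
  | nil => rfl
  | cons a t ih => simp [ih, List.replicate_succ]

theorem flatMap_ite_pair (T : List ℕ) (a e : ℕ) :
    T.flatMap (fun i => if i = a then [e, e] else [e]) =
      List.replicate (T.length + T.count a) e := by
  induction T with
  | nil => rfl
  | cons b t ih =>
    rw [List.flatMap_cons, ih]
    by_cases hb : b = a
    · subst hb
      have : (b :: t).length + (b :: t).count b = (t.length + t.count b) + 1 + 1 := by
        simp; omega
      rw [this, List.replicate_succ, List.replicate_succ]; simp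
    · have : (b :: t).length + (b :: t).count a = (t.length + t.count a) + 1 := by
        rw [List.count_cons_of_ne hb]; simp; omega
      rw [this, List.replicate_succ]; simp [hb]

namespace FullyInvariant

variable {R : List ℕ → List ℕ → Prop}

theorem pow (hR : FullyInvariant R) {u v : List ℕ} (h : R u v) (k : ℕ) :
    R (lpow k u) (lpow k v) := by
  induction k with
  | zero => exact hR.refl _
  | succ k ih => rw [lpow_succ, lpow_succ]; exact hR.append h ih

theorem replicate_length (hR : FullyInvariant R) {u v : List ℕ} (h : R u v) (e : ℕ) :
    R (List.replicate u.length e) (List.replicate v.length e) := by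
  have := hR.subst (fun _ => [e]) (by simp) h
  rwa [flatMap_singleton_const, flatMap_singleton_const] at this

theorem replicate_length_add_count (hR : FullyInvariant R) {u v : List ℕ} (h : R u v) (a e : ℕ) :
    R (List.replicate (u.length + u.count a) e) (List.replicate (v.length + v.count a) e) := by
  have := hR.subst (fun i => if i = a then [e, e] else [e]) (by intro i; split <;> simp) h
  rwa [flatMap_ite_pair, flatMap_ite_pair] at this

theorem replicate_add (hR : FullyInvariant R) {e i j : ℕ}
    (h : R (List.replicate i e) (List.replicate j e)) (k : ℕ) :
    R (List.replicate (i + k) e) (List.replicate (j + k) e) := by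
  rw [List.replicate_add, List.replicate_add]
  exact hR.append h (hR.refl _)

theorem replicate_period (hR : FullyInvariant R) {e N p : ℕ}
    (h : R (List.replicate N e) (List.replicate (N + p) e)) {M : ℕ} (hM : N ≤ M) (t : ℕ) :
    R (List.replicate M e) (List.replicate (M + t * p) e) := by
  induction t with
  | zero => simpa using hR.refl _
  | succ t ih =>
    have h1 := hR.replicate_add h (M + t * p - N)
    rw [show N + (M + t * p - N) = M + t * p by omega,
      show N + p + (M + t * p - N) = M + (t + 1) * p by rw [Nat.succ_mul]; omega] at h1
    exact hR.trans ih h1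

end FullyInvariant

namespace Expanding

variable {R : List ℕ → List ℕ → Prop} {n : ℕ} {w₀ : List ℕ}

theorem not_nodup (h : Expanding R n w₀) {T : List ℕ} (hT : R (List.range n) T)
    (hn : n < T.length) : ¬ T.Nodup := by
  intro hd
  have := (List.subperm_of_subset hd fun a ha => (h.mem_iff hT a).2 ha).length_le
  simp at this; omega

theorem repeat_outer (h : Expanding R n w₀) {X Y : List ℕ} {A B : List ℕ}
    (hXY : R X (A ++ Y ++ B)) (hA : n ≤ A.length) (hB : n ≤ B.length) :
    ∃ A' B', R X (A' ++ Y ++ B') ∧ 2 * n ≤ A'.length ∧ 2 * n ≤ B'.length := by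
  obtain ⟨A', hA', hAl⟩ := h.pump hA (2 * n)
  obtain ⟨B', hB', hBl⟩ := h.pump hB (2 * n)
  exact ⟨A', B', h.inv.trans hXY (h.inv.append (h.inv.append hA' (h.inv.refl Y)) hB'), hAl, hBl⟩

theorem double (h : Expanding R n w₀) {A Y B : List ℕ} (hA : 2 * n ≤ A.length)
    (hB : 2 * n ≤ B.length) (hY : Y ≠ []) :
    ∃ A' V B', R (A ++ Y ++ B) (A' ++ (Y ++ V ++ Y) ++ B') ∧ 2 * n ≤ A'.length ∧
      2 * n ≤ B'.length := by
  obtain ⟨k, hk⟩ : ∃ k, 2 ≤ w₀.count k := by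
    by_contra! hc
    exact h.not_nodup h.rel h.lt (List.nodup_iff_count_le_one.2 fun a => by have := hc a; omega)
  have hkn : k < n := (h.mem_range h.rel k).1 (List.count_pos_iff.1 (by omega))
  obtain ⟨α, β, γ, hw⟩ := exists_two_occurrences hk
  obtain ⟨A0, A1, P, hA2, hA0, hP⟩ := exists_split A n k (by omega)
  obtain ⟨Q, B1, B0, hB2, hQ, hB0⟩ := exists_split B (n - 1 - k) n (by omega)
  obtain ⟨σ, hσ, hσk, hflat⟩ := exists_one_block (n := n) (P := P) (Y := Y) (Q := Q) hY
    (by omega)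
  have hrel := h.inv.subst σ hσ h.rel
  rw [hflat, hw] at hrel
  rw [hP] at hσk
  obtain ⟨A', B', h1, h2, h3⟩ := h.repeat_outer (X := A ++ Y ++ B) (Y := Y ++ β.flatMap σ ++ Y)
    (A := A0 ++ A1 ++ α.flatMap σ) (B := γ.flatMap σ ++ B1 ++ B0) (by
      have := h.inv.ctx (A0 ++ A1) (B1 ++ B0) hrel
      rw [hA2, hB2]
      simpa [hσk] using this) (by simp; omega) (by simp; omega)
  exact ⟨A', _, B', h1, h2, h3⟩

theorem double_apart (h : Expanding R n w₀) {A Y B : List ℕ} (hA : 2 * n ≤ A.length)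
    (hB : 2 * n ≤ B.length) (hY : Y ≠ []) (m : ℕ) :
    ∃ A' V B', R (A ++ Y ++ B) (A' ++ (Y ++ V ++ Y) ++ B') ∧ 2 * n ≤ A'.length ∧
      2 * n ≤ B'.length ∧ m ≤ V.length := by
  induction m with
  | zero =>
    obtain ⟨A', V, B', h1, h2, h3⟩ := h.double hA hB hY
    exact ⟨A', V, B', h1, h2, h3, Nat.zero_le _⟩
  | succ m ih =>
    obtain ⟨A', V, B', h1, h2, h3, h4⟩ := ih
    obtain ⟨A'', V', B'', h5, h6, h7⟩ := h.double (Y := Y ++ V ++ Y) h2 h3 (by simp [hY])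
    have := List.length_pos_of_ne_nil hY
    refine ⟨A'', V ++ Y ++ V' ++ Y ++ V, B'', h.inv.trans h1 ?_, h6, h7, by simp; omega⟩
    simpa using h5

theorem square (h : Expanding R n w₀) {A Y B : List ℕ} (hA : 2 * n ≤ A.length)
    (hB : 2 * n ≤ B.length) (hY : Y ≠ []) :
    ∃ A' B', R (A ++ Y ++ B) (A' ++ (Y ++ Y) ++ B') ∧ 2 * n ≤ A'.length ∧
      2 * n ≤ B'.length := by
  obtain ⟨A', V, B', h1, hA', hB', hV⟩ := h.double_apart hA hB hY n
  obtain ⟨α, k, l, β, hw, hlk⟩ := exists_descent (h.not_nodup h.rel h.lt)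
  have hkn : k < n := (h.mem_range h.rel k).1 (by simp [hw])
  obtain ⟨A0, A1, P, hA2, hA0, hP⟩ := exists_split A' n l (by omega)
  obtain ⟨Q, B1, B0, hB2, hQ, hB0⟩ := exists_split B' (n - 1 - k) n (by omega)
  suffices hs : ∃ C D, R (P ++ (Y ++ V ++ Y) ++ Q) (C ++ (Y ++ Y) ++ D) by
    obtain ⟨C, D, hCD⟩ := hs
    refine h.repeat_outer (A := A0 ++ A1 ++ C) (B := D ++ B1 ++ B0)
      (h.inv.trans h1 ?_) (by simp; omega) (by simp; omega)
    have := h.inv.ctx (A0 ++ A1) (B1 ++ B0) hCD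
    rw [hA2, hB2]
    simpa using this
  rcases hlk.eq_or_lt with rfl | hlk
  · obtain ⟨σ, hσ, hσk, hflat⟩ := exists_one_block (n := n) (P := P) (Y := Y ++ V ++ Y) (Q := Q)
      (by simp [hY]) (by omega)
    have hrel := h.inv.subst σ hσ h.rel
    rw [hflat, hw] at hrel
    rw [hP] at hσk
    refine ⟨α.flatMap σ ++ Y ++ V, V ++ Y ++ β.flatMap σ, ?_⟩
    simpa [hσk] using hrel
  · obtain ⟨E, V1, M, hV1, hE, hM⟩ := exists_split V 0 (k - l - 1) (by omega)
    obtain rfl : E = [] := List.length_eq_zero_iff.1 hE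
    rw [List.nil_append] at hV1
    obtain ⟨σ, hσ, hσl, hσk, hflat⟩ := exists_two_block (n := n) (P := P) (Y := Y ++ V1) (M := M)
      (Z := Y) (Q := Q) (by simp [hY]) hY (by omega)
    have hrel := h.inv.subst σ hσ h.rel
    rw [hflat, hw] at hrel
    rw [hP] at hσk hσl
    rw [show l + 1 + M.length = k by omega] at hσk
    refine ⟨α.flatMap σ, V1 ++ β.flatMap σ, ?_⟩
    rw [hV1]
    simpa [hσk, hσl] using hrel

theorem exists_lpow (h : Expanding R n w₀) {A Y B : List ℕ} (hA : 2 * n ≤ A.length)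
    (hB : 2 * n ≤ B.length) (hY : Y ≠ []) (j : ℕ) :
    ∃ A' B' m, R (A ++ Y ++ B) (A' ++ lpow m Y ++ B') ∧ 2 * n ≤ A'.length ∧
      2 * n ≤ B'.length ∧ j ≤ m := by
  suffices hs : ∃ A' B' m, R (A ++ Y ++ B) (A' ++ lpow (m + 1) Y ++ B') ∧ 2 * n ≤ A'.length ∧
      2 * n ≤ B'.length ∧ j ≤ m + 1 by
    obtain ⟨A', B', m, hs⟩ := hs
    exact ⟨A', B', m + 1, hs⟩
  induction j with
  | zero => exact ⟨A, B, 0, by rw [lpow_one]; exact h.inv.refl _, hA, hB, by omega⟩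
  | succ j ih =>
    obtain ⟨A', B', m, h1, h2, h3, h4⟩ := ih
    obtain ⟨A'', B'', h5, h6, h7⟩ := h.square (Y := lpow (m + 1) Y) h2 h3
      (lpow_ne_nil (by omega) hY)
    rw [← lpow_add] at h5
    exact ⟨A'', B'', m + 1 + m, h.inv.trans h1 h5, h6, h7, by omega⟩

theorem replicate_shift (h : Expanding R n w₀) {T : List ℕ} (hT : R (List.range n) T) {a : ℕ}
    (ha : a < n) (e : ℕ) {M : ℕ} (hM : n ≤ M) (j : ℕ) :
    R (List.replicate M e) (List.replicate (M + j * (T.count a - 1)) e) := by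
  have hw := h.inv.replicate_length h.rel e
  rw [List.length_range, ← Nat.add_sub_cancel' h.lt.le] at hw
  have hp : ∀ M t, n ≤ M → R (List.replicate M e) (List.replicate (M + t * (w₀.length - n)) e) :=
    fun M t hM => h.inv.replicate_period hw hM t
  have h1 := h.inv.replicate_add (h.inv.replicate_length hT e) 1
  have h2 := h.inv.replicate_length_add_count hT a e
  have hc : 0 < T.count a := List.count_pos_iff.2 ((h.mem_range hT a).2 ha)
  rw [List.length_range] at h1
  rw [List.length_range, List.count_eq_one_of_mem List.nodup_range (by simpa using ha)] at h2
  have h3 := h.inv.trans (h.inv.symm h1) h2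
  rw [show T.length + T.count a = T.length + 1 + (T.count a - 1) by omega] at h3
  have hlt := h.lt
  have hle : T.length + 1 ≤ (T.length + 1) * (w₀.length - n) :=
    Nat.le_mul_of_pos_right _ (by omega)
  have h4 := h.inv.replicate_period h3
    (M := M + (T.length + 1) * (w₀.length - n)) (by omega) j
  have h5 := hp (M + j * (T.count a - 1)) (T.length + 1) (by omega)
  rw [Nat.add_right_comm] at h5
  exact h.inv.trans (h.inv.trans (hp M _ hM) h4) (h.inv.symm h5)

theorem count_flatMap_gadget (P Q : ℕ → List ℕ) (m x : ℕ → ℕ) {es : List ℕ} (hes : es.Nodup)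
    (a : ℕ) :
    (es.flatMap fun e => P e ++ List.replicate (m e + x e) e ++ Q e).count a =
      (es.flatMap fun e => P e ++ List.replicate (m e) e ++ Q e).count a +
        if a ∈ es then x a else 0 := by
  induction es with
  | nil => simp
  | cons e t ih =>
    rw [List.nodup_cons] at hes
    simp only [List.flatMap_cons, List.count_append, ih hes.2, List.count_replicate,
      List.mem_cons]
    by_cases ha : a = e
    · subst ha
      simp [hes.1]; omega
    · simp [ha, Ne.symm ha]; omega

theorem exists_count_modEq_one (h : Expanding R n w₀) (r : ℕ) :
    ∃ w, R (List.range n) w ∧ n < w.length ∧ ∀ a < n, ∃ q, w.count a = 1 + (r + 1) * q := by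
  have hpos := h.pos
  obtain ⟨L, C, M, hT, hC, hdeep, hone⟩ := h.exists_core
  have hClen : 2 * n + 2 * n ≤ C.length := by
    obtain ⟨e, he⟩ := List.exists_mem_of_ne_nil _ hC
    obtain ⟨U, W, rfl, hU, hW⟩ := hdeep e he
    simp; omega
  obtain ⟨A, Y, B, hCeq, hA, hB⟩ := exists_split C (2 * n) (2 * n) hClen
  have hYdeep : ∀ e ∈ C, Deep (2 * n) Y e := fun e he => by
    have := hdeep e he
    rw [hCeq] at this
    exact this.factor (by omega) (by omega)
  have hY : Y ≠ [] := by
    obtain ⟨e, he⟩ := List.exists_mem_of_ne_nil _ hC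
    exact List.ne_nil_of_mem (hYdeep e he).mem
  have hpow : ∀ e, ∃ P Q m, e ∈ C → n ≤ m ∧ R Y (P ++ List.replicate m e ++ Q) := by
    intro e
    by_cases he : e ∈ C
    · obtain ⟨U, W, hUW, hU, hW⟩ := hYdeep e he
      obtain ⟨P, Q, m, h1, -, -, h4⟩ := h.exists_lpow (Y := [e]) hU hW (by simp) n
      refine ⟨P, Q, m, fun _ => ⟨h4, ?_⟩⟩
      rw [lpow_singleton] at h1
      rw [hUW]
      simpa using h1
    · exact ⟨[], [], 0, fun h => absurd h he⟩
  choose P Q m hPQ using hpow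
  obtain ⟨A', B', j, hAB, hA', hB', hj⟩ := h.exists_lpow (A := A) (B := B) (by omega)
    (by omega) hY C.dedup.length
  replace hAB : R C (A' ++ lpow j Y ++ B') := by rw [hCeq]; exact hAB
  obtain ⟨i, rfl⟩ := Nat.exists_eq_add_of_le hj
  rw [lpow_add] at hAB
  let G : (ℕ → ℕ) → List ℕ := fun x =>
    C.dedup.flatMap fun e => P e ++ List.replicate (m e + x e) e ++ Q e
  let F : (ℕ → ℕ) → List ℕ := fun x =>
    L ++ (A' ++ (G x ++ lpow i Y) ++ B') ++ M
  have hG0 : ∀ es : List ℕ, (∀ e ∈ es, e ∈ C) → R (lpow es.length Y)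
      (es.flatMap fun e => P e ++ List.replicate (m e + 0) e ++ Q e) := by
    intro es hes
    induction es with
    | nil => exact h.inv.refl _
    | cons e t ih =>
      rw [List.length_cons, lpow_succ, List.flatMap_cons]
      exact h.inv.append (hPQ e (hes e (by simp))).2 (ih fun x hx => hes x (by simp [hx]))
  have hF0 : R (List.range n) (F fun _ => 0) := by
    refine h.inv.trans hT (h.inv.ctx L M ?_)
    refine h.inv.trans hAB (h.inv.ctx A' B' ?_)
    exact h.inv.append (hG0 _ fun e he => List.mem_dedup.1 he) (h.inv.refl _)
  let x : ℕ → ℕ := fun e => r * ((F fun _ => 0).count e - 1)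
  have hx : ∀ es : List ℕ, (∀ e ∈ es, e ∈ C) →
      R (es.flatMap fun e => P e ++ List.replicate (m e + 0) e ++ Q e)
        (es.flatMap fun e => P e ++ List.replicate (m e + x e) e ++ Q e) := by
    intro es hes
    induction es with
    | nil => exact h.inv.refl _
    | cons e t ih =>
      rw [List.flatMap_cons, List.flatMap_cons]
      have he := hes e (by simp)
      refine h.inv.append (h.inv.ctx _ _ ?_) (ih fun x hx => hes x (by simp [hx]))
      exact h.replicate_shift hF0 ((h.mem_range hT e).1 (by simp [he])) e (hPQ e he).1 r
  have hFx : R (F fun _ => 0) (F x) := by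
    refine h.inv.ctx L M (h.inv.ctx A' B' (h.inv.append ?_ (h.inv.refl _)))
    exact hx _ fun e he => List.mem_dedup.1 he
  have hcount : ∀ a, (F x).count a = (F fun _ => 0).count a + if a ∈ C then x a else 0 := by
    intro a
    have h1 := count_flatMap_gadget P Q m x (List.nodup_dedup C) a
    simp only [List.mem_dedup] at h1
    simp only [F, G, List.count_append, h1, Nat.add_zero]
    omega
  refine ⟨F x, h.inv.trans hF0 hFx, ?_, fun a ha => ?_⟩
  · simp [F]; omega
  · have hc : 0 < (F fun _ => 0).count a := List.count_pos_iff.2 ((h.mem_range hF0 a).2 ha)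
    by_cases haC : a ∈ C
    · refine ⟨(F fun _ => 0).count a - 1, ?_⟩
      rw [hcount, if_pos haC, Nat.add_mul]
      simp only [x]
      omega
    · refine ⟨0, ?_⟩
      rw [hcount, if_neg haC, Nat.mul_zero, Nat.add_zero, Nat.add_zero]
      have h1 := hone a ha haC
      have h2 : a ∉ A' ++ (G (fun _ => 0) ++ lpow i Y) ++ B' := by
        intro hmem
        refine haC ((h.mem_iff (h.inv.trans hAB (h.inv.ctx A' B' ?_)) a).2 hmem)
        exact h.inv.append (hG0 _ fun e he => List.mem_dedup.1 he) (h.inv.refl _)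
      have h3 := List.count_eq_zero.2 h2
      rw [List.count_append, List.count_append, List.count_eq_zero.2 haC] at h1
      simp only [F]
      rw [List.count_append, List.count_append, h3]
      exact h1

end Expanding

/-- Two words have the same letters. -/
def SameLetters (a b : List ℕ) : Prop := ∀ x, x ∈ a ↔ x ∈ b

theorem sameLetters_fullyInvariant : FullyInvariant SameLetters where
  refl _ _ := Iff.rfl
  symm h x := (h x).symm
  trans h k x := (h x).trans (k x)
  append h k x := by simp [h x, k x]
  subst σ _ h x := by
    simp only [List.mem_flatMap]
    exact exists_congr fun y => and_congr_left fun _ => h y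
  nil h := List.eq_nil_iff_forall_not_mem.2 fun x hx => by simpa using (h x).2 hx

theorem flatMap_eq_self {σ : ℕ → List ℕ} {l : List ℕ} (h : ∀ a ∈ l, σ a = [a]) :
    l.flatMap σ = l := by
  induction l with
  | nil => rfl
  | cons a t ih =>
    rw [List.flatMap_cons, h a (by simp), ih fun b hb => h b (by simp [hb])]; rfl

theorem count_flatMap_of_mem_iff {σ : ℕ → List ℕ} {l : List ℕ} {a b k : ℕ}
    (hb : (σ b).count a = k) (h : ∀ i ∈ l, i ≠ b → a ∉ σ i) :
    (l.flatMap σ).count a = k * l.count b := by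
  induction l with
  | nil => simp
  | cons c t ih =>
    rw [List.flatMap_cons, List.count_append, ih fun i hi => h i (by simp [hi])]
    by_cases hc : c = b
    · subst hc; rw [hb, List.count_cons_self, Nat.mul_add]; omega
    · rw [List.count_eq_zero.2 (h c (by simp) hc), List.count_cons_of_ne hc]; omega

theorem perm_of_nodup_of_sameLetters {u v : List ℕ} (hu : u.Nodup) (hv : v.Nodup)
    (h : SameLetters u v) : u.Perm v :=
  (List.perm_ext_iff_of_nodup hu hv).2 h

theorem length_lt_of_not_nodup {u v : List ℕ} (hu : u.Nodup) (hv : ¬ v.Nodup)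
    (h : SameLetters u v) : u.length < v.length := by
  have h1 : u.Subperm v := List.subperm_of_subset hu fun a ha => (h a).1 ha
  rcases h1.length_le.lt_or_eq with h2 | h2
  · exact h2
  · exact absurd ((h1.perm_of_length_le h2.ge).nodup_iff.1 hu) hv

theorem flatMap_getD_range (u : List ℕ) :
    (List.range u.length).flatMap (fun i => [u.getD i 0]) = u := by
  rw [← List.map_eq_flatMap]
  apply List.ext_getElem (by simp)
  intro i h1 h2
  simp [List.getD_eq_getElem?_getD, h2]

theorem flatMap_idxOf {u : List ℕ} (hu : u.Nodup) :
    u.flatMap (fun a => [u.idxOf a]) = List.range u.length := by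
  rw [← List.map_eq_flatMap]
  apply List.ext_getElem (by simp)
  intro i h1 h2
  simp [hu.idxOf_getElem]

namespace FullyInvariant

variable {R : List ℕ → List ℕ → Prop}

/-- If a linear word `u` is identified with some word that is not a permutation of `u`, then it is
identified with a nonlinear word on the same letters each of which occurs a number of times
congruent to `1` modulo `r`. -/
theorem exists_nonlinear (hR : FullyInvariant R) {u v : List ℕ} (hu : u.Nodup) (huv : R u v)
    (hv : ¬ u.Perm v) {r : ℕ} (hr : 1 ≤ r) :
    ∃ w, R u w ∧ SameLetters u w ∧ ¬ w.Nodup ∧ ∀ a ∈ u, ∃ q, w.count a = 1 + r * q := by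
  by_cases hsub : ∃ a ∈ u, a ∉ v
  · obtain ⟨a, hau, hav⟩ := hsub
    let σ : ℕ → List ℕ := fun i => if i = a then List.replicate (1 + r) a else [i]
    have hσ : ∀ i, σ i ≠ [] := by
      intro i; by_cases hi : i = a <;> simp [σ, hi]
    have h1 := hR.subst σ hσ huv
    rw [flatMap_eq_self (l := v) fun b hb => by
      have : b ≠ a := by rintro rfl; exact hav hb
      simp [σ, this]] at h1
    have hcount : ∀ b, (u.flatMap σ).count b = (if b = a then 1 + r else 1) * u.count b := by
      intro b
      refine count_flatMap_of_mem_iff ?_ fun i _ hib => ?_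
      · by_cases hb : b = a <;> simp [σ, hb]
      · by_cases hi : i = a
        · subst hi; simp [σ, List.mem_replicate, Ne.symm hib]
        · simp [σ, hi, Ne.symm hib]
    refine ⟨_, hR.trans huv (hR.symm h1), fun b => ?_, fun hd => ?_, fun b hb => ?_⟩
    · rw [← List.count_pos_iff, ← List.count_pos_iff, hcount]
      split <;> simp
    · have h2 := List.nodup_iff_count_le_one.1 hd a
      rw [hcount, if_pos rfl, List.count_eq_one_of_mem hu hau] at h2
      omega
    · rw [hcount, List.count_eq_one_of_mem hu hb]
      by_cases hba : b = a
      · exact ⟨1, by simp [hba]⟩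
      · exact ⟨0, by simp [hba]⟩
  · push Not at hsub
    obtain ⟨w, huw, hsame, hnd⟩ : ∃ w, R u w ∧ SameLetters u w ∧ ¬ w.Nodup := by
      let σ : ℕ → List ℕ := fun i => if i ∈ u then [i] else u ++ u
      have hu0 : u ≠ [] := by
        rintro rfl
        rw [hR.nil huv] at hv; exact hv (List.Perm.refl _)
      have hσ : ∀ i, σ i ≠ [] := by
        intro i; by_cases hi : i ∈ u <;> simp [σ, hi, hu0]
      have h1 := hR.subst σ hσ huv
      rw [flatMap_eq_self (l := u) fun b hb => by simp [σ, hb]] at h1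
      have hsame : SameLetters u (v.flatMap σ) := by
        intro x
        rw [List.mem_flatMap]
        constructor
        · intro hx; exact ⟨x, hsub x hx, by simp [σ, hx]⟩
        · rintro ⟨y, -, hx⟩
          by_cases hy : y ∈ u
          · simp only [σ, if_pos hy, List.mem_singleton] at hx
            exact hx ▸ hy
          · simpa [σ, hy] using hx
      refine ⟨_, h1, hsame, fun hd => ?_⟩
      by_cases hout : ∀ y ∈ v, y ∈ u
      · rw [flatMap_eq_self (l := v) fun b hb => by simp [σ, hout b hb]] at hd hsame
        exact hv (perm_of_nodup_of_sameLetters hu hd hsame)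
      · push Not at hout
        obtain ⟨y, hyv, hyu⟩ := hout
        have h2 := (infix_flatMap_of_mem (σ := σ) hyv).sublist.nodup hd
        simp only [σ, if_neg hyu] at h2
        obtain ⟨x, hx⟩ := List.exists_mem_of_ne_nil _ hu0
        exact List.disjoint_of_nodup_append h2 hx hx
    have hR' := hR.inf sameLetters_fullyInvariant
    have hexp : Expanding (fun a b => R a b ∧ SameLetters a b) u.length
        (w.flatMap fun a => [u.idxOf a]) := by
      refine ⟨hR', fun h => h.2, ?_, ?_⟩
      · have := hR'.subst (fun a => [u.idxOf a]) (by simp) ⟨huw, hsame⟩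
        rwa [flatMap_idxOf hu] at this
      · rw [← List.map_eq_flatMap, List.length_map]
        exact length_lt_of_not_nodup hu hnd hsame
    obtain ⟨t, ht, htl, htc⟩ := hexp.exists_count_modEq_one (r - 1)
    have h3 := hR'.subst (fun i => [u.getD i 0]) (by simp) ht
    rw [flatMap_getD_range] at h3
    refine ⟨_, h3.1, h3.2, fun hd => ?_, fun a ha => ?_⟩
    · have := (perm_of_nodup_of_sameLetters hu hd h3.2).length_eq
      rw [← List.map_eq_flatMap, List.length_map] at this
      omega
    · have hia : u.idxOf a < u.length := List.idxOf_lt_length_iff.2 ha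
      have hget : ∀ i, i < u.length → u.getD i 0 = a → i = u.idxOf a := by
        intro i hi h
        rw [← h, List.getD_eq_getElem _ _ hi, hu.idxOf_getElem]
      rw [count_flatMap_of_mem_iff (b := u.idxOf a) (k := 1)]
      · obtain ⟨q, hq⟩ := htc _ hia
        exact ⟨q, by rw [one_mul, hq, Nat.sub_add_cancel hr]⟩
      · rw [List.getD_eq_getElem _ _ hia, List.getElem_idxOf]; simp
      · intro i hi hne hmem
        rw [List.mem_singleton] at hmem
        exact hne (hget i ((hexp.mem_range ht i).1 hi) hmem.symm)

end FullyInvariant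

theorem count_filter_ite (p : ℕ → Bool) (l : List ℕ) (a : ℕ) :
    (l.filter p).count a = if p a then l.count a else 0 := by
  split_ifs with h
  · exact List.count_filter h
  · exact List.count_eq_zero_of_not_mem fun hc => h (List.mem_filter.1 hc).2

namespace FullyInvariant

variable {R : List ℕ → List ℕ → Prop}

theorem replicate_letter (hR : FullyInvariant R) {i j a : ℕ}
    (h : R (List.replicate i a) (List.replicate j a)) (b : ℕ) :
    R (List.replicate i b) (List.replicate j b) := by
  simpa using hR.replicate_length h b

/-- The differences of the exponents of identified powers of a letter. -/
def expDiff (hR : FullyInvariant R) : AddSubgroup ℤ where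
  carrier := {z | ∃ i j : ℕ, (j : ℤ) - i = z ∧ R (List.replicate i 0) (List.replicate j 0)}
  zero_mem' := ⟨0, 0, by simp, hR.refl _⟩
  add_mem' := by
    rintro _ _ ⟨i, j, rfl, h⟩ ⟨k, l, rfl, h'⟩
    refine ⟨i + k, j + l, by push_cast; ring, ?_⟩
    rw [List.replicate_add, List.replicate_add]
    exact hR.append h h'
  neg_mem' := by
    rintro _ ⟨i, j, rfl, h⟩
    exact ⟨j, i, by ring, hR.symm h⟩

theorem count_sub_mem_expDiff (hR : FullyInvariant R) {l l' : List ℕ} (h : R l l') (a : ℕ) :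
    (l'.count a : ℤ) - l.count a ∈ hR.expDiff := by
  have h1 : (l'.length : ℤ) - l.length ∈ hR.expDiff := ⟨_, _, rfl, hR.replicate_length h 0⟩
  have h2 : ((l'.length + l'.count a : ℕ) : ℤ) - (l.length + l.count a : ℕ) ∈ hR.expDiff :=
    ⟨_, _, rfl, hR.replicate_length_add_count h a 0⟩
  have h3 := hR.expDiff.sub_mem h2 h1
  have h4 : ((l'.length + l'.count a : ℕ) : ℤ) - (l.length + l.count a : ℕ) -
      ((l'.length : ℤ) - l.length) = (l'.count a : ℤ) - l.count a := by push_cast; ring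
  rwa [h4] at h3

theorem expDiff_mono {S : List ℕ → List ℕ → Prop} (hR : FullyInvariant R)
    (hS : FullyInvariant S) (h : ∀ {a b}, R a b → S a b) : hR.expDiff ≤ hS.expDiff := by
  rintro _ ⟨i, j, rfl, hij⟩
  exact ⟨i, j, rfl, h hij⟩

theorem inf_expDiff_le {S : List ℕ → List ℕ → Prop} (hR : FullyInvariant R)
    (hS : FullyInvariant S) : hR.expDiff ⊓ hS.expDiff ≤ (hR.inf hS).expDiff := by
  rintro z ⟨⟨i, j, h1, hij⟩, ⟨k, l, h2, hkl⟩⟩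
  refine ⟨i + k, j + k, by push_cast; omega, hR.replicate_add hij k, ?_⟩
  have h3 := hS.replicate_add hkl i
  rwa [show l + i = j + k by omega, Nat.add_comm k i] at h3

/-- Periodicity: exponents at least `r` may be shifted by elements of `expDiff`. -/
theorem replicate_of_mem_expDiff (hR : FullyInvariant R) {r : ℕ} (hr : 1 ≤ r)
    (hper : R (List.replicate r 0) (List.replicate (r + r) 0)) {M k : ℕ} (hM : r ≤ M)
    (hk : (k : ℤ) ∈ hR.expDiff) (a : ℕ) :
    R (List.replicate M a) (List.replicate (M + k) a) := by
  apply hR.replicate_letter (a := 0)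
  obtain ⟨i, j, hij, h⟩ := hk
  obtain rfl : j = i + k := by omega
  have hi : i ≤ i * r := Nat.le_mul_of_pos_right _ hr
  have h1 := hR.replicate_period hper hM i
  have h2 := hR.replicate_period h (M := M + i * r) (by omega) 1
  have h3 := hR.replicate_period hper (M := M + k) (by omega) i
  rw [one_mul, Nat.add_right_comm] at h2
  exact hR.trans (hR.trans h1 h2) (hR.symm h3)

theorem of_perm_append (hR : FullyInvariant R) (hperm : ∀ {a b : List ℕ}, a.Perm b → R a b)
    {X Y l l' : List ℕ} (C : List ℕ) (h : R X Y) (hl : l.Perm (X ++ C)) (hl' : l'.Perm (Y ++ C)) :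
    R l l' :=
  hR.trans (hperm hl) (hR.trans (hR.append h (hR.refl C)) (hperm hl'.symm))

theorem append_of_replicate (hR : FullyInvariant R)
    (hperm : ∀ {a b : List ℕ}, a.Perm b → R a b) (l P : List ℕ)
    (h : ∀ a ∈ P, R l (l ++ List.replicate (P.count a) a)) : R l (l ++ P) := by
  induction hn : P.length using Nat.strong_induction_on generalizing P with
  | _ n ih =>
    subst hn
    cases P with
    | nil => simpa using hR.refl l
    | cons a t =>
      set P := a :: t with hP
      have h1 : R l (l ++ P.filter (· ≠ a)) := by
        refine ih _ ?_ _ (fun b hb => ?_) rfl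
        · exact List.length_filter_lt_length_iff_exists.2 ⟨a, by simp [hP], by simp⟩
        · rw [List.mem_filter] at hb
          rw [count_filter_ite, if_pos hb.2]
          exact h b hb.1
      refine hR.trans (h a (by simp [hP])) (hR.of_perm_append hperm
        (List.replicate (P.count a) a) h1 (List.Perm.refl _) ?_)
      rw [List.append_assoc, List.perm_append_left_iff, List.perm_iff_count]
      intro b
      rw [List.count_append, count_filter_ite, List.count_replicate]
      by_cases hb : b = a
      · simp [hb]
      · simp [hb, Ne.symm hb]

theorem of_append_replicate (hR : FullyInvariant R)
    (hperm : ∀ {a b : List ℕ}, a.Perm b → R a b) {r : ℕ} (hr : 1 ≤ r) {l l' : List ℕ}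
    (h : ∀ a, l.count a ≠ l'.count a →
      R l (l ++ List.replicate ((r - 1) * l.count a + l'.count a) a) ∧
        R l' (l' ++ List.replicate (r * l.count a) a)) : R l l' := by
  have h1 := hR.append_of_replicate hperm l
    ((lpow (r - 1) l ++ l').filter fun a => l.count a ≠ l'.count a) fun a ha => by
      rw [List.mem_filter] at ha
      rw [count_filter_ite, if_pos ha.2, List.count_append, count_lpow]
      exact (h a (by simpa using ha.2)).1
  have h2 := hR.append_of_replicate hperm l'
    ((lpow r l).filter fun a => l.count a ≠ l'.count a) fun a ha => by
      rw [List.mem_filter] at ha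
      rw [count_filter_ite, if_pos ha.2, count_lpow]
      exact (h a (by simpa using ha.2)).2
  refine hR.trans h1 (hR.trans (hperm (List.perm_iff_count.2 fun a => ?_)) (hR.symm h2))
  rw [List.count_append, List.count_append, count_filter_ite, count_filter_ite, List.count_append,
    count_lpow, count_lpow]
  obtain ⟨r, rfl⟩ := Nat.exists_eq_add_of_le' hr
  by_cases ha : l.count a = l'.count a
  · simp [ha]
  · simp [ha, add_mul]; omega

/-- Exponents which are at least `r` may be shifted by elements of `expDiff`. -/
theorem of_count_sub_mem_expDiff (hR : FullyInvariant R)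
    (hperm : ∀ {a b : List ℕ}, a.Perm b → R a b) {r : ℕ} (hr : 1 ≤ r)
    (hper : R (List.replicate r 0) (List.replicate (r + r) 0)) {l l' : List ℕ}
    (h : ∀ a, l.count a = l'.count a ∨ r ≤ l.count a ∧ r ≤ l'.count a ∧
      (l'.count a : ℤ) - l.count a ∈ hR.expDiff) : R l l' := by
  have hrd : (r : ℤ) ∈ hR.expDiff := ⟨r, r + r, by push_cast; ring, hper⟩
  have happ : ∀ (l : List ℕ) (a k : ℕ), r ≤ l.count a → (k : ℤ) ∈ hR.expDiff →
      R l (l ++ List.replicate k a) := by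
    intro l a k hl hk
    refine hR.of_perm_append hperm (l.filter (· ≠ a))
      (hR.replicate_of_mem_expDiff hr hper hl hk a) ?_ ?_ <;>
    · refine List.perm_iff_count.2 fun b => ?_
      simp only [List.count_append, count_filter_ite, List.count_replicate]
      by_cases hb : b = a
      · simp [hb]
      · simp [hb, Ne.symm hb]
  refine hR.of_append_replicate hperm hr fun a ha => ?_
  obtain ⟨h1, h2, h3⟩ := (h a).resolve_left ha
  have hm : ((r * l.count a : ℕ) : ℤ) ∈ hR.expDiff := by
    have := hR.expDiff.zsmul_mem hrd (l.count a)
    rwa [smul_eq_mul, mul_comm, ← Nat.cast_mul] at this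
  refine ⟨happ _ _ _ h1 ?_, happ _ _ _ h2 hm⟩
  have := hR.expDiff.add_mem hm h3
  obtain ⟨s, rfl⟩ := Nat.exists_eq_add_of_le' hr
  convert this using 1
  push_cast [Nat.add_sub_cancel]
  ring

/-- If powers of a letter can be padded by `r`, words with congruent exponents are identified. -/
theorem of_count_modEq (hR : FullyInvariant R)
    (hperm : ∀ {a b : List ℕ}, a.Perm b → R a b) {r : ℕ} (hr : 1 ≤ r) {l l' : List ℕ}
    (h : ∀ a, l.count a = l'.count a ∨ R l (l ++ List.replicate r a) ∧
      R l' (l' ++ List.replicate r a) ∧ l.count a ≡ l'.count a [MOD r]) : R l l' := by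
  have hk : ∀ (l : List ℕ) (a k : ℕ), R l (l ++ List.replicate r a) →
      R l (l ++ List.replicate (r * k) a) := by
    intro l a k h
    induction k with
    | zero => simpa using hR.refl l
    | succ k ih =>
      rw [Nat.mul_succ, Nat.add_comm, List.replicate_add, ← List.append_assoc]
      exact hR.trans h (hR.of_perm_append hperm (List.replicate r a) ih (List.Perm.refl _)
        (by rw [List.append_assoc, List.append_assoc]
            exact (List.perm_append_comm).append_left l))
  refine hR.of_append_replicate hperm hr fun a ha => ?_
  obtain ⟨h1, h2, h3⟩ := (h a).resolve_left ha
  refine ⟨?_, hk _ _ _ h2⟩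
  obtain ⟨m, hm⟩ : r ∣ (r - 1) * l.count a + l'.count a := by
    obtain ⟨s, rfl⟩ := Nat.exists_eq_add_of_le' hr
    rw [Nat.add_sub_cancel, ← Nat.modEq_zero_iff_dvd]
    calc s * l.count a + l'.count a ≡ s * l.count a + l.count a [MOD s + 1] :=
          Nat.ModEq.add_left _ h3.symm
      _ = (s + 1) * l.count a := by ring
      _ ≡ 0 [MOD s + 1] := by simp [Nat.modEq_zero_iff_dvd]
  rw [hm]
  exact hk _ _ _ h1

end FullyInvariant

/-- The join of two relations. -/
def relSup (R S : List ℕ → List ℕ → Prop) : List ℕ → List ℕ → Prop :=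
  Relation.ReflTransGen fun a b => R a b ∨ S a b

/-- The meet of two relations. -/
def relInf (R S : List ℕ → List ℕ → Prop) : List ℕ → List ℕ → Prop :=
  fun a b => R a b ∧ S a b

theorem relSup_left {R S : List ℕ → List ℕ → Prop} {a b : List ℕ} (h : R a b) : relSup R S a b :=
  Relation.ReflTransGen.single (Or.inl h)

theorem relSup_right {R S : List ℕ → List ℕ → Prop} {a b : List ℕ} (h : S a b) : relSup R S a b :=
  Relation.ReflTransGen.single (Or.inr h)

/-- A chain leaving a property has a step that leaves it. -/
theorem relSup_exit {R S : List ℕ → List ℕ → Prop} {u v : List ℕ} (h : relSup R S u v)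
    (Q : List ℕ → Prop) (hu : Q u) (hv : ¬ Q v) :
    ∃ s t, Q s ∧ ¬ Q t ∧ (R s t ∨ S s t) := by
  induction h with
  | refl => exact absurd hu hv
  | @tail b c _ hbc ih =>
    by_cases hb : Q b
    · exact ⟨b, c, hb, hv, hbc⟩
    · exact ih hb

theorem flatMap_replicate (k a : ℕ) (σ : ℕ → List ℕ) :
    (List.replicate k a).flatMap σ = lpow k (σ a) := by
  induction k with
  | zero => rfl
  | succ k ih => rw [List.replicate_succ, List.flatMap_cons, ih, lpow_succ]

theorem count_replicate_ite (k a b : ℕ) :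
    (List.replicate k a).count b = if b = a then k else 0 := by
  by_cases h : b = a
  · simp [h]
  · rw [if_neg h]; exact List.count_eq_zero_of_not_mem fun hc => h (List.eq_of_mem_replicate hc)

namespace FullyInvariant

variable {R : List ℕ → List ℕ → Prop}

theorem exists_replicate_of_not_sameLetters (hR : FullyInvariant R) {s t : List ℕ} (h : R s t)
    (hst : ¬ SameLetters s t) :
    ∃ B w, 1 ≤ B ∧ R (List.replicate B 0) w ∧ ∀ x, x ∈ w ↔ x = 0 ∨ x = 1 := by
  have key : ∀ {s t : List ℕ}, R s t → ∀ a, a ∈ t → a ∉ s →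
      ∃ B w, 1 ≤ B ∧ R (List.replicate B 0) w ∧ ∀ x, x ∈ w ↔ x = 0 ∨ x = 1 := by
    intro s t h a hat has
    have h1 := hR.subst (fun i => if i = a then [0, 1] else [0]) (by intro i; split <;> simp) h
    have h2 : s.flatMap (fun i => if i = a then [0, 1] else [0]) = List.replicate s.length 0 := by
      rw [← flatMap_singleton_const]
      exact List.flatMap_congr fun i hi => if_neg (ne_of_mem_of_not_mem hi has)
    refine ⟨s.length, _, ?_, h2 ▸ h1, ?_⟩
    · rw [Nat.one_le_iff_ne_zero, Ne, List.length_eq_zero_iff]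
      rintro rfl
      rw [hR.nil h] at hat
      simp at hat
    · intro x
      rw [List.mem_flatMap]
      constructor
      · rintro ⟨i, -, hi⟩
        split_ifs at hi <;> simp at hi <;> omega
      · intro hx
        exact ⟨a, hat, by simpa using hx⟩
  simp only [SameLetters, not_forall] at hst
  obtain ⟨a, ha⟩ := hst
  by_cases hs : a ∈ s
  · exact key (hR.symm h) a hs fun hc => ha ⟨fun _ => hc, fun _ => hs⟩
  · exact key h a (by by_contra hc; exact ha ⟨fun h => absurd h hs, fun h => absurd h hc⟩) hs

theorem exists_replicate_mul_add (hR : FullyInvariant R) {a j : ℕ} (hj : 1 ≤ j) {t : List ℕ}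
    (h : R (List.replicate j a) t) (ht : t ≠ List.replicate j a) (r : ℕ) :
    ∃ d, 1 ≤ d ∧ R (List.replicate j a) (List.replicate (j + d * r) a) := by
  have key : ∃ i, i ≠ j ∧ R (List.replicate j a) (List.replicate i a) := by
    by_cases hb : ∃ b ∈ t, b ≠ a
    · obtain ⟨b, hbt, hba⟩ := hb
      have h1 := hR.subst (fun i => if i = b then List.replicate (j + 1) a else [a])
        (by intro i; split <;> simp) h
      rw [flatMap_replicate, if_neg (Ne.symm hba), lpow_singleton] at h1
      have h2 := infix_flatMap_of_mem (σ := fun i => if i = b then List.replicate (j + 1) a else [a]) hbt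
      set t' := t.flatMap fun i => if i = b then List.replicate (j + 1) a else [a] with ht'
      have h3 : t' = List.replicate t'.length a := by
        rw [List.eq_replicate_iff]
        refine ⟨rfl, fun x hx => ?_⟩
        rw [ht', List.mem_flatMap] at hx
        obtain ⟨i, -, hi⟩ := hx
        split_ifs at hi
        · exact List.eq_of_mem_replicate hi
        · simpa using hi
      have h4 := h2.length_le
      rw [if_pos rfl, List.length_replicate] at h4
      exact ⟨t'.length, by omega, h3 ▸ h1⟩
    · push Not at hb
      have h3 : t = List.replicate t.length a := List.eq_replicate_iff.2 ⟨rfl, hb⟩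
      exact ⟨t.length, fun hc => ht (hc ▸ h3), h3 ▸ h⟩
  obtain ⟨i, hij, hi⟩ := key
  rcases Nat.lt_or_gt_of_ne hij with hlt | hgt
  · obtain ⟨e, rfl⟩ := Nat.exists_eq_add_of_le hlt.le
    refine ⟨e, by omega, ?_⟩
    rw [Nat.mul_comm]
    exact hR.replicate_period (hR.symm hi) (by omega) r
  · obtain ⟨e, rfl⟩ := Nat.exists_eq_add_of_le hgt.le
    refine ⟨e, by omega, ?_⟩
    rw [Nat.mul_comm]
    exact hR.replicate_period hi le_rfl r

end FullyInvariant

/-- A commutative fully invariant relation under which exponents `≥ 2` in long nonlinear words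
only matter modulo `r`. -/
structure ModPeriod (θ : List ℕ → List ℕ → Prop) (r : ℕ) : Prop where
  inv : FullyInvariant θ
  perm : ∀ {a b : List ℕ}, a.Perm b → θ a b
  four_le : 4 ≤ r
  count_congr : ∀ {l l' : List ℕ}, ¬ l.Nodup → ¬ l'.Nodup → 4 ≤ l.length → 4 ≤ l'.length →
    (∀ a, l.count a = l'.count a ∨
      2 ≤ l.count a ∧ 2 ≤ l'.count a ∧ l.count a ≡ l'.count a [MOD r]) → θ l l'

theorem not_nodup_of_two_le_count {l : List ℕ} {a : ℕ} (h : 2 ≤ l.count a) : ¬ l.Nodup :=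
  fun hd => by have := List.nodup_iff_count_le_one.1 hd a; omega

theorem exists_two_le_count {l : List ℕ} (h : ¬ l.Nodup) : ∃ a, 2 ≤ l.count a := by
  by_contra! hc
  exact h (List.nodup_iff_count_le_one.2 fun a => by have := hc a; omega)

namespace ModPeriod

variable {θ : List ℕ → List ℕ → Prop} {r : ℕ}

theorem count_congr_of_four_le (h : ModPeriod θ r) {l l' : List ℕ} {x : ℕ} (hx : 4 ≤ l.count x)
    (hx' : 4 ≤ l'.count x) (hc : ∀ a, l.count a = l'.count a ∨
      2 ≤ l.count a ∧ 2 ≤ l'.count a ∧ l.count a ≡ l'.count a [MOD r]) : θ l l' :=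
  h.count_congr (not_nodup_of_two_le_count (a := x) (by omega))
    (not_nodup_of_two_le_count (a := x) (by omega)) (hx.trans List.count_le_length)
    (hx'.trans List.count_le_length) hc

theorem replicate_congr (h : ModPeriod θ r) {i j : ℕ} (hi : 4 ≤ i) (hj : 4 ≤ j)
    (hij : i ≡ j [MOD r]) (a : ℕ) : θ (List.replicate i a) (List.replicate j a) := by
  refine h.count_congr_of_four_le (x := a) (by simpa) (by simpa) fun b => ?_
  rw [count_replicate_ite, count_replicate_ite]
  split_ifs
  · exact Or.inr ⟨by omega, by omega, hij⟩
  · exact Or.inl rfl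

theorem period (h : ModPeriod θ r) :
    θ (List.replicate r 0) (List.replicate (r + r) 0) :=
  h.replicate_congr h.four_le (h.four_le.trans (by omega)) (by simp [Nat.ModEq]) 0

theorem one_le (h : ModPeriod θ r) : 1 ≤ r := by have := h.four_le; omega

theorem lpow_congr (h : ModPeriod θ r) {p q : List ℕ} (hp : p ≠ []) (hpq : SameLetters p q) :
    θ (lpow r p) (lpow r q) := by
  obtain ⟨x, hx⟩ := List.exists_mem_of_ne_nil p hp
  have h4 := h.four_le
  have hle : ∀ {p : List ℕ} {a : ℕ}, a ∈ p → r ≤ r * p.count a := fun ha =>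
    Nat.le_mul_of_pos_right _ (List.count_pos_iff.2 ha)
  refine h.count_congr_of_four_le (x := x) ?_ ?_ fun a => ?_
  · rw [count_lpow]; exact h4.trans (hle hx)
  · rw [count_lpow]; exact h4.trans (hle ((hpq x).1 hx))
  · rw [count_lpow, count_lpow]
    by_cases ha : a ∈ p
    · have h1 := hle ha
      have h2 := hle ((hpq a).1 ha)
      exact Or.inr ⟨by omega, by omega, by simp [Nat.ModEq]⟩
    · rw [List.count_eq_zero_of_not_mem ha,
        List.count_eq_zero_of_not_mem fun hc => ha ((hpq a).2 hc)]
      exact Or.inl rfl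

/-- If a linear word is identified with a suitable nonlinear one, it equals its power `r + 1`. -/
theorem nodup_rel_lpow (h : ModPeriod θ r) {ρ : List ℕ → List ℕ → Prop} (hρ : FullyInvariant ρ)
    (hle : ∀ {a b}, θ a b → ρ a b) {u w : List ℕ} (hu : u.Nodup) (huw : ρ u w)
    (hs : SameLetters u w) (hw : ¬ w.Nodup) (hc : ∀ a ∈ u, ∃ q, w.count a = 1 + r * q) :
    ρ u (lpow (1 + r) u) := by
  obtain ⟨a₀, ha₀⟩ := exists_two_le_count hw
  have ha₀u : a₀ ∈ u := (hs a₀).2 (List.count_pos_iff.1 (by omega))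
  have key : ∀ L : List ℕ, L ⊆ u → ∃ W, ρ u W ∧ SameLetters u W ∧
      (∀ a ∈ u, ∃ q, W.count a = 1 + r * q) ∧ ∀ b ∈ L, 2 ≤ W.count b := by
    intro L hL
    induction L with
    | nil => exact ⟨w, huw, hs, hc, by simp⟩
    | cons b L ih =>
      obtain ⟨W, hW, hsW, hcW, h2⟩ := ih fun x hx => hL (List.mem_cons_of_mem _ hx)
      have hbu : b ∈ u := hL (by simp)
      set f := Equiv.swap a₀ b with hf
      have hfu : ∀ x, f x ∈ u ↔ x ∈ u := by
        intro x
        rw [hf]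
        by_cases h1 : x = a₀
        · subst h1; simp [hbu, ha₀u]
        by_cases h2 : x = b
        · subst h2; simp [hbu, ha₀u]
        rw [Equiv.swap_apply_of_ne_of_ne h1 h2]
      have hmf : ∀ x, x ∈ u.map f ↔ x ∈ u := by
        intro x
        rw [List.mem_map]
        constructor
        · rintro ⟨y, hy, rfl⟩; exact (hfu y).2 hy
        · intro hx; exact ⟨f x, (hfu x).2 hx, by simp [hf]⟩
      have hpu : u.Perm (u.map f) :=
        (List.perm_ext_iff_of_nodup hu (hu.map f.injective)).2 fun x => (hmf x).symm
      have hw' : ρ u (w.map f) := by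
        have := hρ.subst (fun i => [f i]) (by simp) huw
        rw [← List.map_eq_flatMap, ← List.map_eq_flatMap] at this
        exact hρ.trans (hle (h.perm hpu)) this
      have hcw : ∀ x, (w.map f).count (f x) = w.count x :=
        fun x => List.count_map_of_injective _ _ f.injective _
      have hsub : u.Subperm W := List.subperm_of_subset hu fun x hx => (hsW x).1 hx
      have hp : W.Perm (u ++ W.diff u) := (List.subperm_append_diff_self_of_count_le
        fun x _ => List.Subperm.count_le hsub x).symm
      have hcount : ∀ x, (w.map f ++ W.diff u).count x + u.count x =
          (w.map f).count x + W.count x := by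
        intro x
        rw [List.count_append, hp.count_eq, List.count_append]; ring
      have hc' : ∀ a ∈ u, ∃ q, (w.map f).count a = 1 + r * q := by
        intro a ha
        obtain ⟨x, rfl⟩ : ∃ x, a = f x := ⟨f a, by simp [hf]⟩
        rw [hcw]
        exact hc x ((hfu x).1 ha)
      have hu1 : ∀ a ∈ u, u.count a = 1 := fun a ha => List.count_eq_one_of_mem hu ha
      have hcn : ∀ a ∈ u, ∃ q, (w.map f ++ W.diff u).count a = 1 + r * q := by
        intro a ha
        obtain ⟨q, hq⟩ := hc' a ha
        obtain ⟨q', hq'⟩ := hcW a ha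
        have := hcount a
        rw [hu1 a ha, hq, hq'] at this
        exact ⟨q + q', by rw [mul_add]; omega⟩
      refine ⟨w.map f ++ W.diff u, ?_, ?_, hcn, ?_⟩
      · exact hρ.trans hW (hρ.trans (hle (h.perm hp)) (hρ.append hw' (hρ.refl _)))
      · intro x
        constructor
        · intro hx
          obtain ⟨q, hq⟩ := hcn x hx
          exact List.count_pos_iff.1 (by omega)
        · intro hx
          rw [List.mem_append] at hx
          rcases hx with hx | hx
          · obtain ⟨y, hy, rfl⟩ := List.mem_map.1 hx
            exact (hfu y).2 ((hs y).2 hy)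
          · exact (hsW x).2 (List.diff_subset _ _ hx)
      · intro x hx
        have hxu := hL hx
        have h3 := hcount x
        rw [hu1 x hxu] at h3
        obtain ⟨q, hq⟩ := hc' x hxu
        rcases List.mem_cons.1 hx with rfl | hxL
        · have h4 := hcw a₀
          rw [hf, Equiv.swap_apply_left, ← hf] at h4
          obtain ⟨q', hq'⟩ := hcW x hxu
          omega
        · have := h2 x hxL
          omega
  obtain ⟨W, hW, hsW, hcW, h2⟩ := key u fun _ hx => hx
  have h4 := h.four_le
  refine hρ.trans hW (hle ?_)
  have hu1 := List.count_eq_one_of_mem hu ha₀u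
  refine h.count_congr_of_four_le (x := a₀) ?_ ?_ fun a => ?_
  · obtain ⟨q, hq⟩ := hcW a₀ ha₀u
    have := h2 a₀ ha₀u
    rcases q with _ | q
    · omega
    · rw [hq, mul_add]; omega
  · rw [count_lpow, hu1]; omega
  · rw [count_lpow]
    by_cases ha : a ∈ u
    · obtain ⟨q, hq⟩ := hcW a ha
      have := h2 a ha
      rw [List.count_eq_one_of_mem hu ha]
      exact Or.inr ⟨this, by omega, by rw [hq]; simp [Nat.ModEq]⟩
    · rw [List.count_eq_zero_of_not_mem ha,
        List.count_eq_zero_of_not_mem fun hc => ha ((hsW a).2 hc)]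
      exact Or.inl rfl

end ModPeriod

/-- A relation `θ` of period `r` below `β`, together with an arbitrary `γ`; the modular law for
`θ`, `β`, `γ` compares `β ∧ (θ ∨ γ)` with `θ ∨ (β ∧ γ)`. -/
structure ModularTriple (θ β γ : List ℕ → List ℕ → Prop) (r : ℕ) : Prop where
  mod : ModPeriod θ r
  invβ : FullyInvariant β
  invγ : FullyInvariant γ
  le : ∀ {a b}, θ a b → β a b

namespace ModularTriple

section

variable {θ β γ : List ℕ → List ℕ → Prop} {r : ℕ}

/-- The larger side `β ∧ (θ ∨ γ)` of the modular law. -/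
local notation "ε" => relInf β (relSup θ γ)

/-- The smaller side `θ ∨ (β ∧ γ)` of the modular law. -/
local notation "δ" => relSup θ (relInf β γ)

theorem invδ (c : ModularTriple θ β γ r) : FullyInvariant δ := c.mod.inv.sup (c.invβ.inf c.invγ)

theorem invε (c : ModularTriple θ β γ r) : FullyInvariant ε :=
  c.invβ.inf (c.mod.inv.sup c.invγ)

theorem permδ (c : ModularTriple θ β γ r) {a b : List ℕ} (h : a.Perm b) : δ a b :=
  relSup_left (c.mod.perm h)

theorem periodδ (c : ModularTriple θ β γ r) :
    δ (List.replicate r 0) (List.replicate (r + r) 0) := relSup_left c.mod.period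

theorem upper_of_lower (c : ModularTriple θ β γ r) {a b : List ℕ} (h : δ a b) : ε a b := by
  induction h with
  | refl => exact c.invε.refl _
  | tail _ h ih =>
    refine c.invε.trans ih ?_
    rcases h with h | h
    · exact ⟨c.le h, relSup_left h⟩
    · exact ⟨h.1, relSup_right h.2⟩

theorem count_sub_mem_expDiff (c : ModularTriple θ β γ r) {u v : List ℕ} (h : ε u v) (a : ℕ) :
    (v.count a : ℤ) - u.count a ∈ c.invδ.expDiff := by
  have h1 : (v.count a : ℤ) - u.count a ∈ c.mod.inv.expDiff ⊔ c.invγ.expDiff := by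
    have h2 := h.2
    clear h
    induction h2 with
    | refl => simp
    | @tail b d _ hbd ih =>
      have h2 : (d.count a : ℤ) - b.count a ∈ c.mod.inv.expDiff ⊔ c.invγ.expDiff := by
        rcases hbd with hbd | hbd
        · exact AddSubgroup.mem_sup_left (c.mod.inv.count_sub_mem_expDiff hbd a)
        · exact AddSubgroup.mem_sup_right (c.invγ.count_sub_mem_expDiff hbd a)
      have h3 := AddSubgroup.add_mem _ ih h2
      rwa [show (b.count a : ℤ) - u.count a + ((d.count a : ℤ) - b.count a) =
        (d.count a : ℤ) - u.count a by ring] at h3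
  have h2 : c.mod.inv.expDiff ≤ c.invβ.expDiff := c.mod.inv.expDiff_mono c.invβ c.le
  have h3 : (v.count a : ℤ) - u.count a ∈
      (c.mod.inv.expDiff ⊔ c.invγ.expDiff) ⊓ c.invβ.expDiff :=
    ⟨h1, c.invβ.count_sub_mem_expDiff h.1 a⟩
  rw [sup_inf_assoc_of_le _ h2] at h3
  refine sup_le (c.mod.inv.expDiff_mono c.invδ relSup_left) ?_ h3
  rw [inf_comm]
  exact (c.invβ.inf_expDiff_le c.invγ).trans
    ((c.invβ.inf c.invγ).expDiff_mono c.invδ fun h => relSup_right h)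

theorem lpow_append_lpow (c : ModularTriple θ β γ r) {u v : List ℕ} (h : ε u v) {p q : List ℕ}
    (hp : p ≠ []) (hq : q ≠ []) (hpq : SameLetters p q ∨ ¬ SameLetters u v) :
    δ (lpow r p) (lpow r p ++ lpow r q) := by
  by_cases hs : SameLetters p q
  · have h1 : δ (lpow r p) (lpow (r + r) p) := by
      have := c.invδ.subst (fun _ => p) (fun _ => hp) c.periodδ
      rwa [flatMap_replicate, flatMap_replicate] at this
    rw [lpow_add] at h1
    exact c.invδ.trans h1 (c.invδ.append (c.invδ.refl _)
      (relSup_left (c.mod.lpow_congr hp hs)))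
  have h01 : ∀ {ρ : List ℕ → List ℕ → Prop} (hρ : FullyInvariant ρ)
      (hle : ∀ {a b}, θ a b → ρ a b) {B : ℕ} {w : List ℕ}, 1 ≤ B →
      (∀ x, x ∈ w ↔ x = 0 ∨ x = 1) → ρ (lpow r (List.replicate B 0)) (lpow r w) →
      ρ (lpow r [0]) (lpow r [0, 1]) := by
    intro ρ hρ hle B w hB hw h
    have hw0 : w ≠ [] := List.ne_nil_of_mem ((hw 0).2 (by simp))
    refine hρ.trans (hle (c.mod.lpow_congr (by simp) fun x => ?_))
      (hρ.trans h (hle (c.mod.lpow_congr hw0 fun x => ?_)))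
    · simp; omega
    · simp [hw]
  have key : δ (lpow r [0]) (lpow r [0, 1]) := by
    have huv := hpq.resolve_left hs
    obtain ⟨s, t, hus, hut, hst⟩ := relSup_exit h.2 (SameLetters u)
      (sameLetters_fullyInvariant.refl u) huv
    have hst' : ¬ SameLetters s t := fun hc => hut (sameLetters_fullyInvariant.trans hus hc)
    rcases hst with hst | hst
    · obtain ⟨B, w, hB, h1, hw⟩ := c.mod.inv.exists_replicate_of_not_sameLetters hst hst'
      exact relSup_left (h01 c.mod.inv id hB hw (c.mod.inv.pow h1 r))
    · obtain ⟨B, w, hB, h1, hw⟩ := c.invγ.exists_replicate_of_not_sameLetters hst hst'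
      obtain ⟨B', w', hB', h1', hw'⟩ := c.invβ.exists_replicate_of_not_sameLetters h.1 huv
      have h2 := h01 c.invβ c.le hB' hw' (c.invβ.pow h1' r)
      have h3 : β (lpow r (List.replicate B 0)) (lpow r w) := by
        refine c.invβ.trans (c.le (c.mod.lpow_congr ?_ fun x => ?_))
          (c.invβ.trans h2 (c.le (c.mod.lpow_congr (by simp) fun x => ?_)))
        · simp; omega
        · simp; omega
        · simp [hw]
      exact h01 c.invδ relSup_left hB hw (relSup_right ⟨h3, c.invγ.pow h1 r⟩)
  have h1 := c.invδ.subst (fun i => if i = 0 then p else q) (by intro i; split <;> simpa) key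
  have hf : ∀ l : List ℕ, (lpow r l).flatMap (fun i => if i = 0 then p else q) =
      lpow r (l.flatMap fun i => if i = 0 then p else q) := by
    intro l
    generalize r = k
    induction k with
    | zero => rfl
    | succ k ih => rw [lpow_succ, List.flatMap_append, ih, lpow_succ]
  rw [hf, hf] at h1
  simp only [List.flatMap_cons, List.flatMap_nil, if_true, List.append_nil, one_ne_zero,
    if_false] at h1
  refine c.invδ.trans h1 (c.permδ (List.perm_iff_count.2 fun a => ?_))
  simp [count_lpow, mul_add]

theorem ne_nil (c : ModularTriple θ β γ r) {u v : List ℕ} (h : ε u v) (hu : u ≠ []) : v ≠ [] := by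
  rintro rfl
  exact hu (c.invε.nil (c.invε.symm h))

theorem lpow_rel_lpow (c : ModularTriple θ β γ r) {u v : List ℕ} (h : ε u v) (hu : u ≠ []) :
    δ (lpow (1 + r) u) (lpow (1 + r) v) := by
  have hv := c.ne_nil h hu
  have h1 := c.lpow_append_lpow h hu hv (em _)
  have h2 := c.lpow_append_lpow (c.invε.symm h) hv hu (em _)
  rw [lpow_add, lpow_add, lpow_one, lpow_one]
  refine c.invδ.trans (c.invδ.append (c.invδ.refl u) h1) (c.invδ.trans ?_
    (c.invδ.symm (c.invδ.append (c.invδ.refl v) h2)))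
  refine c.invδ.of_count_sub_mem_expDiff c.permδ c.mod.one_le c.periodδ fun a => ?_
  simp only [List.count_append, count_lpow]
  have hc := c.count_sub_mem_expDiff h a
  by_cases ha : u.count a = 0 ∧ v.count a = 0
  · simp [ha.1, ha.2]
  · right
    have h3 : r ≤ r * u.count a + r * v.count a := by
      rw [← mul_add]; exact Nat.le_mul_of_pos_right _ (by omega)
    refine ⟨by omega, by omega, ?_⟩
    convert hc using 1
    push_cast; ring

theorem replicate_rel_lpow (c : ModularTriple θ β γ r) {j a : ℕ} (hj : 1 ≤ j) {v : List ℕ}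
    (h : ε (List.replicate j a) v) (hv : v ≠ List.replicate j a) :
    δ (List.replicate j a) (lpow (1 + r) (List.replicate j a)) := by
  have h4 := c.mod.four_le
  have hr : ∀ d, 1 ≤ d → θ (List.replicate (j + d * r) a) (lpow (1 + r) (List.replicate j a)) := by
    intro d hd
    have h1 : r ≤ d * r := Nat.le_mul_of_pos_left _ hd
    have h2 : r ≤ r * j := Nat.le_mul_of_pos_right _ hj
    have h3 : lpow (1 + r) (List.replicate j a) = List.replicate ((1 + r) * j) a := by
      rw [List.eq_replicate_iff]
      refine ⟨by simp [length_lpow], fun b hb => ?_⟩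
      have := List.count_pos_iff.2 hb
      rw [count_lpow] at this
      exact List.eq_of_mem_replicate (List.count_pos_iff.1 (Nat.pos_of_mul_pos_left this))
    rw [h3]
    refine c.mod.replicate_congr (by omega) (by rw [add_mul]; omega) ?_ a
    rw [add_mul, one_mul, mul_comm d]
    simp [Nat.ModEq]
  obtain ⟨d, hd, hβ⟩ := c.invβ.exists_replicate_mul_add hj h.1 hv r
  obtain ⟨s, t, rfl, hst, hs⟩ := relSup_exit h.2 (· = List.replicate j a) rfl hv
  rcases hs with hs | hs
  · obtain ⟨e, he, hθ⟩ := c.mod.inv.exists_replicate_mul_add hj hs hst r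
    exact relSup_left (c.mod.inv.trans hθ (hr e he))
  · obtain ⟨e, he, hγ⟩ := c.invγ.exists_replicate_mul_add hj hs hst r
    have h1 := c.invβ.replicate_period hβ le_rfl e
    have h2 := c.invγ.replicate_period hγ le_rfl d
    rw [← mul_assoc] at h1
    rw [← mul_assoc, mul_comm d e] at h2
    exact c.invδ.trans (relSup_right ⟨h1, h2⟩) (relSup_left (hr (e * d) (Nat.mul_pos he hd)))

theorem nodup_rel_lpow (c : ModularTriple θ β γ r) {u v : List ℕ} (h : ε u v) (hu : u.Nodup)
    (hv : ¬ u.Perm v) : δ u (lpow (1 + r) u) := by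
  have h1r := c.mod.one_le
  obtain ⟨s, t, hus, hut, hst⟩ := relSup_exit h.2 (u.Perm ·) (List.Perm.refl u) hv
  rcases hst with hst | hst
  · obtain ⟨w, hw, hs, hwn, hc⟩ := c.mod.inv.exists_nonlinear hu
      (c.mod.inv.trans (c.mod.perm hus) hst) hut h1r
    exact relSup_left (c.mod.nodup_rel_lpow c.mod.inv id hu hw hs hwn hc)
  · obtain ⟨w', hw', hs', hwn', hc'⟩ := c.invβ.exists_nonlinear hu h.1 hv h1r
    have hβ := c.mod.nodup_rel_lpow c.invβ c.le hu hw' hs' hwn' hc'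
    obtain ⟨w, hw, hs, hwn, hc⟩ := c.invγ.exists_nonlinear (hus.nodup_iff.1 hu) hst
      (fun hp => hut (hus.trans hp)) h1r
    have hmem : ∀ a, a ∈ u ↔ a ∈ w := fun a => hus.mem_iff.trans (hs a)
    have hcu : ∀ a ∈ u, ∃ q, w.count a = 1 + r * q := fun a ha => hc a (hus.mem_iff.1 ha)
    have h2 := c.invβ.subst (fun a => a :: List.replicate (w.count a - 1) a) (by simp) hβ
    have hcount : ∀ (l : List ℕ) (a : ℕ), a ∈ u →
        (l.flatMap fun a => a :: List.replicate (w.count a - 1) a).count a =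
          w.count a * l.count a := by
      intro l a ha
      obtain ⟨q, hq⟩ := hcu a ha
      refine count_flatMap_of_mem_iff (by simp; omega) fun i _ hi => ?_
      simp [List.mem_replicate, Ne.symm hi]
    have hnot : ∀ (l : List ℕ) (a : ℕ), a ∉ l →
        (l.flatMap fun a => a :: List.replicate (w.count a - 1) a).count a = 0 := by
      intro l a ha
      refine List.count_eq_zero_of_not_mem fun hcon => ?_
      obtain ⟨i, hi, hai⟩ := List.mem_flatMap.1 hcon
      rcases List.mem_cons.1 hai with rfl | hai
      · exact ha hi
      · exact ha (List.eq_of_mem_replicate hai ▸ hi)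
    have hpw : (u.flatMap fun a => a :: List.replicate (w.count a - 1) a).Perm w := by
      refine List.perm_iff_count.2 fun a => ?_
      by_cases ha : a ∈ u
      · rw [hcount u a ha, List.count_eq_one_of_mem hu ha, mul_one]
      · rw [hnot u a ha, List.count_eq_zero_of_not_mem fun hcon => ha ((hmem a).2 hcon)]
    have hlp : ∀ a, a ∈ lpow (1 + r) u ↔ a ∈ u := by
      intro a
      rw [← List.count_pos_iff, count_lpow, ← List.count_pos_iff (l := u)]
      exact ⟨fun h => Nat.pos_of_mul_pos_left h, fun h => by positivity⟩
    obtain ⟨x, hx⟩ := exists_two_le_count hwn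
    have hxu : x ∈ u := (hmem x).2 (List.count_pos_iff.1 (by omega))
    have h4 := c.mod.four_le
    have h3 : θ ((lpow (1 + r) u).flatMap fun a => a :: List.replicate (w.count a - 1) a)
        (lpow (1 + r) u) := by
      have hge : ∀ a ∈ u, 1 + r ≤ w.count a * (1 + r) := by
        intro a ha
        obtain ⟨q, hq⟩ := hcu a ha
        exact Nat.le_mul_of_pos_left _ (by omega)
      refine c.mod.count_congr_of_four_le (x := x) ?_ ?_ fun a => ?_
      · rw [hcount _ x hxu, count_lpow, List.count_eq_one_of_mem hu hxu, mul_one]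
        have := hge x hxu; omega
      · rw [count_lpow, List.count_eq_one_of_mem hu hxu]; omega
      · by_cases ha : a ∈ u
        · obtain ⟨q, hq⟩ := hcu a ha
          have := hge a ha
          rw [hcount _ a ha, count_lpow, List.count_eq_one_of_mem hu ha, mul_one]
          refine Or.inr ⟨by omega, by omega, ?_⟩
          rw [hq, show (1 + r * q) * (1 + r) = 1 + r + r * (q * (1 + r)) by ring]
          simp [Nat.ModEq]
        · rw [hnot _ a fun hcon => ha ((hlp a).1 hcon),
            List.count_eq_zero_of_not_mem fun hcon => ha ((hlp a).1 hcon)]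
          exact Or.inl rfl
    have h5 : β s w := by
      refine c.invβ.trans (c.le (c.mod.perm hus.symm)) (c.invβ.trans hβ ?_)
      exact c.invβ.trans (c.invβ.symm (c.le h3))
        (c.invβ.trans (c.invβ.symm h2) (c.le (c.mod.perm hpw)))
    exact c.mod.nodup_rel_lpow c.invδ relSup_left hu
      (c.invδ.trans (c.permδ hus) (relSup_right ⟨h5, hw⟩)) hmem hwn hcu

end

end ModularTriple

theorem exists_perm_cons_cons {l : List ℕ} {a : ℕ} (h : 2 ≤ l.count a) :
    ∃ C, l.Perm (a :: a :: C) := by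
  have h1 : a ∈ l := List.count_pos_iff.1 (by omega)
  have h2 : a ∈ l.erase a := List.count_pos_iff.1 (by rw [List.count_erase_self]; omega)
  exact ⟨(l.erase a).erase a,
    (List.perm_cons_erase h1).trans ((List.perm_cons_erase h2).cons a)⟩

theorem not_nodup_of_two_lt_length {a b : ℕ} {w : List ℕ} (hab : a ≠ b)
    (h : SameLetters [a, b] w) (hw : 2 < w.length) : ¬ w.Nodup := fun hd => by
  have := (perm_of_nodup_of_sameLetters (by simpa using hab) hd h).length_eq
  simp at this; omega

theorem sameLetters_lpow {k : ℕ} (hk : 1 ≤ k) (u : List ℕ) : SameLetters u (lpow k u) := by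
  intro x
  rw [← List.count_pos_iff, ← List.count_pos_iff, count_lpow]
  exact ⟨fun h => Nat.mul_pos hk h, fun h => Nat.pos_of_mul_pos_left h⟩

namespace FullyInvariant

variable {R : List ℕ → List ℕ → Prop}

theorem sq_mul_comm (hR : FullyInvariant R) (h : R [0, 0, 1] [0, 1, 1]) {X Y : List ℕ}
    (hX : X ≠ []) (hY : Y ≠ []) : R (X ++ X ++ Y) (X ++ Y ++ Y) := by
  simpa using hR.subst (fun i => if i = 0 then X else Y) (by intro i; split <;> simpa) h

/-- The consequence `x²yz = x³yz` of `x²y = xy²` and commutativity. -/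
theorem sq_mul_mul_absorb (hR : FullyInvariant R) (hperm : ∀ {a b : List ℕ}, a.Perm b → R a b)
    (h : R [0, 0, 1] [0, 1, 1]) (x y z : ℕ) : R [x, x, y, z] [x, x, x, y, z] := by
  have h1 : R [x, x, y, z] [x, y, z, y, z] := by
    simpa using hR.sq_mul_comm h (X := [x]) (Y := [y, z]) (by simp) (by simp)
  have h2 : R [x, x, z] [x, z, z] := by
    simpa using hR.sq_mul_comm h (X := [x]) (Y := [z]) (by simp) (by simp)
  have h3 : R [x, x, y] [x, y, y] := by
    simpa using hR.sq_mul_comm h (X := [x]) (Y := [y]) (by simp) (by simp)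
  have h4 : R [x, y, z, y, z] [x, x, y, y, z] := by
    refine hR.of_perm_append hperm [y, y] (hR.symm h2) ?_ ?_ <;>
    · refine List.perm_iff_count.2 fun b => ?_
      simp only [List.count_append, List.count_cons, List.count_nil]
      omega
  have h5 : R [x, x, y, y, z] [x, x, x, y, z] := by
    refine hR.of_perm_append hperm [x, z] (hR.symm h3) ?_ ?_ <;>
    · refine List.perm_iff_count.2 fun b => ?_
      simp only [List.count_append, List.count_cons, List.count_nil]
      omega
  exact hR.trans h1 (hR.trans h4 h5)

theorem append_singleton_of_sq_mul_comm (hR : FullyInvariant R)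
    (hperm : ∀ {a b : List ℕ}, a.Perm b → R a b) (h : R [0, 0, 1] [0, 1, 1]) {l : List ℕ}
    (hl : ¬ l.Nodup) (h4 : 4 ≤ l.length) {a : ℕ} (ha : a ∈ l) : R l (l ++ [a]) := by
  obtain ⟨x, hx⟩ := exists_two_le_count hl
  obtain ⟨C, hC⟩ := exists_perm_cons_cons hx
  have hlen := hC.length_eq
  simp only [List.length_cons] at hlen
  have key : ∃ y z D, R l ([a, a, y, z] ++ D) := by
    by_cases hax : a = x
    · subst hax
      obtain ⟨y, z, D, rfl⟩ : ∃ y z D, C = y :: z :: D := by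
        rcases C with _ | ⟨y, _ | ⟨z, D⟩⟩
        · simp at hlen; omega
        · simp at hlen; omega
        · exact ⟨y, z, D, rfl⟩
      exact ⟨y, z, D, hperm hC⟩
    · have haC : a ∈ C := by simpa [hax] using hC.mem_iff.1 ha
      have hC' := List.perm_cons_erase haC
      have hlen' := hC'.length_eq
      obtain ⟨z, D, hD⟩ : ∃ z D, C.erase a = z :: D := by
        rcases hE : C.erase a with _ | ⟨z, D⟩
        · rw [hE] at hlen'; simp at hlen'; omega
        · exact ⟨z, D, rfl⟩
      rw [hD] at hC'
      have h1 : R [x, x, a] [x, a, a] := by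
        simpa using hR.sq_mul_comm h (X := [x]) (Y := [a]) (by simp) (by simp)
      refine ⟨x, z, D, hR.of_perm_append hperm ([z] ++ D) h1
        (hC.trans ((hC'.cons x).cons x)) ?_⟩
      refine List.perm_iff_count.2 fun b => ?_
      simp only [List.count_append, List.count_cons, List.count_nil]
      omega
  obtain ⟨y, z, D, hk⟩ := key
  have h2 : R ([a, a, y, z] ++ D) ([a, a, y, z] ++ D ++ [a]) := by
    refine hR.of_perm_append hperm D (hR.sq_mul_mul_absorb hperm h a y z) (List.Perm.refl _) ?_
    refine List.perm_iff_count.2 fun b => ?_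
    simp only [List.count_append, List.count_cons, List.count_nil]
    omega
  exact hR.trans hk (hR.trans h2 (hR.append (hR.symm hk) (hR.refl _)))

theorem of_sameLetters (hR : FullyInvariant R)
    (hperm : ∀ {a b : List ℕ}, a.Perm b → R a b) (h : R [0, 0, 1] [0, 1, 1]) {l l' : List ℕ}
    (hl : ¬ l.Nodup) (hl' : ¬ l'.Nodup) (h4 : 4 ≤ l.length) (h4' : 4 ≤ l'.length)
    (hs : SameLetters l l') : R l l' := by
  refine hR.of_count_modEq hperm le_rfl fun a => ?_
  by_cases ha : a ∈ l
  · exact Or.inr ⟨hR.append_singleton_of_sq_mul_comm hperm h hl h4 ha,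
      hR.append_singleton_of_sq_mul_comm hperm h hl' h4' ((hs a).1 ha), Nat.modEq_one⟩
  · rw [List.count_eq_zero_of_not_mem ha,
      List.count_eq_zero_of_not_mem fun hc => ha ((hs a).2 hc)]
    exact Or.inl rfl

theorem modPeriod_of_sq_mul_comm (hR : FullyInvariant R)
    (hperm : ∀ {a b : List ℕ}, a.Perm b → R a b) (h : R [0, 0, 1] [0, 1, 1]) : ModPeriod R 4 where
  inv := hR
  perm := hperm
  four_le := le_rfl
  count_congr hl hl' h4 h4' hc := hR.of_sameLetters hperm h hl hl' h4 h4' fun a => by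
    rw [← List.count_pos_iff, ← List.count_pos_iff]
    rcases hc a with h | h
    · rw [h]
    · omega

/-- A word outside the class of words of length `3` in exactly two letters can be replaced by
a long word in these letters. -/
theorem exists_long (hR : FullyInvariant R) {a b : ℕ} (hab : a ≠ b) {s t : List ℕ}
    (hs : s.length = 3) (hsl : SameLetters [a, b] s) (h : R s t)
    (ht : ¬ (t.length = 3 ∧ SameLetters [a, b] t)) :
    ∃ w, SameLetters [a, b] w ∧ 4 ≤ w.length ∧ R s w := by
  by_cases hout : ∃ c ∈ t, c ∉ [a, b]
  · obtain ⟨c, hct, hc⟩ := hout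
    have h1 := hR.subst (fun i => if i ∈ [a, b] then [i] else [a, b, a, b])
      (by intro i; split <;> simp) h
    rw [flatMap_eq_self fun i hi => if_pos ((hsl i).2 hi)] at h1
    have h2 := infix_flatMap_of_mem (σ := fun i => if i ∈ [a, b] then [i] else [a, b, a, b]) hct
    rw [if_neg hc] at h2
    refine ⟨_, fun x => ⟨fun hx => h2.subset ?_, fun hx => ?_⟩, h2.length_le, h1⟩
    · simp at hx ⊢; tauto
    · obtain ⟨i, -, hi⟩ := List.mem_flatMap.1 hx
      split_ifs at hi with hi'
      · rw [List.mem_singleton] at hi; rwa [hi]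
      · simp at hi ⊢; tauto
  push Not at hout
  by_cases hmiss : ∃ y ∈ [a, b], y ∉ t
  · obtain ⟨y, hy, hyt⟩ := hmiss
    have h1 := hR.subst (fun i => if i = y then [y, y] else [i]) (by intro i; split <;> simp) h
    rw [flatMap_eq_self (l := t) fun i hi => if_neg (ne_of_mem_of_not_mem hi hyt)] at h1
    refine ⟨_, fun x => ?_, ?_, hR.trans h (hR.symm h1)⟩
    · rw [hsl x, List.mem_flatMap]
      constructor
      · intro hx
        refine ⟨x, hx, ?_⟩
        split_ifs with hxy <;> simp [hxy]
      · rintro ⟨i, hi, hxi⟩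
        split_ifs at hxi with hiy
        · simp at hxi; rwa [hxi, ← hiy]
        · simp at hxi; rwa [hxi]
    · obtain ⟨A, B, rfl⟩ := List.append_of_mem ((hsl y).1 hy)
      have hA := length_le_length_flatMap (σ := fun i => if i = y then [y, y] else [i])
        (by intro i; split <;> simp) A
      have hB := length_le_length_flatMap (σ := fun i => if i = y then [y, y] else [i])
        (by intro i; split <;> simp) B
      simp only [List.flatMap_append, List.flatMap_cons, List.length_append, List.length_cons,
        if_true, List.length_nil] at hs ⊢
      omega
  push Not at hmiss
  have htl : SameLetters [a, b] t := fun x => ⟨hmiss x, hout x⟩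
  by_cases h4 : 4 ≤ t.length
  · exact ⟨t, htl, h4, h⟩
  · have hsub : [a, b].Subperm t := List.subperm_of_subset (by simpa using hab) hmiss
    have h2 := hsub.length_le
    have h3 : t.length ≠ 3 := fun hc => ht ⟨hc, htl⟩
    simp only [List.length_cons, List.length_nil] at h2
    have hp := hsub.perm_of_length_le (by simp; omega)
    have hd : t.Nodup := hp.nodup_iff.1 (by simpa using hab)
    obtain ⟨w, hw, hsw, hwn, hc⟩ := hR.exists_nonlinear hd (hR.symm h)
      (fun hc => by have := hc.length_eq; omega) (r := 4) (by omega)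
    refine ⟨w, sameLetters_fullyInvariant.trans htl hsw, ?_, hR.trans h hw⟩
    obtain ⟨x, hx⟩ := exists_two_le_count hwn
    obtain ⟨q, hq⟩ := hc x ((hsw x).2 (List.count_pos_iff.1 (by omega)))
    have := List.count_le_length (a := x) (l := w)
    omega

end FullyInvariant

namespace ModularTriple

variable {θ β γ : List ℕ → List ℕ → Prop}

theorem rel_lpow_of_sq_mul_comm (c : ModularTriple θ β γ 4) (h : θ [0, 0, 1] [0, 1, 1])
    {u v : List ℕ} (hu : u ≠ []) (huv : relInf β (relSup θ γ) u v) (hn : ¬ θ u v) :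
    relSup θ (relInf β γ) u (lpow (1 + 4) u) := by
  have hv : v ≠ u := fun hc => hn (hc ▸ c.mod.inv.refl _)
  by_cases hd : u.Nodup
  · exact c.nodup_rel_lpow huv hd fun hp => hn (c.mod.perm hp)
  have hsl := sameLetters_lpow (k := 1 + 4) (by omega) u
  by_cases h4 : 4 ≤ u.length
  · refine relSup_left (c.mod.inv.of_sameLetters c.mod.perm h hd ?_ h4 ?_ hsl)
    · obtain ⟨x, hx⟩ := exists_two_le_count hd
      exact not_nodup_of_two_le_count (a := x) (by rw [count_lpow]; omega)
    · rw [length_lpow]; omega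
  obtain ⟨a, ha⟩ := exists_two_le_count hd
  obtain ⟨C, hC⟩ := exists_perm_cons_cons ha
  have hlen := hC.length_eq
  rcases C with _ | ⟨b, _ | ⟨_, _⟩⟩
  · obtain rfl : u = List.replicate 2 a := List.perm_replicate.1 hC
    exact c.replicate_rel_lpow (by omega) huv hv
  swap
  · simp at hlen; omega
  by_cases hab : a = b
  · subst hab
    obtain rfl : u = List.replicate 3 a := List.perm_replicate.1 hC
    exact c.replicate_rel_lpow (by omega) huv hv
  have hu3 : u.length = 3 := by simpa using hlen
  have hul : SameLetters [a, b] u := fun x => by simp [hC.mem_iff]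
  have hclass : ∀ s : List ℕ, s.length = 3 ∧ SameLetters [a, b] s → θ u s := by
    rintro s ⟨hs3, hs⟩
    have hsub : [a, b].Subperm s :=
      List.subperm_of_subset (by simpa using hab) fun x hx => (hs x).1 hx
    have hps : s.Perm ([a, b] ++ s.diff [a, b]) := (List.subperm_append_diff_self_of_count_le
      fun x _ => List.Subperm.count_le hsub x).symm
    have hl := hps.length_eq
    obtain ⟨d, hd⟩ : ∃ d, s.diff [a, b] = [d] := by
      rw [← List.length_eq_one_iff]
      rw [List.length_append] at hl
      simp only [List.length_cons, List.length_nil] at hl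
      omega
    rw [hd] at hps
    have hds : d ∈ [a, b] := (hs d).2 (hps.mem_iff.2 (by simp))
    have hba : θ [a, a, b] [a, b, b] := by
      simpa using c.mod.inv.sq_mul_comm h (X := [a]) (Y := [b]) (by simp) (by simp)
    simp only [List.mem_cons, List.not_mem_nil, or_false] at hds
    refine c.mod.inv.trans (c.mod.perm hC) ?_
    rcases hds with rfl | rfl
    · refine c.mod.perm (List.Perm.trans ?_ hps.symm)
      exact (List.Perm.swap _ _ []).cons _
    · exact c.mod.inv.trans hba (c.mod.perm hps.symm)
  have hvc : ¬ (v.length = 3 ∧ SameLetters [a, b] v) := fun hc => hn (hclass v hc)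
  have hlong : ∀ {w w' : List ℕ}, SameLetters [a, b] w → 4 ≤ w.length → SameLetters [a, b] w' →
      4 ≤ w'.length → θ w w' := fun hw h4 hw' h4' =>
    c.mod.inv.of_sameLetters c.mod.perm h (not_nodup_of_two_lt_length hab hw (by omega))
      (not_nodup_of_two_lt_length hab hw' (by omega)) h4 h4'
      (sameLetters_fullyInvariant.trans (sameLetters_fullyInvariant.symm hw) hw')
  have hup := sameLetters_fullyInvariant.trans hul hsl
  have hup4 : 4 ≤ (lpow (1 + 4) u).length := by rw [length_lpow]; omega
  obtain ⟨s, t, hs, ht, hst⟩ := relSup_exit huv.2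
    (fun s => s.length = 3 ∧ SameLetters [a, b] s) ⟨hu3, hul⟩ hvc
  rcases hst with hst | hst
  · obtain ⟨w, hw, hw4, hsw⟩ := c.mod.inv.exists_long hab hs.1 hs.2 hst ht
    exact relSup_left (c.mod.inv.trans (hclass s hs)
      (c.mod.inv.trans hsw (hlong hw hw4 hup hup4)))
  · obtain ⟨w, hw, hw4, hsw⟩ := c.invγ.exists_long hab hs.1 hs.2 hst ht
    obtain ⟨w', hw', hw4', huw'⟩ := c.invβ.exists_long hab hu3 hul huv.1 hvc
    have hβ : β s w := c.invβ.trans (c.invβ.symm (c.le (hclass s hs)))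
      (c.invβ.trans huw' (c.le (hlong hw' hw4' hw hw4)))
    exact c.invδ.trans (relSup_left (hclass s hs)) (c.invδ.trans (relSup_right ⟨hβ, hsw⟩)
      (relSup_left (hlong hw hw4 hup hup4)))

theorem modular_of_sq_mul_comm (c : ModularTriple θ β γ 4) (h : θ [0, 0, 1] [0, 1, 1])
    {u v : List ℕ} (hu : u ≠ []) (huv : relInf β (relSup θ γ) u v) :
    relSup θ (relInf β γ) u v := by
  by_cases hn : θ u v
  · exact relSup_left hn
  have h1 := c.rel_lpow_of_sq_mul_comm h hu huv hn
  have h2 := c.rel_lpow_of_sq_mul_comm h (c.ne_nil huv hu) (c.invε.symm huv)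
    fun hc => hn (c.mod.inv.symm hc)
  exact c.invδ.trans h1 (c.invδ.trans (c.lpow_rel_lpow huv hu) (c.invδ.symm h2))

end ModularTriple

/-- Commutative relations under which exponents `≥ 2` in words of length `≥ 3` only matter
modulo `r`. -/
structure StrongModPeriod (θ : List ℕ → List ℕ → Prop) (r : ℕ) : Prop extends ModPeriod θ r where
  count_congr_of_three_le : ∀ {l l' : List ℕ}, 3 ≤ l.length → 3 ≤ l'.length →
    (∀ a, l.count a = l'.count a ∨
      2 ≤ l.count a ∧ 2 ≤ l'.count a ∧ l.count a ≡ l'.count a [MOD r]) → θ l l'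

namespace FullyInvariant

variable {R : List ℕ → List ℕ → Prop}

theorem sq_mul_period (hR : FullyInvariant R) {r : ℕ}
    (h : R [0, 0, 1] (List.replicate (2 + r) 0 ++ [1])) (k a b : ℕ) :
    R [a, a, b] (List.replicate (2 + k * r) a ++ [b]) := by
  have h1 : ∀ k, R [0, 0, 1] (List.replicate (2 + k * r) 0 ++ [1]) := by
    intro k
    induction k with
    | zero => simpa using hR.refl _
    | succ k ih =>
      have h2 := hR.append (hR.refl (List.replicate (k * r) 0)) h
      rw [← List.append_assoc, ← List.replicate_add,
        show k * r + (2 + r) = 2 + (k + 1) * r by ring] at h2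
      refine hR.trans ih ?_
      convert h2 using 1
      rw [Nat.add_comm, List.replicate_add, List.append_assoc]; rfl
  have h2 := hR.subst (fun i => if i = 0 then [a] else [b]) (by intro i; split <;> simp) (h1 k)
  rw [List.flatMap_append, flatMap_replicate, if_pos rfl, lpow_singleton] at h2
  simpa using h2

theorem strongModPeriod (hR : FullyInvariant R) (hperm : ∀ {a b : List ℕ}, a.Perm b → R a b)
    {r : ℕ} (hr : 1 ≤ r) (h : R [0, 0, 1] (List.replicate (2 + r) 0 ++ [1])) :
    StrongModPeriod R (4 * r) := by
  have hpad : ∀ {l : List ℕ} {a : ℕ}, 3 ≤ l.length → 2 ≤ l.count a →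
      R l (l ++ List.replicate (4 * r) a) := by
    intro l a hl ha
    obtain ⟨C, hC⟩ := exists_perm_cons_cons ha
    obtain ⟨b, D, rfl⟩ : ∃ b D, C = b :: D := by
      rcases C with _ | ⟨b, D⟩
      · have := hC.length_eq; simp at this; omega
      · exact ⟨b, D, rfl⟩
    refine hR.of_perm_append hperm D (hR.sq_mul_period h 4 a b) hC ?_
    refine List.perm_iff_count.2 fun x => ?_
    simp only [List.replicate_add, List.count_append, hC.count_eq, List.count_cons,
      List.count_nil, List.replicate_succ, List.replicate_zero]
    omega
  have hcc : ∀ {l l' : List ℕ}, 3 ≤ l.length → 3 ≤ l'.length → (∀ a, l.count a = l'.count a ∨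
      2 ≤ l.count a ∧ 2 ≤ l'.count a ∧ l.count a ≡ l'.count a [MOD 4 * r]) → R l l' :=
    fun hl hl' hc => hR.of_count_modEq hperm (r := 4 * r) (by omega) fun a =>
      (hc a).imp_right fun ha => ⟨hpad hl ha.1, hpad hl' ha.2.1, ha.2.2⟩
  exact ⟨⟨hR, hperm, by omega, fun _ _ h4 h4' hc => hcc (by omega) (by omega) hc⟩, hcc⟩

/-- From an identity changing the exponent `1` of a letter, an identity of the form
`0ⁱ1 = 0ʲ1ᵏ` up to commutativity, with exponents controlled modulo `r`. -/
theorem exists_linear_letter (hR : FullyInvariant R) {r : ℕ} (hr : 1 ≤ r) {s t : List ℕ}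
    (h : R s t) {y : ℕ} (hs : s.count y = 1) (ht : t.count y ≠ 1) :
    ∃ z z', R z z' ∧ 2 ≤ z.count 0 ∧ 2 ≤ z'.count 0 ∧ r ∣ z.count 0 ∧ r ∣ z'.count 0 ∧
      z.count 1 = 1 ∧ 2 ≤ z'.count 1 ∧ z'.count 1 ≡ 1 [MOD r] ∧
      ∀ x ∈ z ++ z', x = 0 ∨ x = 1 := by
  obtain ⟨s, t, h, hs, ht, hsl, htl⟩ : ∃ s t, R s t ∧ s.count 1 = 1 ∧ t.count 1 ≠ 1 ∧
      (∀ x ∈ s, x = 0 ∨ x = 1) ∧ ∀ x ∈ t, x = 0 ∨ x = 1 := by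
    have hc : ∀ l : List ℕ, (l.flatMap fun i => if i = y then [1] else [0]).count 1 = l.count y := by
      intro l
      rw [count_flatMap_of_mem_iff (b := y) (k := 1) (by simp), one_mul]
      intro i _ hi
      simp [hi]
    have hm : ∀ l : List ℕ, ∀ x ∈ l.flatMap fun i => if i = y then [1] else [0],
        x = 0 ∨ x = 1 := by
      intro l x hx
      obtain ⟨i, -, hi⟩ := List.mem_flatMap.1 hx
      split_ifs at hi <;> simp at hi <;> omega
    exact ⟨_, _, hR.subst (fun i => if i = y then [1] else [0]) (by intro i; split <;> simp) h,
      by rwa [hc], by rwa [hc], hm s, hm t⟩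
  by_cases ht0 : t.count 1 = 0
  · have h1 := hR.subst (fun i => if i = 1 then List.replicate (1 + r) 1 else [i])
      (by intro i; split <;> simp) h
    rw [flatMap_eq_self (l := t) fun i hi => if_neg
      (ne_of_mem_of_not_mem hi (List.count_eq_zero.1 ht0))] at h1
    have h2 := hR.append (hR.refl (List.replicate ((r - 1) * s.count 0 + 2 * r) 0))
      (hR.trans h (hR.symm h1))
    have hc1 : (s.flatMap fun i => if i = 1 then List.replicate (1 + r) 1 else [i]).count 1 =
        1 + r := by
      rw [count_flatMap_of_mem_iff (b := 1) (k := 1 + r) (by simp), hs, mul_one]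
      intro i _ hi
      simp [hi, Ne.symm hi]
    have hc0 : (s.flatMap fun i => if i = 1 then List.replicate (1 + r) 1 else [i]).count 0 =
        s.count 0 := by
      rw [count_flatMap_of_mem_iff (b := 0) (k := 1) (by simp), one_mul]
      intro i _ hi
      by_cases h1 : i = 1
      · simp [h1]
      · simp [h1, Ne.symm hi]
    have he : (r - 1) * s.count 0 + 2 * r + s.count 0 = r * (s.count 0 + 2) := by
      obtain ⟨m, rfl⟩ := Nat.exists_eq_add_of_le' hr
      rw [Nat.add_sub_cancel]; ring
    have he2 : 2 ≤ r * (s.count 0 + 2) := by nlinarith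
    refine ⟨_, _, h2, ?_⟩
    simp only [List.count_append, count_replicate_ite, if_true, one_ne_zero, if_false, hc1, hc0,
      he, hs, zero_add]
    refine ⟨he2, he2, dvd_mul_right _ _, dvd_mul_right _ _, trivial, by omega,
      by simp [Nat.ModEq], fun x hx => ?_⟩
    simp only [List.mem_append, List.mem_flatMap, List.mem_replicate] at hx
    rcases hx with (hx | hx) | (hx | ⟨i, hi, hx⟩)
    · exact Or.inl hx.2
    · exact hsl x hx
    · exact Or.inl hx.2
    · split_ifs at hx
      · exact Or.inr (List.eq_of_mem_replicate hx)
      · rw [List.mem_singleton] at hx; exact hsl x (hx ▸ hi)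
  obtain ⟨k, hk⟩ : ∃ k, t.count 1 = k + 2 := ⟨t.count 1 - 2, by omega⟩
  obtain ⟨i, e, he, hie⟩ : ∃ i e, 1 ≤ e ∧ R (List.replicate i 0) (List.replicate (i + e) 0) := by
    have key : ∀ i j, i ≠ j → R (List.replicate i 0) (List.replicate j 0) →
        ∃ i e, 1 ≤ e ∧ R (List.replicate i 0) (List.replicate (i + e) 0) := by
      intro i j hij h
      rcases Nat.lt_or_gt_of_ne hij with hlt | hlt
      · exact ⟨i, j - i, by omega, by rwa [Nat.add_sub_cancel' hlt.le]⟩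
      · exact ⟨j, i - j, by omega, by rw [Nat.add_sub_cancel' hlt.le]; exact hR.symm h⟩
    by_cases hl : s.length = t.length
    · exact key _ _ (by omega) (hR.replicate_length_add_count h 1 0)
    · exact key _ _ hl (hR.replicate_length h 0)
  set ω := r * (i + 2) * e with hω
  set f := List.replicate ω 0 with hf
  have hωi : i + 2 ≤ ω := by
    calc i + 2 ≤ r * (i + 2) := Nat.le_mul_of_pos_left _ hr
      _ ≤ ω := Nat.le_mul_of_pos_right _ he
  have hff : R f (f ++ f) := by
    have := hR.replicate_period hie (M := ω) (by omega) (r * (i + 2))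
    rwa [← hω, List.replicate_add] at this
  set Z := f ++ [1] ++ f with hZ
  have hfZ : R (f ++ Z) Z := by
    have := hR.append (hR.symm hff) (hR.refl ([1] ++ f))
    simpa [hZ] using this
  have hZf : R (Z ++ f) Z := by
    have := hR.append (hR.refl (f ++ [1])) (hR.symm hff)
    simpa [hZ] using this
  have hred : ∀ l : List ℕ, (∀ x ∈ l, x = 0 ∨ x = 1) →
      R (f ++ (l.flatMap fun i => if i = 0 then f else Z) ++ f) (f ++ lpow (l.count 1) Z ++ f) := by
    intro l hl
    induction l with
    | nil => exact hR.refl _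
    | cons a l ih =>
      have ih := ih fun x hx => hl x (List.mem_cons_of_mem _ hx)
      rcases hl a (by simp) with rfl | rfl
      · have h1 := hR.append (hR.symm hff)
          (hR.refl ((l.flatMap fun i => if i = 0 then f else Z) ++ f))
        rw [List.count_cons_of_ne (by simp)]
        refine hR.trans ?_ ih
        simpa using h1
      · have h1 := hR.append (hR.refl (f ++ f ++ [1])) ih
        rw [List.count_cons_self, lpow_succ]
        simpa [hZ] using h1
  have hZk : R Z (lpow (k + 2) Z) := by
    have h1 := hR.subst (fun i => if i = 0 then f else Z)
      (by intro i; split <;> simp [hf, hZ]; omega) h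
    have h2 := hR.trans (hR.symm (hred s hsl)) (hR.trans (hR.ctx f f h1) (hred t htl))
    rw [hs, hk, lpow_one] at h2
    have h3 : R Z (f ++ Z ++ f) := hR.symm (hR.trans (hR.append hfZ (hR.refl f)) hZf)
    have h4 : R (f ++ lpow (k + 2) Z ++ f) (lpow (k + 2) Z) := by
      rw [show k + 2 = (k + 1) + 1 from rfl, lpow_add, lpow_succ k, lpow_one]
      have h5 := hR.append (hR.append hfZ (hR.refl (lpow k Z))) hZf
      simpa only [List.append_assoc] using h5
    exact hR.trans h3 (hR.trans h2 h4)
  have hZt : ∀ n, R Z (lpow (1 + n * (k + 1)) Z) := by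
    intro n
    induction n with
    | zero => simpa [lpow_one] using hR.refl Z
    | succ n ih =>
      rw [show 1 + (n + 1) * (k + 1) = (k + 2) + n * (k + 1) by ring, lpow_add]
      rw [lpow_add, lpow_one] at ih
      exact hR.trans ih (hR.append hZk (hR.refl _))
  have hd : r ∣ ω := ⟨(i + 2) * e, by rw [hω, mul_assoc]⟩
  have hZ0 : Z.count 0 = 2 * ω := by
    simp [hZ, hf]; omega
  have hZ1 : Z.count 1 = 1 := by simp [hZ, hf, count_replicate_ite]
  have hZm : ∀ x ∈ Z, x = 0 ∨ x = 1 := by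
    intro x hx
    simp only [hZ, hf, List.mem_append, List.mem_replicate, List.mem_singleton] at hx
    omega
  refine ⟨Z, _, hZt r, ?_⟩
  simp only [count_lpow, hZ0, hZ1, mul_one]
  refine ⟨by omega, ?_, hd.mul_left 2, (hd.mul_left 2).mul_left _, trivial, ?_, ?_, ?_⟩
  · exact le_trans (by omega : 2 ≤ 2 * ω) (Nat.le_mul_of_pos_left _ (by omega))
  · have : 1 ≤ r * (k + 1) := Nat.mul_pos hr k.succ_pos
    omega
  · simp [Nat.ModEq]
  · intro x hx
    rcases List.mem_append.1 hx with hx | hx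
    · exact hZm x hx
    · exact hZm x ((sameLetters_lpow (by omega) Z x).2 hx)

end FullyInvariant

theorem three_le_length {z : List ℕ} (h0 : 2 ≤ z.count 0) (h1 : 1 ≤ z.count 1) :
    3 ≤ z.length := by
  obtain ⟨C, hC⟩ := exists_perm_cons_cons h0
  rw [hC.count_eq] at h1
  have h2 : 1 ∈ C := by simpa [List.count_cons] using h1
  rw [hC.length_eq, List.length_cons, List.length_cons]
  have := List.length_pos_of_mem h2
  omega

namespace ModularTriple

section

variable {θ β γ : List ℕ → List ℕ → Prop} {r : ℕ}

/-- The larger side `β ∧ (θ ∨ γ)` of the modular law. -/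
local notation "ε" => relInf β (relSup θ γ)

/-- The smaller side `θ ∨ (β ∧ γ)` of the modular law. -/
local notation "δ" => relSup θ (relInf β γ)

theorem linear_letter_rel (c : ModularTriple θ β γ r) (hθ : StrongModPeriod θ r) {u v : List ℕ}
    (h : ε u v) {y : ℕ} (hu : u.count y = 1) (hv : v.count y ≠ 1) :
    δ (List.replicate r 0 ++ [1]) (List.replicate r 0 ++ List.replicate (1 + r) 1) := by
  have h4 := c.mod.four_le
  have h1r := c.mod.one_le
  have hl : ∀ {z : List ℕ}, 2 ≤ z.count 0 → r ∣ z.count 0 → z.count 1 = 1 →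
      (∀ x ∈ z, x = 0 ∨ x = 1) → θ (List.replicate r 0 ++ [1]) z := by
    intro z h0 hd h1 hz
    have hlen := three_le_length h0 (by omega)
    refine hθ.count_congr_of_three_le (by simp; omega) hlen fun a => ?_
    rw [List.count_append, count_replicate_ite]
    by_cases ha0 : a = 0
    · subst ha0
      refine Or.inr ⟨by simp; omega, h0, ?_⟩
      simpa [Nat.ModEq] using (Nat.mod_eq_zero_of_dvd hd).symm
    · by_cases ha1 : a = 1
      · subst ha1; simp [h1]
      · rw [List.count_eq_zero_of_not_mem (l := z) fun hc => by rcases hz a hc with h | h <;> omega]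
        simp [ha0, Ne.symm ha1]
  have hr : ∀ {z : List ℕ}, 2 ≤ z.count 0 → r ∣ z.count 0 → 2 ≤ z.count 1 →
      z.count 1 ≡ 1 [MOD r] → (∀ x ∈ z, x = 0 ∨ x = 1) →
      θ z (List.replicate r 0 ++ List.replicate (1 + r) 1) := by
    intro z h0 hd h1 h1' hz
    have hlen := three_le_length h0 (by omega)
    refine hθ.count_congr_of_three_le hlen (by simp; omega) fun a => ?_
    rw [List.count_append, count_replicate_ite, count_replicate_ite]
    by_cases ha0 : a = 0
    · subst ha0
      refine Or.inr ⟨h0, by simp; omega, ?_⟩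
      simpa [Nat.ModEq] using (Nat.mod_eq_zero_of_dvd hd)
    · by_cases ha1 : a = 1
      · subst ha1
        refine Or.inr ⟨h1, by simp; omega, ?_⟩
        simpa [Nat.ModEq] using h1'
      · rw [List.count_eq_zero_of_not_mem (l := z) fun hc => by rcases hz a hc with h | h <;> omega]
        simp [ha0, ha1]
  obtain ⟨s, t, hs, ht, hst⟩ := relSup_exit h.2 (fun l => l.count y = 1) hu hv
  rcases hst with hst | hst
  · obtain ⟨z, z', hz, a1, a2, a3, a4, a5, a6, a7, a8⟩ :=
      c.mod.inv.exists_linear_letter h1r hst hs ht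
    exact relSup_left (c.mod.inv.trans
      (hl a1 a3 a5 fun x hx => a8 x (List.mem_append_left _ hx)) (c.mod.inv.trans hz
        (hr a2 a4 a6 a7 fun x hx => a8 x (List.mem_append_right _ hx))))
  · obtain ⟨z, z', hz, a1, a2, a3, a4, a5, a6, a7, a8⟩ :=
      c.invγ.exists_linear_letter h1r hst hs ht
    obtain ⟨y, y', hy, b1, b2, b3, b4, b5, b6, b7, b8⟩ :=
      c.invβ.exists_linear_letter h1r h.1 hu hv
    have hzl := hl a1 a3 a5 fun x hx => a8 x (List.mem_append_left _ hx)
    have hzr := hr a2 a4 a6 a7 fun x hx => a8 x (List.mem_append_right _ hx)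
    have hyl := hl b1 b3 b5 fun x hx => b8 x (List.mem_append_left _ hx)
    have hyr := hr b2 b4 b6 b7 fun x hx => b8 x (List.mem_append_right _ hx)
    have hβ : β z z' := c.invβ.trans
      (c.le (c.mod.inv.trans (c.mod.inv.symm hzl) hyl)) (c.invβ.trans hy
        (c.le (c.mod.inv.trans hyr (c.mod.inv.symm hzr))))
    exact c.invδ.trans (relSup_left hzl)
      (c.invδ.trans (relSup_right ⟨hβ, hz⟩) (relSup_left hzr))

/-- Letters that are linear on the left only can be given the exponent `1 + r`. -/
theorem exists_expand (c : ModularTriple θ β γ r) (hθ : StrongModPeriod θ r) {u v : List ℕ}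
    (h : ε u v) (hu : ¬ u.Nodup) (h3 : 3 ≤ u.length) :
    ∃ u', δ u u' ∧ ¬ u'.Nodup ∧ 3 ≤ u'.length ∧
      ∀ a, u'.count a = if u.count a = 1 ∧ v.count a ≠ 1 then 1 + r else u.count a := by
  let σ : ℕ → List ℕ := fun a =>
    if u.count a = 1 ∧ v.count a ≠ 1 then List.replicate (1 + r) a else [a]
  have hσ : ∀ i, σ i ≠ [] := by intro i; simp only [σ]; split <;> simp
  have hσm : ∀ i a, a ∈ σ i → a = i := by
    intro i a ha
    simp only [σ] at ha
    split_ifs at ha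
    · exact List.eq_of_mem_replicate ha
    · exact List.mem_singleton.1 ha
  have hcount : ∀ a, (u.flatMap σ).count a =
      if u.count a = 1 ∧ v.count a ≠ 1 then 1 + r else u.count a := by
    intro a
    rw [count_flatMap_of_mem_iff (b := a) rfl fun i _ hi ha => hi (hσm i a ha).symm]
    simp only [σ]
    split_ifs with ha
    · rw [List.count_replicate_self, ha.1, mul_one]
    · simp
  have hstep : ∀ x y, δ (List.replicate r x ++ [y]) (List.replicate r x ++ σ y) := by
    intro x y
    simp only [σ]
    split_ifs with hy
    · have h1 := c.invδ.subst (fun i => if i = 0 then [x] else [y])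
        (by intro i; split <;> simp) (c.linear_letter_rel hθ h hy.1 hy.2)
      simp only [List.flatMap_append, flatMap_replicate, if_true, lpow_singleton, one_ne_zero,
        if_false] at h1
      simpa using h1
    · exact c.invδ.refl _
  have hall : ∀ (x : ℕ) (l : List ℕ),
      δ (List.replicate r x ++ l) (List.replicate r x ++ l.flatMap σ) := by
    intro x l
    induction l with
    | nil => exact c.invδ.refl _
    | cons y l ih =>
      have h1 : δ (List.replicate r x ++ y :: l) (List.replicate r x ++ y :: l.flatMap σ) :=
        c.invδ.of_perm_append c.permδ [y] ih
          (by rw [List.append_assoc]; exact (List.perm_append_singleton y l).symm.append_left _)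
          (by rw [List.append_assoc]; exact (List.perm_append_singleton y _).symm.append_left _)
      refine c.invδ.trans h1 ?_
      have h2 := c.invδ.append (hstep x y) (c.invδ.refl (l.flatMap σ))
      simpa using h2
  obtain ⟨x, hx⟩ := exists_two_le_count hu
  have hpad : ∀ {l : List ℕ}, 3 ≤ l.length → 2 ≤ l.count x → θ l (List.replicate r x ++ l) := by
    intro l hl hlx
    refine hθ.count_congr_of_three_le hl (by simp; omega) fun a => ?_
    rw [List.count_append, count_replicate_ite]
    split_ifs with ha
    · subst ha
      exact Or.inr ⟨hlx, by omega, by simp [Nat.ModEq]⟩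
    · simp
  have hx' : (u.flatMap σ).count x = u.count x := by
    rw [hcount, if_neg (by omega)]
  have h3' : 3 ≤ (u.flatMap σ).length := h3.trans (length_le_length_flatMap hσ u)
  refine ⟨u.flatMap σ, ?_, not_nodup_of_two_le_count (a := x) (by omega), h3', hcount⟩
  exact c.invδ.trans (relSup_left (hpad h3 hx)) (c.invδ.trans (hall x u)
    (relSup_left (c.mod.inv.symm (hpad h3' (by omega)))))

theorem modular_of_count_eq_one_iff (c : ModularTriple θ β γ r) (hθ : StrongModPeriod θ r)
    {u v : List ℕ} (h : ε u v) (hu : ¬ u.Nodup) (hv : ¬ v.Nodup) (hu3 : 3 ≤ u.length)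
    (hv3 : 3 ≤ v.length) (huv : ∀ a, u.count a = 1 ↔ v.count a = 1) : δ u v := by
  let N : List ℕ → List ℕ := fun u => u.filter fun a => u.count a ≠ 1
  have hN : ∀ (u : List ℕ) (a : ℕ), (N u).count a = if u.count a = 1 then 0 else u.count a := by
    intro u a
    simp only [N, count_filter_ite]
    by_cases ha : u.count a = 1 <;> simp [ha]
  have hNne : ∀ {u : List ℕ}, ¬ u.Nodup → N u ≠ [] := by
    intro u hu
    obtain ⟨x, hx⟩ := exists_two_le_count hu
    refine List.ne_nil_of_mem (a := x) (List.count_pos_iff.1 ?_)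
    rw [hN, if_neg (by omega)]; omega
  have hNr : ∀ {u : List ℕ}, ¬ u.Nodup → 3 ≤ u.length → θ u (u ++ lpow r (N u)) := by
    intro u hu h3
    refine hθ.count_congr_of_three_le h3 (by simp; omega) fun a => ?_
    rw [List.count_append, count_lpow, hN]
    split_ifs with ha
    · simp
    · by_cases h0 : u.count a = 0
      · simp [h0]
      · exact Or.inr ⟨by omega, by omega, by simp [Nat.ModEq]⟩
  have hpq : SameLetters (N u) (N v) ∨ ¬ SameLetters u v := by
    by_cases hs : SameLetters u v
    · refine Or.inl fun a => ?_
      have hsa := hs a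
      rw [← List.count_pos_iff, ← List.count_pos_iff] at hsa ⊢
      rw [hN, hN]
      have := huv a
      split_ifs <;> omega
    · exact Or.inr hs
  have hqp : SameLetters (N v) (N u) ∨ ¬ SameLetters v u :=
    hpq.imp (fun h a => (h a).symm) fun h h' => h fun a => (h' a).symm
  have h1 := c.lpow_append_lpow h (hNne hu) (hNne hv) hpq
  have h2 := c.lpow_append_lpow (c.invε.symm h) (hNne hv) (hNne hu) hqp
  refine c.invδ.trans (relSup_left (hNr hu hu3)) (c.invδ.trans (c.invδ.append (c.invδ.refl u) h1)
    (c.invδ.trans ?_ (c.invδ.symm (c.invδ.trans (relSup_left (hNr hv hv3))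
      (c.invδ.append (c.invδ.refl v) h2)))))
  refine c.invδ.of_count_sub_mem_expDiff c.permδ c.mod.one_le c.periodδ fun a => ?_
  simp only [List.count_append, count_lpow]
  have hc := c.count_sub_mem_expDiff h a
  have ha := huv a
  by_cases h3 : (N u).count a = 0 ∧ (N v).count a = 0
  · have h4 := h3.1
    have h5 := h3.2
    rw [hN] at h4 h5
    refine Or.inl ?_
    rw [h3.1, h3.2]
    split_ifs at h4 h5 <;> omega
  · right
    have h4 : r ≤ r * (N u).count a + r * (N v).count a := by
      rw [← mul_add]; exact Nat.le_mul_of_pos_right _ (by omega)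
    refine ⟨by omega, by omega, ?_⟩
    convert hc using 1
    push_cast; ring

theorem modular_of_three_le (c : ModularTriple θ β γ r) (hθ : StrongModPeriod θ r)
    {u v : List ℕ} (h : ε u v) (hu : ¬ u.Nodup) (hv : ¬ v.Nodup) (hu3 : 3 ≤ u.length)
    (hv3 : 3 ≤ v.length) : δ u v := by
  have h1r := c.mod.one_le
  obtain ⟨u', hu', hun, hul, huc⟩ := c.exists_expand hθ h hu hu3
  have h1 : ε v u' := c.invε.trans (c.invε.symm h) (c.upper_of_lower hu')
  obtain ⟨v', hv', hvn, hvl, hvc⟩ := c.exists_expand hθ h1 hv hv3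
  have h2 : ε u' v' := c.invε.trans (c.invε.symm h1) (c.upper_of_lower hv')
  refine c.invδ.trans hu' (c.invδ.trans
    (c.modular_of_count_eq_one_iff hθ h2 hun hvn hul hvl fun a => ?_) (c.invδ.symm hv'))
  rw [hvc, huc]
  split_ifs <;> omega

/-- The modular law when `x²y = x²⁺ʳy` holds. -/
theorem modular_of_strongModPeriod (c : ModularTriple θ β γ r) (hθ : StrongModPeriod θ r)
    {u v : List ℕ} (hu : u ≠ []) (h : ε u v) : δ u v := by
  have h4 := c.mod.four_le
  by_cases hp : u.Perm v
  · exact c.permδ hp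
  have key : ∀ {u v : List ℕ}, u ≠ [] → ε u v → ¬ u.Perm v →
      ∃ w, δ u w ∧ ¬ w.Nodup ∧ 3 ≤ w.length := by
    intro u v hu h hp
    have hpow : ¬ (lpow (1 + r) u).Nodup ∧ 3 ≤ (lpow (1 + r) u).length := by
      have hl := List.length_pos_of_ne_nil hu
      obtain ⟨a, ha⟩ := List.exists_mem_of_ne_nil u hu
      have hc := List.count_pos_iff.2 ha
      refine ⟨not_nodup_of_two_le_count (a := a) ?_, ?_⟩
      · rw [count_lpow]; nlinarith
      · rw [length_lpow]; nlinarith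
    by_cases hn : u.Nodup
    · exact ⟨_, c.nodup_rel_lpow h hn hp, hpow⟩
    by_cases hl : 3 ≤ u.length
    · exact ⟨u, c.invδ.refl u, hn, hl⟩
    obtain ⟨a, ha⟩ := exists_two_le_count hn
    have hle : u.count a ≤ u.length := List.count_le_length
    have hua : u = List.replicate 2 a := by
      rw [List.eq_replicate_iff]
      exact ⟨by omega, fun b hb => (List.count_eq_length.1 (by omega) b hb).symm⟩
    subst hua
    exact ⟨_, c.replicate_rel_lpow (by omega) h fun hv => hp (hv ▸ List.Perm.refl _), hpow⟩
  obtain ⟨u', hu', hun, hul⟩ := key hu h hp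
  obtain ⟨v', hv', hvn, hvl⟩ := key (c.ne_nil h hu) (c.invε.symm h) fun h => hp h.symm
  exact c.invδ.trans hu' (c.invδ.trans (c.modular_of_three_le hθ (c.invε.trans
    (c.invε.symm (c.upper_of_lower hu')) (c.invε.trans h (c.upper_of_lower hv'))) hun hvn hul hvl)
    (c.invδ.symm hv'))

end

end ModularTriple

/-- The word `0ⁱ1ʲ`. -/
def twoLetter (i j : ℕ) : List ℕ := List.replicate i 0 ++ List.replicate j 1

theorem count_twoLetter (i j a : ℕ) :
    (twoLetter i j).count a = if a = 0 then i else if a = 1 then j else 0 := by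
  rw [twoLetter, List.count_append, count_replicate_ite, count_replicate_ite]
  split_ifs <;> omega

theorem perm_twoLetter {l : List ℕ} (h : ∀ a, a ∈ l → a = 0 ∨ a = 1) :
    l.Perm (twoLetter (l.count 0) (l.count 1)) := by
  refine List.perm_iff_count.2 fun a => ?_
  rw [count_twoLetter]
  split_ifs with h0 h1
  · rw [h0]
  · rw [h1]
  · exact List.count_eq_zero_of_not_mem fun ha => (h a ha).elim h0 h1

namespace FullyInvariant

variable {R : List ℕ → List ℕ → Prop}

theorem twoLetter_mul (hR : FullyInvariant R) (hperm : ∀ {a b : List ℕ}, a.Perm b → R a b)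
    {i j k l : ℕ} (h : R (twoLetter i j) (twoLetter k l)) (m n : ℕ) :
    R (twoLetter (i + m) (j + n)) (twoLetter (k + m) (l + n)) := by
  refine hR.of_perm_append hperm (twoLetter m n) h ?_ ?_ <;>
    refine List.perm_iff_count.2 fun a => ?_ <;>
    simp only [List.count_append, count_twoLetter] <;> split_ifs <;> rfl

theorem twoLetter_swap (hR : FullyInvariant R) (hperm : ∀ {a b : List ℕ}, a.Perm b → R a b)
    {i j k l : ℕ} (h : R (twoLetter i j) (twoLetter k l)) :
    R (twoLetter j i) (twoLetter l k) := by
  have h1 := hR.subst (fun a => if a = 0 then [1] else [0]) (by intro a; split <;> simp) h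
  simp only [twoLetter, List.flatMap_append, flatMap_replicate, if_true, lpow_singleton,
    one_ne_zero, if_false] at h1
  exact hR.trans (hperm List.perm_append_comm) (hR.trans h1 (hperm List.perm_append_comm))

theorem twoLetter_double (hR : FullyInvariant R) {i j k l : ℕ}
    (h : R (twoLetter i j) (twoLetter k l)) : R (twoLetter i (2 * j)) (twoLetter k (2 * l)) := by
  have h1 := hR.subst (fun a => if a = 0 then [0] else [1, 1]) (by intro a; split <;> simp) h
  have h2 : ∀ n, lpow n [1, 1] = List.replicate (2 * n) 1 := by
    intro n
    induction n with
    | zero => rfl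
    | succ n ih => rw [lpow_succ, ih, Nat.mul_succ, Nat.add_comm, List.replicate_add]; rfl
  simpa only [twoLetter, List.flatMap_append, flatMap_replicate, if_true, lpow_singleton,
    one_ne_zero, if_false, h2] using h1

theorem sq_mul_period_of_two_le (hR : FullyInvariant R)
    (hperm : ∀ {a b : List ℕ}, a.Perm b → R a b) {i j : ℕ}
    (h : R (twoLetter 2 1) (twoLetter (i + 2) (j + 2))) :
    R (twoLetter 2 1) (twoLetter (2 + (j + 1)) 1) := by
  have h1 := hR.twoLetter_double h
  have h2 := hR.twoLetter_mul hperm h 0 (j + 2)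
  have h3 : R (twoLetter 2 2) (twoLetter 2 (j + 3)) := by
    refine hR.trans h1 (hR.symm ?_)
    convert h2 using 2 <;> omega
  have h4 := hR.twoLetter_mul hperm (hR.twoLetter_swap hperm h3) i j
  have h5 := hR.twoLetter_mul hperm h (j + 1) 0
  refine hR.trans h (hR.symm (hR.trans h5 (hR.symm ?_)))
  convert h4 using 2 <;> omega

/-- If `x²y` is not an isoterm for a commutative relation then `x²y = xy²` or
`x²y = x²⁺ʳy` holds. -/
theorem sq_mul_cases (hR : FullyInvariant R) (hperm : ∀ {a b : List ℕ}, a.Perm b → R a b)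
    {w : List ℕ} (h : R [0, 0, 1] w) (hw : ¬ w.Perm [0, 0, 1]) :
    R [0, 0, 1] [0, 1, 1] ∨ ∃ r, 1 ≤ r ∧ R [0, 0, 1] (List.replicate (2 + r) 0 ++ [1]) := by
  change R (twoLetter 2 1) (twoLetter 1 2) ∨ ∃ r, 1 ≤ r ∧ R (twoLetter 2 1) (twoLetter (2 + r) 1)
  by_cases hz : ∃ z ∈ w, z ≠ 0 ∧ z ≠ 1
  · obtain ⟨z, hz, hz0, hz1⟩ := hz
    have h1 := hR.subst (fun i => if i = z then [z, 0] else [i]) (by intro i; split <;> simp) h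
    rw [flatMap_eq_self (l := [0, 0, 1]) (by simp; omega)] at h1
    have h2 : (w.flatMap fun i => if i = z then [z, 0] else [i]).Perm
        (w ++ List.replicate (w.count z) 0) := by
      clear h1 h hw hz
      induction w with
      | nil => simp
      | cons a w ih =>
        refine List.perm_iff_count.2 fun x => ?_
        have := ih.count_eq x
        simp only [List.flatMap_cons, List.count_append, List.count_cons, count_replicate_ite] at *
        rw [this]
        by_cases ha : a = z
        · subst ha
          simp only [if_true, List.count_cons, List.count_nil, beq_iff_eq, beq_self_eq_true]
          split_ifs <;> omega
        · simp only [ha, if_false, List.count_cons, List.count_nil, beq_iff_eq]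
          split_ifs <;> omega
    refine Or.inr ⟨w.count z, List.count_pos_iff.2 hz, ?_⟩
    refine hR.trans h1 (hR.trans (hperm h2) (hR.symm ?_))
    refine hR.of_perm_append hperm _ h ?_ (List.Perm.refl _)
    refine List.perm_iff_count.2 fun x => ?_
    rw [count_twoLetter, List.count_append, count_replicate_ite,
      show [0, 0, 1] = twoLetter 2 1 from rfl, count_twoLetter]
    split_ifs <;> omega
  push Not at hz
  have hwp := perm_twoLetter fun a ha => or_iff_not_imp_left.2 (hz a ha)
  have h1 : R (twoLetter 2 1) (twoLetter (w.count 0) (w.count 1)) := hR.trans h (hperm hwp)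
  by_cases h00 : w.count 0 = 0
  · have h2 := hR.twoLetter_swap hperm (hR.twoLetter_double (hR.twoLetter_swap hperm h1))
    rw [h00] at h1 h2
    exact Or.inr ⟨2, by omega, hR.trans h1 (hR.symm h2)⟩
  by_cases h10 : w.count 1 = 0
  · have h2 := hR.subst (fun i => if i = 0 then [0] else [1, 0]) (by intro i; split <;> simp) h1
    rw [h10] at h1 h2
    simp only [twoLetter, List.flatMap_append, flatMap_replicate, if_true, lpow_singleton,
      one_ne_zero, if_false, List.replicate_zero, List.append_nil, lpow_one] at h1 h2
    refine Or.inr ⟨1, le_rfl, hR.trans h1 (hR.trans (hR.symm h2) (hperm ?_))⟩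
    decide
  have h21 : ¬ (w.count 0 = 2 ∧ w.count 1 = 1) := by
    rintro ⟨h2, h3⟩
    rw [h2, h3] at hwp
    exact hw hwp
  obtain ⟨a, ha⟩ : ∃ a, w.count 0 = a + 1 := ⟨w.count 0 - 1, by omega⟩
  obtain ⟨b, hb⟩ : ∃ b, w.count 1 = b + 1 := ⟨w.count 1 - 1, by omega⟩
  rw [ha, hb] at h1 h21
  rcases b with _ | b
  · rcases a with _ | _ | a
    · exact Or.inr ⟨1, le_rfl, hR.symm (hR.twoLetter_mul hperm h1 1 0)⟩
    · exact absurd ⟨rfl, rfl⟩ h21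
    · exact Or.inr ⟨a + 1, by omega, by convert h1 using 2; omega⟩
  · rcases a with _ | a
    · rcases b with _ | b
      · exact Or.inl h1
      · have h2 := hR.twoLetter_mul hperm (hR.twoLetter_swap hperm h1) 0 (b + 1)
        have h3 : R (twoLetter 2 1) (twoLetter (b + 1 + 2) (b + 2)) := by
          refine hR.trans h1 ?_
          convert h2 using 2 <;> omega
        exact Or.inr ⟨_, by omega, hR.sq_mul_period_of_two_le hperm h3⟩
    · exact Or.inr ⟨_, by omega, hR.sq_mul_period_of_two_le hperm h1⟩

end FullyInvariant

/-- Words of length at least four, and cubes of letters. -/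
def Big (l : List ℕ) : Prop := 4 ≤ l.length ∨ ∃ a, l = List.replicate 3 a

/-- The relation identifying all big words with one another and, among the others, words of the
same length with the same letters. -/
def bigRel (l l' : List ℕ) : Prop := (l.length = l'.length ∧ SameLetters l l') ∨ (Big l ∧ Big l')

theorem Big.three_le {l : List ℕ} (h : Big l) : 3 ≤ l.length := by
  rcases h with h | ⟨a, rfl⟩
  · omega
  · simp

theorem Big.of_sameLetters {l l' : List ℕ} (h : Big l) (hl : l.length = l'.length)
    (hs : SameLetters l l') : Big l' := by
  rcases h with h | ⟨a, rfl⟩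
  · exact Or.inl (by omega)
  · refine Or.inr ⟨a, List.eq_replicate_iff.2 ⟨by simpa using hl.symm, fun b hb => ?_⟩⟩
    exact List.eq_of_mem_replicate ((hs b).2 hb)

theorem Big.append {l m : List ℕ} (h : Big l ∨ Big m) (hl : l ≠ []) (hm : m ≠ []) :
    Big (l ++ m) := by
  have h1 := List.length_pos_of_ne_nil hl
  have h2 := List.length_pos_of_ne_nil hm
  refine Or.inl ?_
  rw [List.length_append]
  rcases h with h | h <;> have := h.three_le <;> omega

theorem bigRel.nil {b : List ℕ} (h : bigRel [] b) : b = [] := by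
  rcases h with h | h
  · exact List.eq_nil_of_length_eq_zero h.1.symm
  · exact absurd h.1.three_le (by simp)

theorem bigRel_fullyInvariant : FullyInvariant bigRel where
  refl a := Or.inl ⟨rfl, fun _ => Iff.rfl⟩
  symm h := h.imp (fun h => ⟨h.1.symm, fun x => (h.2 x).symm⟩) And.symm
  trans := by
    rintro a b c (h | h) (k | k)
    · exact Or.inl ⟨h.1.trans k.1, fun x => (h.2 x).trans (k.2 x)⟩
    · exact Or.inr ⟨k.1.of_sameLetters h.1.symm fun x => (h.2 x).symm, k.2⟩
    · exact Or.inr ⟨h.1, h.2.of_sameLetters k.1 k.2⟩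
    · exact Or.inr ⟨h.1, k.2⟩
  nil := bigRel.nil
  append := by
    have symm : ∀ {a b}, bigRel a b → bigRel b a :=
      fun h => h.imp (fun h => ⟨h.1.symm, fun x => (h.2 x).symm⟩) And.symm
    intro a b c d h k
    by_cases ha : a = []
    · subst ha; obtain rfl := h.nil; exact k
    by_cases hc : c = []
    · subst hc; obtain rfl := k.nil; simpa using h
    have hb : b ≠ [] := by rintro rfl; exact ha (symm h).nil
    have hd : d ≠ [] := by rintro rfl; exact hc (symm k).nil
    rcases h with h | h
    · rcases k with k | k
      · exact Or.inl ⟨by simp [h.1, k.1], fun x => by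
          rw [List.mem_append, List.mem_append, h.2 x, k.2 x]⟩
      · exact Or.inr ⟨Big.append (Or.inr k.1) ha hc, Big.append (Or.inr k.2) hb hd⟩
    · exact Or.inr ⟨Big.append (Or.inl h.1) ha hc, Big.append (Or.inl h.2) hb hd⟩
  subst := by
    have hbig : ∀ {a : List ℕ} (σ : ℕ → List ℕ), (∀ i, σ i ≠ []) → Big a → Big (a.flatMap σ) := by
      intro a σ hσ h
      have hle := length_le_length_flatMap hσ a
      rcases h with h | ⟨x, rfl⟩
      · exact Or.inl (by omega)
      · have hx := List.length_pos_of_ne_nil (hσ x)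
        rw [flatMap_replicate]
        by_cases hx1 : (σ x).length = 1
        · obtain ⟨y, hy⟩ := List.length_eq_one_iff.1 hx1
          exact Or.inr ⟨y, by rw [hy, lpow_singleton]⟩
        · refine Or.inl ?_
          rw [length_lpow]; omega
    have hgrow : ∀ {a : List ℕ} (σ : ℕ → List ℕ), (∀ i, σ i ≠ []) → ∀ x ∈ a, (σ x).length ≠ 1 →
        3 ≤ a.length → 4 ≤ (a.flatMap σ).length := by
      intro a σ hσ x hx hx1 ha
      obtain ⟨s, t, rfl⟩ := List.append_of_mem hx
      have h1 := length_le_length_flatMap hσ s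
      have h2 := length_le_length_flatMap hσ t
      have h3 := List.length_pos_of_ne_nil (hσ x)
      simp only [List.flatMap_append, List.flatMap_cons, List.length_append,
        List.length_cons] at *
      omega
    rintro a b σ hσ (h | h)
    · by_cases h3 : 3 ≤ a.length
      · by_cases hx : ∃ x ∈ a, (σ x).length ≠ 1
        · obtain ⟨x, hx, hx1⟩ := hx
          exact Or.inr ⟨Or.inl (hgrow σ hσ x hx hx1 h3),
            Or.inl (hgrow σ hσ x ((h.2 x).1 hx) hx1 (h.1 ▸ h3))⟩
        · push Not at hx
          have hlen : ∀ l : List ℕ, (∀ x ∈ l, (σ x).length = 1) →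
              (l.flatMap σ).length = l.length := by
            intro l hl
            induction l with
            | nil => rfl
            | cons y l ih =>
              rw [List.flatMap_cons, List.length_append, hl y (by simp),
                ih fun x hx => hl x (List.mem_cons_of_mem _ hx), List.length_cons, Nat.add_comm]
          refine Or.inl ⟨?_, sameLetters_fullyInvariant.subst σ hσ h.2⟩
          rw [hlen a hx, hlen b fun x hxb => hx x ((h.2 x).2 hxb), h.1]
      · have hp : a.Perm b := by
          rcases a with _ | ⟨x, _ | ⟨y, _ | ⟨z, a⟩⟩⟩
          · rw [List.eq_nil_of_length_eq_zero h.1.symm]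
          · obtain ⟨y, rfl⟩ := List.length_eq_one_iff.1 h.1.symm
            have := (h.2 x).1 (by simp)
            simp at this
            rw [this]
          · obtain ⟨u, v, rfl⟩ := List.length_eq_two.1 h.1.symm
            have h1 := h.2 x
            have h2 := h.2 y
            have h4 := h.2 u
            have h5 := h.2 v
            simp only [List.mem_cons, List.not_mem_nil, or_false, true_or, or_true, true_iff,
              iff_true] at h1 h2 h4 h5
            refine List.perm_iff_count.2 fun c => ?_
            simp only [List.count_cons, List.count_nil, beq_iff_eq]
            split_ifs <;> omega
          · simp at h3
        have hp' := hp.flatMap_right σ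
        exact Or.inl ⟨hp'.length_eq, fun x => hp'.mem_iff⟩
    · exact Or.inr ⟨hbig σ hσ h.1, hbig σ hσ h.2⟩

/-- The theory of abelian groups of exponent dividing `q`. -/
def abelianRel (q : ℕ) (l l' : List ℕ) : Prop :=
  (l = [] ↔ l' = []) ∧ ∀ f : ℕ → ZMod q, (l.map f).sum = (l'.map f).sum

theorem abelianRel_of_perm (q : ℕ) {l l' : List ℕ} (h : l.Perm l') : abelianRel q l l' :=
  ⟨by rw [← List.length_eq_zero_iff, ← List.length_eq_zero_iff, h.length_eq],
    fun f => (h.map f).sum_eq⟩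

theorem abelianRel_fullyInvariant (q : ℕ) : FullyInvariant (abelianRel q) where
  refl _ := ⟨Iff.rfl, fun _ => rfl⟩
  symm h := ⟨h.1.symm, fun f => (h.2 f).symm⟩
  trans h k := ⟨h.1.trans k.1, fun f => (h.2 f).trans (k.2 f)⟩
  append h k := ⟨by rw [List.append_eq_nil_iff, List.append_eq_nil_iff, h.1, k.1], fun f => by
    rw [List.map_append, List.map_append, List.sum_append, List.sum_append, h.2, k.2]⟩
  subst := by
    intro a b σ hσ h
    have key : ∀ (f : ℕ → ZMod q) (l : List ℕ),
        ((l.flatMap σ).map f).sum = (l.map fun i => ((σ i).map f).sum).sum := by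
      intro f l
      induction l with
      | nil => rfl
      | cons x l ih => simp [ih]
    have hnil : ∀ l : List ℕ, l.flatMap σ = [] ↔ l = [] := by
      intro l
      rw [List.flatMap_eq_nil_iff]
      exact ⟨fun h => List.eq_nil_iff_forall_not_mem.2 fun x hx => hσ x (h x hx),
        fun h => by simp [h]⟩
    exact ⟨by rw [hnil, hnil, h.1], fun f => by rw [key, key, h.2]⟩
  nil h := h.1.1 rfl

theorem abelianRel_twoLetter {q i j k l : ℕ} (h : i + j ≠ 0 ∧ k + l ≠ 0)
    (hi : (i : ZMod q) = k) (hj : (j : ZMod q) = l) :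
    abelianRel q (twoLetter i j) (twoLetter k l) := by
  refine ⟨?_, fun f => by simp [twoLetter, hi, hj]⟩
  simp only [twoLetter, List.append_eq_nil_iff, List.replicate_eq_nil_iff]
  omega

theorem abelianRel.count_eq {q : ℕ} {l l' : List ℕ} (h : abelianRel q l l') (a : ℕ) :
    (l.count a : ZMod q) = l'.count a := by
  have key : ∀ l : List ℕ, (l.map fun i => if i = a then (1 : ZMod q) else 0).sum = l.count a := by
    intro l
    induction l with
    | nil => simp
    | cons x l ih =>
      rw [List.map_cons, List.sum_cons, ih, List.count_cons]
      by_cases hx : x = a <;> simp [hx, add_comm]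
  rw [← key, ← key, h.2]

namespace FullyInvariant

variable {R : List ℕ → List ℕ → Prop}

theorem length_and_count_of_isoterm (hR : FullyInvariant R)
    (hperm : ∀ {a b : List ℕ}, a.Perm b → R a b) (hiso : ∀ w, R [0, 0, 1] w → w.Perm [0, 0, 1])
    {p q : List ℕ} (h : R p q) (hp : p.length = 3) {y : ℕ} (hy : p.count y = 1 ∨ p.count y = 2) :
    q.length = 3 ∧ q.count y = p.count y := by
  have key : ∀ (a b : ℕ) (l : List ℕ), ∃ k, l.length = k + l.count y ∧
      (l.flatMap fun i => if i = y then [b] else [a]).Perm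
        (List.replicate k a ++ List.replicate (l.count y) b) := by
    intro a b l
    induction l with
    | nil => exact ⟨0, by simp⟩
    | cons x l ih =>
      obtain ⟨k, hk, hl⟩ := ih
      by_cases hx : x = y
      · subst hx
        refine ⟨k, by simp [hk]; omega, ?_⟩
        rw [List.count_cons_self, List.flatMap_cons, if_pos rfl, List.replicate_succ]
        exact (hl.cons b).trans List.perm_middle.symm
      · refine ⟨k + 1, by simp [hk, hx]; omega, ?_⟩
        rw [List.count_cons_of_ne (by simpa using hx), List.flatMap_cons, if_neg hx,
          List.replicate_succ]
        exact hl.cons a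
  have main : ∀ a b : ℕ, List.Perm (List.replicate (3 - p.count y) a ++
      List.replicate (p.count y) b) [0, 0, 1] → a ≠ b → q.length = 3 ∧ q.count y = p.count y := by
    intro a b hab hne
    obtain ⟨k, hk, hpk⟩ := key a b p
    obtain ⟨m, hm, hqm⟩ := key a b q
    obtain rfl : k = 3 - p.count y := by omega
    have h1 := hR.subst (fun i => if i = y then [b] else [a]) (by intro i; split <;> simp) h
    have h2 := hiso _ (hR.trans (hperm (hpk.trans hab).symm) (hR.trans h1 (hperm hqm)))
    have h3 := h2.length_eq
    have h4 := (h2.trans hab.symm).count_eq b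
    simp only [List.length_append, List.length_replicate, List.length_cons, List.length_nil] at h3
    simp only [List.count_append, count_replicate_ite, if_true, Ne.symm hne, if_false] at h4
    omega
  rcases hy with hy | hy
  · exact main 0 1 (by rw [hy]; decide) (by simp)
  · exact main 1 0 (by rw [hy]; decide) (by simp)

theorem perm_of_isoterm_of_length_eq_three (hR : FullyInvariant R)
    (hperm : ∀ {a b : List ℕ}, a.Perm b → R a b) (hiso : ∀ w, R [0, 0, 1] w → w.Perm [0, 0, 1])
    {p q : List ℕ} (h : R p q) (hp : p.length = 3) (hpb : ¬ Big p) : p.Perm q := by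
  obtain ⟨y, hy⟩ : ∃ y, p.count y = 1 := by
    obtain ⟨a, b, c, rfl⟩ := List.length_eq_three.1 hp
    by_cases hab : a = b
    · have hc : c ≠ b := by
        rintro rfl
        exact hpb (Or.inr ⟨c, by rw [hab]; rfl⟩)
      exact ⟨c, by simp [hab, Ne.symm hc]⟩
    · by_cases hac : a = c
      · exact ⟨b, by simp [hab, ← hac]⟩
      · exact ⟨a, by simp [Ne.symm hab, Ne.symm hac]⟩
  refine List.perm_iff_count.2 fun x => ?_
  have hle : p.count x ≤ p.length := List.count_le_length
  have h3 : p.count x ≠ 3 := by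
    intro hx
    refine hpb (Or.inr ⟨x, List.eq_replicate_iff.2 ⟨hp, fun b hb => ?_⟩⟩)
    exact (List.count_eq_length.1 (by omega) b hb).symm
  by_cases hx : p.count x = 0
  · have h1 := hR.subst (fun i => if i = x then [x, x] else [i]) (by intro i; split <;> simp) h
    rw [flatMap_eq_self (l := p) fun i hi => if_neg
      (ne_of_mem_of_not_mem hi (List.count_eq_zero.1 hx))] at h1
    have h2 := (hR.length_and_count_of_isoterm hperm hiso h hp (Or.inl hy)).1
    have h4 := (hR.length_and_count_of_isoterm hperm hiso h1 hp (Or.inl hy)).1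
    have h5 : ∀ l : List ℕ, (l.flatMap fun i => if i = x then [x, x] else [i]).length =
        l.length + l.count x := by
      intro l
      induction l with
      | nil => rfl
      | cons z l ih =>
        rw [List.flatMap_cons, List.length_append, ih, List.count_cons, List.length_cons]
        by_cases hz : z = x <;> simp [hz] <;> omega
    rw [h5] at h4
    omega
  · exact (hR.length_and_count_of_isoterm hperm hiso h hp (by omega)).2.symm

theorem perm_of_isoterm (hR : FullyInvariant R) (hperm : ∀ {a b : List ℕ}, a.Perm b → R a b)
    (hiso : ∀ w, R [0, 0, 1] w → w.Perm [0, 0, 1]) {p q : List ℕ} (h : R p q) (hpb : ¬ Big p) :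
    p.Perm q := by
  have hlt : p.length < 4 := by
    by_contra hc
    exact hpb (Or.inl (by omega))
  by_cases h3 : p.length = 3
  · exact hR.perm_of_isoterm_of_length_eq_three hperm hiso h h3 hpb
  by_cases h0 : p = []
  · subst h0; rw [hR.nil h]
  obtain ⟨m, hm⟩ := Infinite.exists_notMem_finset p.toFinset
  rw [List.mem_toFinset] at hm
  have hl := List.length_pos_of_ne_nil h0
  refine (List.perm_append_right_iff (List.replicate (3 - p.length) m)).1
    (hR.perm_of_isoterm_of_length_eq_three hperm hiso (hR.append h (hR.refl _)) ?_ ?_)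
  · simp; omega
  · rintro (hb | ⟨a, ha⟩)
    · simp at hb; omega
    · have h1 : ∀ x ∈ p ++ List.replicate (3 - p.length) m, x = a := fun x hx =>
        List.eq_of_mem_replicate (ha ▸ hx)
      obtain ⟨z, hz⟩ := List.exists_mem_of_ne_nil p h0
      have h2 := h1 z (List.mem_append_left _ hz)
      have h4 := h1 m (List.mem_append_right _ (List.mem_replicate.2 ⟨by omega, rfl⟩))
      exact hm (h4.trans h2.symm ▸ hz)

theorem bigRel_of_isoterm (hR : FullyInvariant R) (hperm : ∀ {a b : List ℕ}, a.Perm b → R a b)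
    (hiso : ∀ w, R [0, 0, 1] w → w.Perm [0, 0, 1]) {p q : List ℕ} (h : R p q) : bigRel p q := by
  have key : p.Perm q → bigRel p q := fun hp => Or.inl ⟨hp.length_eq, fun x => hp.mem_iff⟩
  by_cases hp : Big p
  · by_cases hq : Big q
    · exact Or.inr ⟨hp, hq⟩
    · exact key (hR.perm_of_isoterm hperm hiso (hR.symm h) hq).symm
  · exact key (hR.perm_of_isoterm hperm hiso h hp)

/-- If `x²y` is an isoterm, the modular law fails. -/
theorem not_modular_of_isoterm (hR : FullyInvariant R)
    (hperm : ∀ {a b : List ℕ}, a.Perm b → R a b) (hiso : ∀ w, R [0, 0, 1] w → w.Perm [0, 0, 1])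
    {N r : ℕ} (hr : 1 ≤ r) (h : R (List.replicate N 0) (List.replicate (N + r) 0)) :
    relInf bigRel (relSup R (abelianRel (r + 1))) [0, 0, 1] [0, 1, 1] ∧
      ¬ relSup R (relInf bigRel (abelianRel (r + 1))) [0, 0, 1] [0, 1, 1] := by
  have hz : (r : ZMod (r + 1)) = -1 := by
    have := ZMod.natCast_self (r + 1)
    push_cast at this
    exact eq_neg_of_add_eq_zero_left this
  constructor
  · refine ⟨Or.inl ⟨rfl, fun x => by simp⟩, ?_⟩
    have hN : N ≤ N * (r + 1) := Nat.le_mul_of_pos_right _ (by omega)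
    have h1 := hR.replicate_period h (M := 2 + N * (r + 1)) (by omega) 1
    have h2 := hR.replicate_period h (M := 1 + N * (r + 1)) (by omega) r
    have h3 : R (twoLetter (2 + N * (r + 1)) (1 + N * (r + 1)))
        (twoLetter (2 + N * (r + 1) + 1 * r) (1 + N * (r + 1) + r * r)) :=
      hR.append h1 (hR.replicate_letter h2 1)
    have h4 : abelianRel (r + 1) (twoLetter 2 1)
        (twoLetter (2 + N * (r + 1)) (1 + N * (r + 1))) := by
      refine abelianRel_twoLetter (by omega) ?_ ?_ <;> push_cast <;> rw [hz] <;> ring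
    have h5 : abelianRel (r + 1)
        (twoLetter (2 + N * (r + 1) + 1 * r) (1 + N * (r + 1) + r * r)) (twoLetter 1 2) := by
      refine abelianRel_twoLetter (by omega) ?_ ?_ <;> push_cast <;> rw [hz] <;> ring
    exact ((relSup_right h4).trans (relSup_left h3)).trans (relSup_right h5)
  · intro hc
    obtain ⟨s, t, hs, ht, hst⟩ := relSup_exit hc (fun l => l.Perm [0, 0, 1]) (List.Perm.refl _)
      (by decide)
    rcases hst with hst | ⟨hst, hst'⟩
    · exact ht (hiso t (hR.trans (hperm hs.symm) hst))
    · rcases hst with ⟨hl, hm⟩ | ⟨hb, -⟩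
      · have ht01 : ∀ x, x ∈ t ↔ x = 0 ∨ x = 1 := by
          intro x
          rw [← hm x, hs.mem_iff]
          simp
        have htp := perm_twoLetter fun x => (ht01 x).1
        have h0 := List.count_pos_iff.2 ((ht01 0).2 (by simp))
        have h1 := List.count_pos_iff.2 ((ht01 1).2 (by simp))
        have hlen := htp.length_eq
        rw [← hl, hs.length_eq] at hlen
        simp only [twoLetter, List.length_append, List.length_replicate, List.length_cons,
          List.length_nil] at hlen
        have hc0 := hst'.count_eq 0
        rw [hs.count_eq, show List.count 0 [0, 0, 1] = 2 from rfl] at hc0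
        by_cases hc1 : t.count 0 = 1
        · rw [hc1] at hc0
          have h10 : ((1 : ℕ) : ZMod (r + 1)) = 0 := by
            push_cast at hc0 ⊢
            linear_combination hc0
          rw [ZMod.natCast_eq_zero_iff] at h10
          have := Nat.le_of_dvd one_pos h10
          omega
        · refine ht ?_
          have e0 : t.count 0 = 2 := by omega
          have e1 : t.count 1 = 1 := by omega
          rw [e0, e1] at htp
          exact htp
      · rcases hb with hb | ⟨a, rfl⟩
        · rw [hs.length_eq] at hb; simp at hb
        · have e0 := hs.count_eq 0
          rw [count_replicate_ite, show List.count 0 [0, 0, 1] = 2 from rfl] at e0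
          split_ifs at e0
          omega

end FullyInvariant

theorem relSup_mono_right {R S T : List ℕ → List ℕ → Prop} (h : ∀ {a b}, S a b → T a b)
    {a b : List ℕ} (hab : relSup R S a b) : relSup R T a b := by
  induction hab with
  | refl => exact .refl
  | tail _ hbc ih => exact ih.tail (hbc.imp_right h)

namespace SgVariety

variable {V W : SgVariety}

theorem rel_mono (h : W.th ⊆ V.th) {a b : List ℕ} (hab : W.rel a b) : V.rel a b :=
  hab.imp_right fun ⟨e, he, h1, h2⟩ => ⟨e, h he, h1, h2⟩

theorem rel_of_perm (hV : commId ∈ V.th) {a b : List ℕ} (h : a.Perm b) : V.rel a b := by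
  have hR := V.rel_fullyInvariant
  induction h with
  | nil => exact hR.refl _
  | cons x _ ih => exact hR.append (hR.refl [x]) ih
  | swap x y l =>
    have h1 : V.rel [0, 1] [1, 0] := rel_letters.2 hV
    have h2 := hR.subst (fun i => if i = 0 then [y] else [x]) (by intro i; split <;> simp) h1
    exact hR.append h2 (hR.refl l)
  | trans _ _ ih1 ih2 => exact hR.trans ih1 ih2

/-- An identity of a meet is derived by alternating identities of the two varieties. -/
theorem relSup_of_mem_inf {u v : Word} (h : (u, v) ∈ (V ⊓ W).th) :
    relSup V.rel W.rel u.letters v.letters := by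
  refine (V.rel_fullyInvariant.sup W.rel_fullyInvariant).of_mem_eqTh (E := V.th ∪ W.th) ?_ h
  rintro e (he | he)
  · exact relSup_left (rel_letters.2 he)
  · exact relSup_right (rel_letters.2 he)

theorem mem_inf_of_relSup {u v : Word} (h : relSup V.rel W.rel u.letters v.letters) :
    (u, v) ∈ (V ⊓ W).th := by
  rw [← rel_letters]
  generalize u.letters = a at h
  generalize v.letters = b at h
  induction h with
  | refl => exact (V ⊓ W).rel_fullyInvariant.refl _
  | tail _ h ih =>
    refine (V ⊓ W).rel_fullyInvariant.trans ih ?_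
    rcases h with h | h
    · exact rel_mono (inf_le_left : V ⊓ W ≤ V) h
    · exact rel_mono (inf_le_right : V ⊓ W ≤ W) h

theorem rel_sup {a b : List ℕ} (h : (V ⊔ W).rel a b) : relInf V.rel W.rel a b :=
  ⟨rel_mono (le_sup_left : V ≤ V ⊔ W) h, rel_mono (le_sup_right : W ≤ V ⊔ W) h⟩

theorem rel_sup_of_relInf {a b : List ℕ} (h : relInf V.rel W.rel a b) : (V ⊔ W).rel a b := by
  obtain ⟨h1, h2⟩ := h
  by_cases ha : a = []
  · subst ha
    exact Or.inl (V.rel_fullyInvariant.nil h1).symm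
  · by_cases hb : b = []
    · subst hb
      exact absurd (V.rel_fullyInvariant.nil (V.rel_fullyInvariant.symm h1)) ha
    · obtain ⟨u, rfl⟩ := Word.exists_letters_eq ha
      obtain ⟨v, rfl⟩ := Word.exists_letters_eq hb
      exact rel_letters.2 ⟨rel_letters.1 h1, rel_letters.1 h2⟩

theorem rel_toVariety {R : List ℕ → List ℕ → Prop} (hR : FullyInvariant R) {a b : List ℕ} :
    hR.toVariety.rel a b ↔ R a b := by
  constructor
  · rintro (rfl | ⟨e, he, rfl, rfl⟩)
    · exact hR.refl _
    · exact he
  · intro h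
    by_cases ha : a = []
    · subst ha
      exact Or.inl (hR.nil h).symm
    · by_cases hb : b = []
      · subst hb
        exact absurd (hR.nil (hR.symm h)) ha
      · obtain ⟨u, rfl⟩ := Word.exists_letters_eq ha
        obtain ⟨v, rfl⟩ := Word.exists_letters_eq hb
        exact rel_letters.2 h

theorem isUpperModular_of_forall (h : ∀ B C : SgVariety, B ≤ V → ∀ u : List ℕ, u ≠ [] → ∀ v,
    relInf B.rel (relSup V.rel C.rel) u v → relSup V.rel (relInf B.rel C.rel) u v) :
    IsUpperModular V := by
  intro B C hB
  refine le_antisymm ?_ (sup_le (le_inf hB le_sup_left)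
    (le_inf inf_le_left (inf_le_right.trans le_sup_right)))
  rintro ⟨u, v⟩ ⟨h1, h2⟩
  have h3 := h B C hB _ u.letters_ne_nil _ ⟨rel_letters.2 h1, relSup_of_mem_inf h2⟩
  refine mem_inf_of_relSup (relSup_mono_right rel_sup_of_relInf h3)

end SgVariety

theorem mem_COMvar_of_perm {u v : Word} (h : u.letters.Perm v.letters) : (u, v) ∈ COMvar.th :=
  SgVariety.rel_letters.1 (SgVariety.rel_of_perm (subset_eqTh {commId} rfl) h)

theorem ComVariety.exists_replicate_rel {V : ComVariety} (hV : V ≠ COMcom) :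
    ∃ N r, 1 ≤ r ∧ V.1.rel (List.replicate N 0) (List.replicate (N + r) 0) := by
  have hR := V.1.rel_fullyInvariant
  obtain ⟨u, v, huv, hp⟩ : ∃ u v, V.1.rel u v ∧ ¬ u.Perm v := by
    by_contra! hc
    refine hV (Subtype.ext (SgVariety.ext' (Set.Subset.antisymm ?_ ?_)))
    · rintro ⟨u, v⟩ h
      exact mem_COMvar_of_perm (hc _ _ (SgVariety.rel_letters.2 h))
    · change eqTh {commId} ⊆ _
      exact (eqTh_mono (Set.singleton_subset_iff.2 V.2)).trans V.1.closed.subset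
  have key : ∀ i j, i ≠ j → V.1.rel (List.replicate i 0) (List.replicate j 0) →
      ∃ N r, 1 ≤ r ∧ V.1.rel (List.replicate N 0) (List.replicate (N + r) 0) := by
    intro i j hij h
    rcases Nat.lt_or_gt_of_ne hij with hlt | hlt
    · exact ⟨i, j - i, by omega, by rwa [Nat.add_sub_cancel' hlt.le]⟩
    · exact ⟨j, i - j, by omega, by rw [Nat.add_sub_cancel' hlt.le]; exact hR.symm h⟩
  by_cases hl : u.length = v.length
  · obtain ⟨a, ha⟩ : ∃ a, u.count a ≠ v.count a := by
      by_contra! hc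
      exact hp (List.perm_iff_count.2 hc)
    exact key _ _ (by omega) (hR.replicate_length_add_count huv a 0)
  · exact key _ _ hl (hR.replicate_length huv 0)

theorem ComVariety.sq_mul_cases {V : ComVariety} (hV : V ≠ COMcom) (h : IsUpperModular V) :
    V.1.rel [0, 0, 1] [0, 1, 1] ∨
      ∃ r, 1 ≤ r ∧ V.1.rel [0, 0, 1] (List.replicate (2 + r) 0 ++ [1]) := by
  have hR := V.1.rel_fullyInvariant
  have hperm : ∀ {a b : List ℕ}, a.Perm b → V.1.rel a b := SgVariety.rel_of_perm V.2
  by_cases hiso : ∀ w, V.1.rel [0, 0, 1] w → w.Perm [0, 0, 1]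
  · exfalso
    obtain ⟨N, r, hr, hN⟩ := ComVariety.exists_replicate_rel hV
    obtain ⟨⟨h1, h2⟩, h3⟩ := hR.not_modular_of_isoterm hperm hiso hr hN
    have hβ : ∀ {a b}, V.1.rel a b → bigRel a b := hR.bigRel_of_isoterm hperm hiso
    let B : ComVariety := ⟨bigRel_fullyInvariant.toVariety,
      hβ (hperm (List.Perm.swap _ _ _))⟩
    let C : ComVariety := ⟨(abelianRel_fullyInvariant (r + 1)).toVariety,
      abelianRel_of_perm _ (List.Perm.swap _ _ _)⟩
    have hBV : B ≤ V := fun e he => hβ (SgVariety.rel_letters.2 he)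
    have hm := congrArg (fun X : ComVariety => X.1.th) (h B C hBV)
    have hmem : (w_xxy, w_xyy) ∈ (B.1 ⊔ (V.1 ⊓ C.1)).th := by
      refine ⟨h1, SgVariety.mem_inf_of_relSup (relSup_mono_right (fun hab =>
        (SgVariety.rel_toVariety (abelianRel_fullyInvariant (r + 1))).2 hab) h2)⟩
    have hmem' : (w_xxy, w_xyy) ∈ (V.1 ⊓ (B.1 ⊔ C.1)).th := by
      rw [show (B.1 ⊔ (V.1 ⊓ C.1)).th = (V.1 ⊓ (B.1 ⊔ C.1)).th from hm.symm] at hmem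
      exact hmem
    refine h3 (relSup_mono_right (fun hab => ?_) (SgVariety.relSup_of_mem_inf hmem'))
    have hab := SgVariety.rel_sup hab
    exact ⟨(SgVariety.rel_toVariety bigRel_fullyInvariant).1 hab.1,
      (SgVariety.rel_toVariety (abelianRel_fullyInvariant (r + 1))).1 hab.2⟩
  · push Not at hiso
    obtain ⟨w, hw, hwp⟩ := hiso
    exact hR.sq_mul_cases hperm hw hwp

/-- A commutative semigroup variety `V ≠ COM` is an
upper-modular element of **Com** iff it is an upper-modular element of **SEM**
(the lattice of all semigroup varieties). -/
theorem upperModular_Com_iff_upperModular_SEM (V : ComVariety) (hV : V ≠ COMcom) :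
    IsUpperModular V ↔ IsUpperModular V.1 := by
  refine ⟨fun h => ?_, fun h B C hB => Subtype.ext (h B.1 C.1 hB)⟩
  have hperm : ∀ {a b : List ℕ}, a.Perm b → V.1.rel a b := SgVariety.rel_of_perm V.2
  refine SgVariety.isUpperModular_of_forall fun B C hB u hu v huv => ?_
  have triple : ∀ {r}, ModPeriod V.1.rel r → ModularTriple V.1.rel B.rel C.rel r := fun hr =>
    ⟨hr, B.rel_fullyInvariant, C.rel_fullyInvariant, SgVariety.rel_mono hB⟩
  rcases ComVariety.sq_mul_cases hV h with hc | ⟨r, hr, hc⟩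
  · exact (triple (V.1.rel_fullyInvariant.modPeriod_of_sq_mul_comm hperm hc)).modular_of_sq_mul_comm
      hc hu huv
  · have hs := V.1.rel_fullyInvariant.strongModPeriod hperm hr hc
    exact (triple hs.toModPeriod).modular_of_strongModPeriod hs hu huv
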